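/- For every fixed n ∈ ℕ there exist effectively computable constants A_{2n-1,n} ≠ 0, A_{2n-2,n}, …, A_{1,n}, A_{0,n} such that for X → ∞, Σ_{γ^{(1)}>0,…,γ^{(n)}>0} exp(−γ^{(1)}⋯γ^{(n)}/X) = X(A_{2n-1,n} log^{2n-1} X + ⋯ + A_{1,n} log X + A_{0,n}) + G^n(0) + O_ε(X^{ε−1}) for every ε > 0, where γ^{(1)},…,γ^{(n)} run independently over the positive ordinates of nontrivial zeros of ζ(s). -/

import Mathlib

open Complex Real MeasureTheory Set Filter

noncomputable section

/-- The multiplicity of `ρ` as a zero of the Riemann zeta function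
(the order of vanishing, i.e. the least `n` with `ζ⁽ⁿ⁾(ρ) ≠ 0`). -/
def zetaMult (ρ : ℂ) : ℕ := sInf {n : ℕ | iteratedDeriv n riemannZeta ρ ≠ 0}

/-- `ρ` is a nontrivial zero of the Riemann zeta function. -/
def IsNontrivialZero (ρ : ℂ) : Prop := riemannZeta ρ = 0 ∧ 0 < ρ.re ∧ ρ.re < 1

open scoped Topology

/-! ### Bounds for the Riemann zeta function -/

lemma hasDerivAt_ofReal_cpow_of_pos {x : ℝ} (hx : 0 < x) (c : ℂ) :
    HasDerivAt (fun y : ℝ ↦ (y : ℂ) ^ c) (c * (x : ℂ) ^ (c - 1)) x := by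
  have h := ((hasDerivAt_id (x : ℂ)).cpow_const (c := c) (by simp [hx])).comp_ofReal
  simpa using h

lemma norm_cpow_neg_sub_cpow_neg_le {a b : ℝ} (ha : 0 < a) (hab : a ≤ b) {s : ℂ}
    (hs : -1 ≤ s.re) :
    ‖(b : ℂ) ^ (-s) - (a : ℂ) ^ (-s)‖ ≤ ‖s‖ * a ^ (-s.re - 1) * (b - a) := by
  refine norm_image_sub_le_of_norm_deriv_le_segment'
    (f := fun y : ℝ ↦ (y : ℂ) ^ (-s)) (f' := fun y : ℝ ↦ -s * (y : ℂ) ^ (-s - 1))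
    (fun x hx ↦ (hasDerivAt_ofReal_cpow_of_pos (ha.trans_le hx.1) _).hasDerivWithinAt)
    (fun x hx ↦ ?_) b ⟨hab, le_rfl⟩
  rw [norm_mul, norm_neg, norm_cpow_eq_rpow_re_of_pos (ha.trans_le hx.1)]
  gcongr ?_ * ?_
  simp only [sub_re, neg_re, one_re]
  exact Real.rpow_le_rpow_of_nonpos ha hx.1 (by linarith)

/-- The `n`-th term of the telescoping series for `(s - 1) ζ(s) - 1`. -/
def zetaTerm (n : ℕ) (s : ℂ) : ℂ :=
  (s - 1) * ((n + 1 : ℝ) : ℂ) ^ (-s) + ((n + 1 + 1 : ℝ) : ℂ) ^ (1 - s) - ((n + 1 : ℝ) : ℂ) ^ (1 - s)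

lemma differentiable_zetaTerm (n : ℕ) : Differentiable ℂ (zetaTerm n) := by
  unfold zetaTerm
  have h (x : ℝ) (hx : 0 < x) : (x : ℂ) ≠ 0 := by exact_mod_cast hx.ne'
  have h1 := h (n + 1) (by positivity)
  have h2 := h (n + 1 + 1) (by positivity)
  intro s
  refine DifferentiableAt.sub (DifferentiableAt.add (DifferentiableAt.mul (by fun_prop) ?_) ?_) ?_
  · exact DifferentiableAt.const_cpow (by fun_prop) (Or.inl h1)
  · exact DifferentiableAt.const_cpow (by fun_prop) (Or.inl h2)
  · exact DifferentiableAt.const_cpow (by fun_prop) (Or.inl h1)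

lemma norm_zetaTerm_le (n : ℕ) {s : ℂ} (hs : 0 ≤ s.re) :
    ‖zetaTerm n s‖ ≤ ‖s - 1‖ * ‖s‖ * (n + 1 : ℝ) ^ (-s.re - 1) := by
  set N : ℝ := n + 1 with hN
  have hN0 : 0 < N := by positivity
  have key := norm_image_sub_le_of_norm_deriv_le_segment' (a := N) (b := N + 1)
    (f := fun x : ℝ ↦ (s - 1) * (N : ℂ) ^ (-s) * ((x : ℂ) - N) + (x : ℂ) ^ (1 - s))
    (f' := fun x : ℝ ↦ (s - 1) * (N : ℂ) ^ (-s) * 1 + (1 - s) * (x : ℂ) ^ (1 - s - 1))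
    (C := ‖s - 1‖ * ‖s‖ * N ^ (-s.re - 1))
    (fun x hx ↦ by
      refine HasDerivAt.hasDerivWithinAt (HasDerivAt.add (HasDerivAt.const_mul _ ?_) ?_)
      · exact (Complex.ofRealCLM.hasDerivAt (x := x)).sub_const _
      · exact hasDerivAt_ofReal_cpow_of_pos (hN0.trans_le hx.1) _)
    (fun x hx ↦ by
      have e : (s - 1) * (N : ℂ) ^ (-s) * 1 + (1 - s) * (x : ℂ) ^ (1 - s - 1)
          = -(s - 1) * ((x : ℂ) ^ (-s) - (N : ℂ) ^ (-s)) := by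
        rw [show 1 - s - 1 = -s by ring]; ring
      rw [e, norm_mul, norm_neg, mul_assoc]
      gcongr
      refine (norm_cpow_neg_sub_cpow_neg_le hN0 hx.1 (by linarith)).trans ?_
      exact mul_le_of_le_one_right (by positivity) (by linarith [hx.2]))
    (N + 1) ⟨by linarith, le_rfl⟩
  have e : zetaTerm n s = (s - 1) * (N : ℂ) ^ (-s) * (((N + 1 : ℝ) : ℂ) - N)
        + ((N + 1 : ℝ) : ℂ) ^ (1 - s)
      - ((s - 1) * (N : ℂ) ^ (-s) * ((N : ℂ) - N) + (N : ℂ) ^ (1 - s)) := by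
    simp only [zetaTerm, ← hN]
    push_cast
    ring
  rw [e]
  simpa using key

lemma hasSum_zetaTerm {s : ℂ} (hs : 1 < s.re) :
    HasSum (fun n ↦ zetaTerm n s) (riemannZeta₁ s - 1) := by
  have hs1 : s ≠ 1 := by rintro rfl; simp at hs
  have hz : HasSum (fun n : ℕ ↦ ((n + 1 : ℝ) : ℂ) ^ (-s)) (riemannZeta s) := by
    rw [zeta_eq_tsum_one_div_nat_add_one_cpow hs]
    have : Summable (fun n : ℕ ↦ 1 / ((n : ℂ) + 1) ^ s) := by
      have := (Complex.summable_one_div_nat_cpow.mpr hs).comp_injective (add_left_injective 1)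
      simpa [Function.comp_def] using this
    convert! this.hasSum using 2 with n
    rw [cpow_neg, one_div]
    push_cast
    rfl
  have ht : Summable (fun n ↦ zetaTerm n s) := by
    refine Summable.of_norm_bounded (g := fun n : ℕ ↦ ‖s - 1‖ * ‖s‖ * (n + 1 : ℝ) ^ (-s.re - 1)) ?_
      (fun n ↦ norm_zetaTerm_le n (by linarith))
    refine Summable.mul_left _ ?_
    have := (Real.summable_nat_rpow.mpr (show -s.re - 1 < -1 by linarith)).comp_injective
      (add_left_injective 1)
    simpa [Function.comp_def] using this
  rw [ht.hasSum_iff_tendsto_nat]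
  have hsum : ∀ N : ℕ, ∑ i ∈ Finset.range N, zetaTerm i s
      = (s - 1) * ∑ i ∈ Finset.range N, ((i + 1 : ℝ) : ℂ) ^ (-s) +
        (((N + 1 : ℝ) : ℂ) ^ (1 - s) - 1) := by
    intro N
    induction N with
    | zero => simp
    | succ N ih =>
      rw [Finset.sum_range_succ, ih, Finset.sum_range_succ]
      simp only [zetaTerm]
      push_cast
      ring
  simp_rw [hsum]
  have h0 : Tendsto (fun N : ℕ ↦ ((N + 1 : ℝ) : ℂ) ^ (1 - s)) atTop (𝓝 0) := by
    rw [tendsto_zero_iff_norm_tendsto_zero]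
    have e : ∀ N : ℕ, ‖((N + 1 : ℝ) : ℂ) ^ (1 - s)‖ = ((N + 1 : ℝ)) ^ (-(s.re - 1)) := by
      intro N
      rw [norm_cpow_eq_rpow_re_of_pos (by positivity)]
      simp
    simp_rw [e]
    exact (tendsto_rpow_neg_atTop (by linarith)).comp
      (tendsto_atTop_add_const_right _ _ tendsto_natCast_atTop_atTop)
  have := (hz.tendsto_sum_nat.const_mul (s - 1)).add (h0.sub_const 1)
  convert! this using 2
  rw [riemannZeta_eq_inv_sub_mul hs1, mul_inv_cancel_left₀ (sub_ne_zero.mpr hs1)]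
  ring

lemma summable_succ_rpow {p : ℝ} (hp : p < -1) : Summable fun n : ℕ ↦ (n + 1 : ℝ) ^ p := by
  have := (Real.summable_nat_rpow.mpr hp).comp_injective (add_left_injective 1)
  simpa [Function.comp_def] using this

lemma riemannZeta₁_eq_tsum {s : ℂ} (hs : 0 < s.re) :
    riemannZeta₁ s = 1 + ∑' n, zetaTerm n s := by
  have hopen : IsOpen {s : ℂ | 0 < s.re} := isOpen_lt continuous_const continuous_re
  have hdiff : DifferentiableOn ℂ (fun s ↦ ∑' n, zetaTerm n s) {s : ℂ | 0 < s.re} := by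
    intro w hw
    set U : Set ℂ := {z | w.re / 2 < z.re} ∩ Metric.ball 0 (‖w‖ + 1) with hU
    have hUo : IsOpen U := (isOpen_lt continuous_const continuous_re).inter Metric.isOpen_ball
    have hw0 : 0 < w.re := hw
    have hwU : w ∈ U := ⟨show w.re / 2 < w.re by linarith, by simp⟩
    have := differentiableOn_tsum_of_summable_norm (F := zetaTerm) (U := U)
      (u := fun n : ℕ ↦ (‖w‖ + 2) * (‖w‖ + 1) * (n + 1 : ℝ) ^ (-(w.re / 2) - 1))
      ((summable_succ_rpow (by linarith)).mul_left _)
      (fun n ↦ (differentiable_zetaTerm n).differentiableOn) hUo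
      (fun n z hz ↦ by
        have hz1 : w.re / 2 < z.re := hz.1
        have hz2 : ‖z‖ < ‖w‖ + 1 := by simpa using hz.2
        refine (norm_zetaTerm_le n (by linarith)).trans ?_
        have : ‖z - 1‖ ≤ ‖w‖ + 2 := (norm_sub_le _ _).trans (by simp; linarith)
        gcongr
        simp)
    exact (this.differentiableAt (hUo.mem_nhds hwU)).differentiableWithinAt
  have h1 : AnalyticOnNhd ℂ riemannZeta₁ {s : ℂ | 0 < s.re} :=
    differentiable_riemannZeta₁.differentiableOn.analyticOnNhd hopen
  have h2 : AnalyticOnNhd ℂ (fun s ↦ 1 + ∑' n, zetaTerm n s) {s : ℂ | 0 < s.re} :=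
    ((differentiableOn_const _).add hdiff).analyticOnNhd hopen
  refine h1.eqOn_of_preconnected_of_eventuallyEq h2 (convex_halfSpace_re_gt 0).isPreconnected
    (z₀ := 2) (by simp) ?_ hs
  filter_upwards [(isOpen_lt continuous_const continuous_re).mem_nhds
    (show (2 : ℂ) ∈ {s : ℂ | 1 < s.re} by simp)] with z hz
  rw [(hasSum_zetaTerm hz).tsum_eq]
  ring

lemma exists_norm_riemannZeta_le : ∃ C : ℝ, 0 < C ∧ ∀ s : ℂ, 3 / 10 ≤ s.re → 1 ≤ |s.im| →
    ‖riemannZeta s‖ ≤ C * (1 + ‖s‖) := by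
  have hsum := summable_succ_rpow (show (-(3 / 10) - 1 : ℝ) < -1 by norm_num)
  refine ⟨1 + ∑' n : ℕ, (n + 1 : ℝ) ^ (-(3 / 10) - 1 : ℝ), ?_, fun s hs ht ↦ ?_⟩
  · have : 0 ≤ ∑' n : ℕ, (n + 1 : ℝ) ^ (-(3 / 10) - 1 : ℝ) := tsum_nonneg fun n ↦ by positivity
    linarith
  set B := ∑' n : ℕ, (n + 1 : ℝ) ^ (-(3 / 10) - 1 : ℝ)
  have hB : 0 ≤ B := tsum_nonneg fun n ↦ by positivity
  have h1 : 1 ≤ ‖s - 1‖ := ht.trans (by simpa using Complex.abs_im_le_norm (s - 1))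
  have hs1 : s ≠ 1 := by rintro rfl; simp at h1; linarith
  rw [riemannZeta_eq_inv_sub_mul hs1, riemannZeta₁_eq_tsum (by linarith), norm_mul, norm_inv]
  have hb : ‖∑' n, zetaTerm n s‖ ≤ ‖s - 1‖ * ‖s‖ * B := by
    refine tsum_of_norm_bounded (hsum.hasSum.mul_left (‖s - 1‖ * ‖s‖)) (fun n ↦ ?_)
    refine (norm_zetaTerm_le n (by linarith)).trans ?_
    gcongr
    simp
  rw [inv_mul_le_iff₀ (by linarith)]
  calc ‖1 + ∑' n, zetaTerm n s‖ ≤ 1 + ‖s - 1‖ * ‖s‖ * B := (norm_add_le _ _).trans (by simpa using hb)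
    _ ≤ ‖s - 1‖ * ((1 + B) * (1 + ‖s‖)) := by nlinarith [norm_nonneg s, mul_nonneg (norm_nonneg s) hB, mul_nonneg (norm_nonneg (s-1)) (norm_nonneg s), mul_nonneg (norm_nonneg (s-1)) hB]

lemma abs_log_norm_le_of_norm_sub_one_le {w : ℂ} {q : ℝ} (hq : q < 1) (h : ‖w - 1‖ ≤ q) :
    |Real.log ‖w‖| ≤ ‖w - 1‖ / (1 - q) := by
  have h1 : 1 - ‖w - 1‖ ≤ ‖w‖ := by
    have := norm_sub_norm_le (1 : ℂ) (1 - w)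
    simp only [norm_one, sub_sub_cancel] at this
    rwa [norm_sub_rev 1 w] at this
  have h2 : ‖w‖ ≤ 1 + ‖w - 1‖ := by
    have := norm_add_le (1 : ℂ) (w - 1)
    simpa using this
  have hw : 0 < ‖w‖ := by linarith
  have hq0 : 0 ≤ q := (norm_nonneg _).trans h
  have h3 : ‖w - 1‖ ≤ ‖w - 1‖ / (1 - q) := by
    rw [le_div_iff₀ (by linarith)]; nlinarith [norm_nonneg (w - 1)]
  rw [abs_le]
  constructor
  · have := Real.one_sub_inv_le_log_of_pos hw
    have h4 : ‖w‖⁻¹ ≤ 1 + ‖w - 1‖ / (1 - q) := by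
      have h5 : (1 + ‖w - 1‖ / (1 - q)) = (1 - q + ‖w - 1‖) / (1 - q) := by
        have : 1 - q ≠ 0 := by linarith
        field_simp
      rw [h5, inv_eq_one_div, div_le_div_iff₀ hw (by linarith)]
      nlinarith [norm_nonneg (w - 1)]
    linarith
  · have := Real.log_le_sub_one_of_pos hw
    linarith

lemma norm_riemannZeta_sub_one_le {s : ℂ} (hs : 2 ≤ s.re) :
    ‖riemannZeta s - 1‖ ≤ (2 : ℝ) ^ (2 - s.re) * (7 / 10) := by
  have hz2 : HasSum (fun n : ℕ ↦ 1 / ((n : ℝ) + 1 + 1) ^ 2) (π ^ 2 / 6 - 1) := by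
    have h := hasSum_zeta_two
    rw [← hasSum_nat_add_iff' 2] at h
    simpa [Finset.sum_range_succ, add_assoc, one_add_one_eq_two] using h
  have hq : π ^ 2 / 6 - 1 ≤ 7 / 10 := by nlinarith [Real.pi_lt_d2, Real.pi_pos]
  have hz : HasSum (fun n : ℕ ↦ 1 / ((n : ℂ) + 1 + 1) ^ s) (riemannZeta s - 1) := by
    have hs1 : 1 < s.re := by linarith
    have : HasSum (fun n : ℕ ↦ 1 / ((n : ℂ) + 1) ^ s) (riemannZeta s) := by
      rw [zeta_eq_tsum_one_div_nat_add_one_cpow hs1]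
      have := (Complex.summable_one_div_nat_cpow.mpr hs1).comp_injective (add_left_injective 1)
      exact Summable.hasSum (by simpa [Function.comp_def] using this)
    rw [← hasSum_nat_add_iff' 1] at this
    simpa using this
  have hb := tsum_of_norm_bounded (hz2.mul_left ((2 : ℝ) ^ (2 - s.re))) (f := fun n : ℕ ↦ 1 / ((n : ℂ) + 1 + 1) ^ s)
    (fun n ↦ by
      have hn : (0 : ℝ) < n + 1 + 1 := by positivity
      have e : ((n : ℂ) + 1 + 1) = ((n + 1 + 1 : ℝ) : ℂ) := by push_cast; rfl
      rw [e, norm_div, norm_one, norm_cpow_eq_rpow_re_of_pos hn, one_div, ← Real.rpow_neg hn.le,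
        one_div, ← Real.rpow_natCast, ← Real.rpow_neg hn.le,
        show -s.re = (2 - s.re) + (-((2 : ℕ) : ℝ)) by push_cast; ring, Real.rpow_add hn]
      gcongr ?_ * _
      exact Real.rpow_le_rpow_of_nonpos two_pos (by linarith [(Nat.cast_nonneg n : (0 : ℝ) ≤ n)])
        (by linarith))
  rw [hz.tsum_eq] at hb
  refine hb.trans ?_
  gcongr

lemma abs_log_norm_riemannZeta_le {s : ℂ} (hs : 2 ≤ s.re) :
    |Real.log ‖riemannZeta s‖| ≤ 4 * (2 : ℝ) ^ (2 - s.re) := by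
  have h := norm_riemannZeta_sub_one_le hs
  have h1 : (2 : ℝ) ^ (2 - s.re) ≤ 1 :=
    Real.rpow_le_one_of_one_le_of_nonpos one_le_two (by linarith)
  refine (abs_log_norm_le_of_norm_sub_one_le (q := 7 / 10) (by norm_num) (by linarith)).trans ?_
  rw [div_le_iff₀ (by norm_num)]
  have : 0 < (2 : ℝ) ^ (2 - s.re) := by positivity
  linarith

/-! ### Stirling's formula for the modulus of the Gamma function -/

/-- The real part of the main term in Stirling's formula. -/
def stirlingMain (z : ℂ) : ℝ := ((z - 1 / 2) * Complex.log z - z).re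

/-- The remainder in Stirling's formula for `log ‖Γ(z)‖`. -/
def stirlingRem (z : ℂ) : ℝ := Real.log ‖Complex.Gamma z‖ - stirlingMain z

lemma norm_add_le_of_re_nonneg {z : ℂ} (hz : 0 ≤ z.re) {t : ℝ} (ht : 0 ≤ t) : ‖z‖ ≤ ‖z + t‖ := by
  rw [← sq_le_sq₀ (norm_nonneg _) (norm_nonneg _), ← Complex.normSq_eq_norm_sq,
    ← Complex.normSq_eq_norm_sq, Complex.normSq_apply, Complex.normSq_apply]
  simp
  nlinarith

lemma stirlingRem_sub_stirlingRem_add_one {z : ℂ} (hz : 0 < z.re) :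
    |stirlingRem z - stirlingRem (z + 1)| ≤ 1 / (4 * ‖z‖ ^ 2) := by
  have hz0 : z ≠ 0 := by rintro rfl; simp at hz
  have hzn : 0 < ‖z‖ := norm_pos_iff.mpr hz0
  have hne (t : ℝ) (ht : 0 ≤ t) : z + t ≠ 0 := by
    intro h
    have := congrArg re h
    simp at this
    linarith
  have hhalf : z + 1 / 2 ≠ 0 := by
    have := hne (1 / 2) (by norm_num)
    push_cast at this
    exact this
  have e : stirlingRem z - stirlingRem (z + 1)
      = ((z + 1 / 2) * (Complex.log (z + 1) - Complex.log z) - 1).re := by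
    have hG : Real.log ‖Complex.Gamma (z + 1)‖ = Real.log ‖z‖ + Real.log ‖Complex.Gamma z‖ := by
      rw [Complex.Gamma_add_one z hz0, norm_mul, Real.log_mul hzn.ne'
        (norm_ne_zero_iff.mpr (Complex.Gamma_ne_zero_of_re_pos hz))]
    have e2 : ((z + 1 / 2) * (Complex.log (z + 1) - Complex.log z) - 1)
        = ((z + 1 - 1 / 2) * Complex.log (z + 1) - (z + 1)) - ((z - 1 / 2) * Complex.log z - z)
          - Complex.log z := by ring
    rw [e2, sub_re, sub_re, log_re]
    simp only [stirlingRem, hG, stirlingMain]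
    ring
  rw [e]
  refine (Complex.abs_re_le_norm _).trans ?_
  have key := norm_image_sub_le_of_norm_deriv_le_segment' (a := 0) (b := 1)
    (f := fun t : ℝ ↦ (z + 1 / 2) * Complex.log (z + t) - t - ((t : ℂ) / 2 - (t : ℂ) ^ 2 / 2) / (z + 1 / 2))
    (f' := fun t : ℝ ↦ (z + 1 / 2) * (1 / (z + t)) - 1 - ((1 : ℂ) / 2 - 2 * t / 2) / (z + 1 / 2))
    (C := 1 / (4 * ‖z‖ ^ 2))
    (fun t ht ↦ by
      refine HasDerivAt.hasDerivWithinAt ?_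
      have h1 : HasDerivAt (fun t : ℝ ↦ (t : ℂ)) 1 t := Complex.ofRealCLM.hasDerivAt (x := t)
      refine HasDerivAt.sub (HasDerivAt.sub (HasDerivAt.const_mul _ ?_) h1) (HasDerivAt.div_const ?_ _)
      · refine HasDerivAt.clog_real ?_ ?_
        · simpa using h1.const_add z
        · left; simp; linarith [ht.1]
      · refine HasDerivAt.sub (h1.div_const 2) (HasDerivAt.div_const ?_ 2)
        simpa using h1.fun_pow 2)
    (fun t ht ↦ by
      have hzt := hne t ht.1
      have e3 : (z + 1 / 2) * (1 / (z + t)) - 1 - ((1 : ℂ) / 2 - 2 * t / 2) / (z + 1 / 2)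
          = ((1 / 2 - t : ℝ) : ℂ) ^ 2 / ((z + t) * (z + 1 / 2)) := by
        push_cast
        have h2z : 1 + z * 2 ≠ 0 := fun h ↦ hhalf (by linear_combination h / 2)
        field_simp
        ring_nf
        field_simp
        ring
      rw [e3, norm_div, norm_pow, norm_mul, Complex.norm_real, Real.norm_eq_abs, sq_abs]
      have h1 := norm_add_le_of_re_nonneg hz.le ht.1
      have h2 : ‖z‖ ≤ ‖z + 1 / 2‖ := by
        have := norm_add_le_of_re_nonneg hz.le (show (0 : ℝ) ≤ 1 / 2 by norm_num)
        push_cast at this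
        exact this
      rw [div_le_div_iff₀ (by positivity) (by positivity)]
      have h3 : (1 / 2 - t) ^ 2 ≤ 1 / 4 := by nlinarith [ht.1, ht.2]
      have h4 : ‖z‖ ^ 2 ≤ ‖z + t‖ * ‖z + 1 / 2‖ := by nlinarith
      nlinarith [sq_nonneg (1 / 2 - t), sq_nonneg ‖z‖])
    1 ⟨zero_le_one, le_rfl⟩
  simp only [ofReal_one, ofReal_zero, sub_zero, mul_one] at key
  convert! key using 2
  simp
  ring

lemma stirlingRem_sub_stirlingRem_add_nat {z : ℂ} (hz : 1 / 4 ≤ z.re) (N : ℕ) :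
    |stirlingRem z - stirlingRem (z + N)| ≤ 5 / 2 / ‖z‖ := by
  have hzr : z.re ≤ ‖z‖ := (le_abs_self _).trans (Complex.abs_re_le_norm z)
  set r := ‖z‖ with hr
  have hr0 : 1 / 4 ≤ r := hz.trans hzr
  have main : |stirlingRem z - stirlingRem (z + N)| ≤ 5 / 2 * (1 / r - 1 / (r + N)) := by
    induction N with
    | zero => simp
    | succ N ih =>
      have hN : (0 : ℝ) ≤ N := Nat.cast_nonneg N
      have h1 : |stirlingRem (z + N) - stirlingRem (z + N + 1)| ≤ 1 / (4 * ‖z + N‖ ^ 2) :=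
        stirlingRem_sub_stirlingRem_add_one (by simp; linarith)
      have h2 : (r + N) ^ 2 ≤ 2 * ‖z + N‖ ^ 2 := by
        have hsq : r ^ 2 = z.re * z.re + z.im * z.im := by
          rw [hr, ← Complex.normSq_eq_norm_sq, Complex.normSq_apply]
        rw [← Complex.normSq_eq_norm_sq, Complex.normSq_apply]
        simp
        nlinarith [sq_nonneg (r - N), mul_nonneg hN (show 0 ≤ z.re by linarith)]
      have h3 : 1 / (4 * ‖z + N‖ ^ 2) ≤ 5 / 2 * (1 / (r + N) - 1 / (r + (N + 1))) := by
        have h5 : 1 / (r + N) - 1 / (r + (N + 1)) = 1 / ((r + N) * (r + (N + 1))) := by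
          have : r + N ≠ 0 := by linarith
          have : r + (N + 1) ≠ 0 := by linarith
          field_simp
          ring
        rw [h5, mul_one_div, div_le_div_iff₀ (by nlinarith) (by nlinarith)]
        nlinarith
      push_cast
      rw [show z + (N + 1 : ℂ) = z + N + 1 by ring]
      calc _ = |(stirlingRem z - stirlingRem (z + N)) + (stirlingRem (z + N) - stirlingRem (z + N + 1))| := by ring_nf
        _ ≤ _ := (abs_add_le _ _)
        _ ≤ 5 / 2 * (1 / r - 1 / (r + N)) + 5 / 2 * (1 / (r + N) - 1 / (r + (N + 1))) := by linarith
        _ = _ := by ring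
  have : 0 ≤ 1 / (r + N) := by positivity
  calc _ ≤ _ := main
    _ ≤ 5 / 2 * (1 / r) := by linarith
    _ = _ := by ring

lemma tendsto_log_norm_Gamma_add_nat {z : ℂ} (hz : 0 < z.re) :
    Tendsto (fun n : ℕ ↦ Real.log ‖Complex.Gamma (z + (n + 1 : ℕ))‖ - z.re * Real.log n
      - Real.log (n.factorial)) atTop (𝓝 0) := by
  have hG : Complex.Gamma z ≠ 0 := Complex.Gamma_ne_zero_of_re_pos hz
  have hzk : ∀ k : ℕ, z ≠ -k := by
    rintro k rfl
    simp at hz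
    linarith [(Nat.cast_nonneg k : (0 : ℝ) ≤ k)]
  have h1 : Tendsto (fun n ↦ Real.log ‖Complex.Gamma z‖ - Real.log ‖Complex.GammaSeq z n‖)
      atTop (𝓝 0) := by
    have := ((Complex.GammaSeq_tendsto_Gamma z).norm.log (norm_ne_zero_iff.mpr hG)).const_sub
      (Real.log ‖Complex.Gamma z‖)
    simpa using this
  refine h1.congr' ?_
  filter_upwards [eventually_gt_atTop 0] with n hn
  have hn' : (0 : ℝ) < n := by exact_mod_cast hn
  have hprod : ∏ j ∈ Finset.range (n + 1), (z + j) ≠ 0 := by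
    refine Finset.prod_ne_zero_iff.mpr fun j _ h ↦ hzk j ?_
    linear_combination h
  have hGn : ∀ m : ℕ, Complex.Gamma (z + m) = (∏ j ∈ Finset.range m, (z + j)) * Complex.Gamma z := by
    intro m
    induction m with
    | zero => simp
    | succ m ih =>
      push_cast
      rw [← add_assoc, Complex.Gamma_add_one, ih, Finset.prod_range_succ]
      · ring
      · intro h; exact hzk m (by linear_combination h)
  have hf : (n.factorial : ℝ) ≠ 0 := by positivity
  rw [hGn, Complex.GammaSeq, norm_mul, norm_div, norm_mul,
    Real.log_mul (norm_ne_zero_iff.mpr hprod) (norm_ne_zero_iff.mpr hG)]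
  have e1 : ‖(n : ℂ) ^ z‖ = (n : ℝ) ^ z.re := by
    have := norm_cpow_eq_rpow_re_of_pos hn' z
    simpa using this
  rw [e1, Complex.norm_natCast, Real.log_div (by positivity) (norm_ne_zero_iff.mpr hprod),
    Real.log_mul (by positivity) hf, Real.log_rpow hn']
  ring

lemma tendsto_stirlingMain_add_nat (z : ℂ) (hz : 0 < z.re) :
    Tendsto (fun n : ℕ ↦ stirlingMain (z + (n + 1 : ℕ)) - ((z.re + n + 1 / 2) * Real.log n - n))
      atTop (𝓝 0) := by
  have h0 : Tendsto (fun n : ℕ ↦ (n : ℂ) * ((z + 1) / n)) atTop (𝓝 (z + 1)) := by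
    refine tendsto_const_nhds.congr' ?_
    filter_upwards [eventually_gt_atTop 0] with n hn
    have : (n : ℂ) ≠ 0 := by exact_mod_cast hn.ne'
    field_simp
  have h1 := Complex.tendsto_nat_mul_log_one_add_of_tendsto h0
  have hinv : Tendsto (fun n : ℕ ↦ ((n : ℂ))⁻¹) atTop (𝓝 0) := tendsto_inv_atTop_nhds_zero_nat
  have h2 : Tendsto (fun n : ℕ ↦ (z + 1 / 2) * (((n : ℂ))⁻¹ * (n * Complex.log (1 + (z + 1) / n))))
      atTop (𝓝 0) := by
    have := (hinv.mul h1).const_mul (z + 1 / 2)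
    simpa using this
  have h3 := ((h1.add h2).sub_const (z + 1))
  have h4 := (Complex.continuous_re.tendsto _).comp h3
  simp only [add_zero, sub_self, zero_re] at h4
  refine h4.congr' ?_
  filter_upwards [eventually_gt_atTop 0] with n hn
  have hn' : (0 : ℝ) < n := by exact_mod_cast hn
  have hnc : (n : ℂ) ≠ 0 := by exact_mod_cast hn.ne'
  have hw : 1 + (z + 1) / n ≠ 0 := by
    intro h
    have h5 : (n : ℂ) + (z + 1) = 0 := by
      field_simp at h
      linear_combination h
    have := congrArg re h5
    simp at this
    linarith
  have hlog : Complex.log (z + (n + 1 : ℕ)) = Real.log n + Complex.log (1 + (z + 1) / n) := by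
    rw [← Complex.log_ofReal_mul hn' hw]
    congr 1
    push_cast
    field_simp
    ring
  simp only [Function.comp, stirlingMain, hlog]
  have e : (z + ((n + 1 : ℕ) : ℂ) - 1 / 2) * (Real.log n + Complex.log (1 + (z + 1) / n)) - (z + ((n + 1 : ℕ) : ℂ))
     = (n * Complex.log (1 + (z + 1) / n) + (z + 1 / 2) * (((n : ℂ))⁻¹ * (n * Complex.log (1 + (z + 1) / n))) - (z + 1))
       + (z + ((n : ℝ) : ℂ) + ((1 / 2 : ℝ) : ℂ)) * (Real.log n : ℂ) - ((n : ℝ) : ℂ) := by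
    push_cast
    field_simp
    ring
  rw [e]
  generalize (n * Complex.log (1 + (z + 1) / n)
    + (z + 1 / 2) * (((n : ℂ))⁻¹ * (n * Complex.log (1 + (z + 1) / n))) - (z + 1)) = w
  rw [sub_re, add_re, re_mul_ofReal]
  simp only [add_re, ofReal_re]
  ring

/-- **Stirling's formula** for `log ‖Γ(z)‖` in the half-plane `Re z ≥ 1/4`, with remainder
`O(1 / ‖z‖)`. -/
lemma exists_abs_log_norm_Gamma_sub_le : ∃ c : ℝ, ∀ z : ℂ, 1 / 4 ≤ z.re →
    |Real.log ‖Complex.Gamma z‖ - stirlingMain z - c| ≤ 5 / 2 / ‖z‖ := by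
  refine ⟨Real.log √π + 1 / 2 * Real.log 2, fun z hz ↦ ?_⟩
  have hz0 : 0 < z.re := by linarith
  have hf : Tendsto (fun n : ℕ ↦ Real.log n.factorial - ((n + 1 / 2) * Real.log n - n)) atTop
      (𝓝 (Real.log √π + 1 / 2 * Real.log 2)) := by
    have h := (Stirling.tendsto_stirlingSeq_sqrt_pi.log (by positivity)).add_const
      (1 / 2 * Real.log 2)
    refine h.congr' ?_
    filter_upwards [eventually_gt_atTop 0] with n hn
    have hn' : (0 : ℝ) < n := by exact_mod_cast hn
    rw [Stirling.log_stirlingSeq_formula, Real.log_mul two_ne_zero hn'.ne',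
      Real.log_div hn'.ne' (Real.exp_ne_zero _), Real.log_exp]
    ring
  have hlim : Tendsto (fun n : ℕ ↦ stirlingRem (z + (n + 1 : ℕ))) atTop
      (𝓝 (Real.log √π + 1 / 2 * Real.log 2)) := by
    have := ((tendsto_log_norm_Gamma_add_nat hz0).sub (tendsto_stirlingMain_add_nat z hz0)).add hf
    simp only [sub_zero, zero_add] at this
    refine this.congr fun n ↦ ?_
    simp only [stirlingRem]
    ring
  exact le_of_tendsto (hlim.const_sub (stirlingRem z)).abs
    (Eventually.of_forall fun n ↦ stirlingRem_sub_stirlingRem_add_nat hz (n + 1))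

/-! ### The function `ξ` and its zeros -/

/-- The entire function `s (s - 1) π^{-s/2} Γ(s/2) ζ(s)`. -/
def xi (s : ℂ) : ℂ := s * (s - 1) * completedRiemannZeta₀ s + 1

lemma differentiable_xi : Differentiable ℂ xi := by
  have := differentiable_completedZeta₀
  unfold xi
  fun_prop

lemma analyticAt_xi (s : ℂ) : AnalyticAt ℂ xi s :=
  differentiable_xi.analyticAt s

lemma xi_one_sub (s : ℂ) : xi (1 - s) = xi s := by
  simp only [xi, completedRiemannZeta₀_one_sub]
  ring

lemma xi_eq {s : ℂ} (hs : 0 < s.re) (hs1 : s ≠ 1) :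
    xi s = s * (s - 1) * Gammaℝ s * riemannZeta s := by
  have hs0 : s ≠ 0 := by rintro rfl; simp at hs
  have hs2 : 1 - s ≠ 0 := sub_ne_zero.mpr hs1.symm
  have hG := Gammaℝ_ne_zero_of_re_pos hs
  rw [riemannZeta_def_of_ne_zero hs0, mul_assoc, mul_div_cancel₀ _ hG, completedRiemannZeta_eq, xi]
  field_simp
  ring

lemma isNontrivialZero_ne_one {s : ℂ} (hs : IsNontrivialZero s) : s ≠ 1 := by
  rintro rfl
  simpa using hs.2.2

lemma xi_eq_zero_iff {s : ℂ} : xi s = 0 ↔ IsNontrivialZero s := by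
  have key : ∀ {s : ℂ}, 0 < s.re → xi s = 0 → IsNontrivialZero s := by
    intro s hs h
    have hs1 : s ≠ 1 := by rintro rfl; simp [xi] at h
    have hs0 : s ≠ 0 := by rintro rfl; simp at hs
    have hG := Gammaℝ_ne_zero_of_re_pos hs
    rw [xi_eq hs hs1] at h
    have hz : riemannZeta s = 0 := by
      simpa [hs0, sub_ne_zero.mpr hs1, hG] using h
    refine ⟨hz, hs, ?_⟩
    by_contra! hre
    exact riemannZeta_ne_zero_of_one_le_re hre hz
  constructor
  · intro h
    rcases lt_or_ge 0 s.re with hs | hs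
    · exact key hs h
    · have h1 := key (s := 1 - s) (by simp; linarith) (by rwa [xi_one_sub])
      have := h1.2.2
      simp at this
      linarith
  · intro h
    rw [xi_eq h.2.1 (isNontrivialZero_ne_one h), h.1, mul_zero]

lemma isNontrivialZero_one_sub_iff {s : ℂ} : IsNontrivialZero (1 - s) ↔ IsNontrivialZero s := by
  rw [← xi_eq_zero_iff, ← xi_eq_zero_iff, xi_one_sub]

lemma xi_ne_zero_function : xi ≠ 0 := by
  intro h
  have := congrFun h 0
  simp [xi] at this

lemma analyticOrderAt_xi_ne_top (s : ℂ) : analyticOrderAt xi s ≠ ⊤ := by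
  rw [Ne, AnalyticOnNhd.analyticOrderAt_eq_top_iff_eq_zero s analyticAt_xi]
  exact xi_ne_zero_function

lemma analyticAt_riemannZeta {s : ℂ} (hs : s ≠ 1) : AnalyticAt ℂ riemannZeta s := by
  refine DifferentiableOn.analyticAt (s := {1}ᶜ) (fun z hz ↦ ?_) (isOpen_compl_singleton.mem_nhds hs)
  exact (differentiableAt_riemannZeta hz).differentiableWithinAt

lemma analyticOrderAt_xi_eq_riemannZeta {s : ℂ} (hs : 0 < s.re) (hs1 : s ≠ 1) :
    analyticOrderAt xi s = analyticOrderAt riemannZeta s := by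
  have hs0 : s ≠ 0 := by rintro rfl; simp at hs
  have hev : xi =ᶠ[𝓝 s] (fun z ↦ z * (z - 1) * Gammaℝ z) * riemannZeta := by
    filter_upwards [isOpen_compl_singleton.mem_nhds hs1,
      (isOpen_lt continuous_const continuous_re).mem_nhds hs] with z hz1 hz
    exact xi_eq hz hz1
  have hA : AnalyticAt ℂ (fun z ↦ z * (z - 1) * Gammaℝ z) s := by
    refine DifferentiableOn.analyticAt (s := {z | 0 < z.re}) (fun z hz ↦ ?_)
      ((isOpen_lt continuous_const continuous_re).mem_nhds hs)
    have hG : DifferentiableAt ℂ Gammaℝ z := by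
      have h1 := differentiable_Gammaℝ_inv z
      have h2 := h1.inv (inv_ne_zero (Gammaℝ_ne_zero_of_re_pos hz))
      convert! h2 using 1
      ext w
      simp
    have : DifferentiableAt ℂ (fun z ↦ z * (z - 1) * Gammaℝ z) z := by fun_prop
    exact this.differentiableWithinAt
  rw [analyticOrderAt_congr hev, analyticOrderAt_mul hA (analyticAt_riemannZeta hs1),
    hA.analyticOrderAt_eq_zero.mpr, zero_add]
  exact mul_ne_zero (mul_ne_zero hs0 (sub_ne_zero.mpr hs1)) (Gammaℝ_ne_zero_of_re_pos hs)

lemma analyticOrderAt_xi {s : ℂ} (hs : IsNontrivialZero s) :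
    analyticOrderAt xi s = zetaMult s := by
  have hs1 := isNontrivialZero_ne_one hs
  have h := analyticOrderAt_xi_eq_riemannZeta hs.2.1 hs1
  obtain ⟨n, hn⟩ := ENat.ne_top_iff_exists.mp (analyticOrderAt_xi_ne_top s)
  rw [← hn] at h ⊢
  obtain ⟨h1, h2⟩ :=
    (analyticOrderAt_eq_nat_iff_iteratedDeriv_eq_zero (analyticAt_riemannZeta hs1)).mp h.symm
  congr 1
  refine (le_antisymm (Nat.sInf_le h2) ?_).symm
  refine le_csInf ⟨n, h2⟩ fun m hm ↦ ?_
  by_contra! hlt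
  exact hm (h1 m hlt)

lemma zetaMult_one_sub {s : ℂ} (hs : IsNontrivialZero s) : zetaMult (1 - s) = zetaMult s := by
  have h1 := analyticOrderAt_xi hs
  have h2 := analyticOrderAt_xi (isNontrivialZero_one_sub_iff.mpr hs)
  have hg : AnalyticAt ℂ (fun z : ℂ ↦ 1 - z) s := by fun_prop
  have h3 := analyticOrderAt_comp_of_deriv_ne_zero (f := xi) hg
    (by rw [deriv_const_sub]; simp)
  have h4 : xi ∘ (fun z : ℂ ↦ 1 - z) = xi := funext xi_one_sub
  rw [h4, h1] at h3
  rw [← h3] at h2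
  exact_mod_cast h2.symm

lemma finite_isNontrivialZero_inter_closedBall (c : ℂ) (R : ℝ) :
    {s : ℂ | IsNontrivialZero s ∧ ‖s - c‖ ≤ R}.Finite := by
  refine ((isCompact_closedBall c R).inter_riemannZetaZeros_finite).subset fun s hs ↦ ?_
  exact ⟨by simpa [dist_eq_norm] using hs.2, hs.1.1⟩

/-! ### The size of `ξ` in terms of `ζ` -/

lemma norm_log_add_half_sub_le {p : ℂ} (hp : 0 ≤ p.re) (hp0 : p ≠ 0) :
    ‖Complex.log (p + 1 / 2) - Complex.log p - 1 / (2 * p)‖ ≤ 1 / (4 * ‖p‖ ^ 2) := by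
  have hpn : 0 < ‖p‖ := norm_pos_iff.mpr hp0
  have hslit (t : ℝ) (ht : 0 ≤ t) : p + t ∈ slitPlane := by
    rcases eq_or_ne p.im 0 with him | him
    · left
      have : p.re ≠ 0 := fun h ↦ hp0 (Complex.ext h him)
      have : 0 < p.re := lt_of_le_of_ne hp this.symm
      simp
      linarith
    · right
      simpa using him
  have key := norm_image_sub_le_of_norm_deriv_le_segment' (a := 0) (b := 1 / 2)
    (f := fun t : ℝ ↦ Complex.log (p + t) - t / p)
    (f' := fun t : ℝ ↦ 1 / (p + t) - 1 / p)
    (C := 1 / (2 * ‖p‖ ^ 2))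
    (fun t ht ↦ by
      refine HasDerivAt.hasDerivWithinAt ?_
      have h1 : HasDerivAt (fun t : ℝ ↦ (t : ℂ)) 1 t := Complex.ofRealCLM.hasDerivAt (x := t)
      refine HasDerivAt.sub ?_ (h1.div_const p)
      exact HasDerivAt.clog_real (by simpa using h1.const_add p) (hslit t ht.1))
    (fun t ht ↦ by
      have hpt : p + t ≠ 0 := slitPlane_ne_zero (hslit t ht.1)
      have e : 1 / (p + t) - 1 / p = -(t : ℂ) / ((p + t) * p) := by
        field_simp
        ring
      rw [e, norm_div, norm_neg, norm_mul, Complex.norm_real, Real.norm_eq_abs, abs_of_nonneg ht.1]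
      have h2 := norm_add_le_of_re_nonneg hp ht.1
      have h3 : 0 < ‖p + t‖ := norm_pos_iff.mpr hpt
      rw [div_le_div_iff₀ (by positivity) (by positivity)]
      have h4 : ‖p‖ ^ 2 ≤ ‖p + t‖ * ‖p‖ := by nlinarith
      nlinarith [ht.1, ht.2])
    (1 / 2) ⟨by norm_num, le_rfl⟩
  simp only [ofReal_zero, add_zero, zero_div, sub_zero] at key
  calc _ = ‖Complex.log (p + (1 / 2 : ℝ)) - ((1 / 2 : ℝ) : ℂ) / p - Complex.log p‖ := by
        congr 1
        push_cast
        field_simp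
        ring
    _ ≤ _ := key
    _ = _ := by ring

lemma exists_abs_log_norm_xi_sub_le : ∃ β c : ℝ, ∀ p : ℂ, 3 ≤ ‖p‖ → 0 ≤ p.re →
    riemannZeta (1 / 2 + p) ≠ 0 →
    |Real.log ‖xi (1 / 2 + p)‖ - Real.log ‖riemannZeta (1 / 2 + p)‖
      - ((p * Complex.log p).re / 2 + β * p.re + 7 / 4 * Real.log ‖p‖ + c)| ≤ 10 / ‖p‖ := by
  obtain ⟨c, hc⟩ := exists_abs_log_norm_Gamma_sub_le
  refine ⟨-(Real.log π) / 2 - Real.log 2 / 2 - 1 / 2, -(Real.log π) / 4 + Real.log 2 / 4 + c,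
    fun p hp hre hζ ↦ ?_⟩
  have hpn : 0 < ‖p‖ := by linarith
  have hp0 : p ≠ 0 := norm_pos_iff.mp hpn
  set s : ℂ := 1 / 2 + p with hs
  have hsre : 0 < s.re := by simp [hs]; linarith
  have hs0 : s ≠ 0 := by intro h; rw [h] at hsre; simp at hsre
  have hs1' : s - 1 = p - 1 / 2 := by rw [hs]; ring
  have hpm : p - 1 / 2 ≠ 0 := by
    intro h
    have : p = 1 / 2 := by linear_combination h
    rw [this] at hp
    norm_num at hp
  have hs1 : s ≠ 1 := by
    intro h
    exact hpm (by rw [← hs1', h]; simp)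
  have hG : Complex.Gamma (s / 2) ≠ 0 := Complex.Gamma_ne_zero_of_re_pos (by simp; linarith)
  have hpi : ‖(π : ℂ) ^ (-s / 2)‖ = π ^ (-(1 / 4) - p.re / 2) := by
    rw [norm_cpow_eq_rpow_re_of_pos Real.pi_pos]
    congr 1
    simp [hs]
    ring
  have e1 : Real.log ‖xi s‖ - Real.log ‖riemannZeta s‖ = Real.log ‖p + 1 / 2‖
      + Real.log ‖p - 1 / 2‖ + (-(1 / 4) - p.re / 2) * Real.log π
      + Real.log ‖Complex.Gamma (s / 2)‖ := by
    have hsn : ‖s‖ = ‖p + 1 / 2‖ := by rw [hs, add_comm]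
    have h1 : Real.log ‖p + 1 / 2‖ = Real.log ‖s‖ := by rw [hsn]
    have h2 : (π : ℝ) ^ (-(1 / 4) - p.re / 2) ≠ 0 := (Real.rpow_pos_of_pos Real.pi_pos _).ne'
    rw [xi_eq hsre hs1, Gammaℝ_def, hs1', norm_mul, norm_mul, norm_mul, norm_mul, hpi,
      Real.log_mul, Real.log_mul, Real.log_mul, Real.log_mul, Real.log_rpow Real.pi_pos, h1]
    · ring
    all_goals simp only [ne_eq, mul_eq_zero, norm_eq_zero, not_or]; tauto
  have hδ := norm_log_add_half_sub_le hre hp0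
  set δ := Complex.log (p + 1 / 2) - Complex.log p - 1 / (2 * p) with hδd
  have hl1 : Complex.log (p + 1 / 2) = Complex.log p + 1 / (2 * p) + δ := by rw [hδd]; ring
  have hphalf : p + 1 / 2 ≠ 0 := by rw [add_comm]; exact hs0
  have hl2 : Complex.log (s / 2) = Complex.log p + 1 / (2 * p) + δ - (Real.log 2 : ℝ) := by
    have : s / 2 = ((1 / 2 : ℝ) : ℂ) * (p + 1 / 2) := by rw [hs]; push_cast; ring
    rw [this, Complex.log_ofReal_mul (by norm_num) hphalf, hl1, one_div, Real.log_inv]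
    push_cast
    ring
  have hst : stirlingMain (s / 2) = (p * Complex.log p).re / 2 - Real.log ‖p‖ / 4
      - (Real.log 2 / 2) * p.re + Real.log 2 / 4 - p.re / 2
      + (-(1 / (8 * p)) + (p / 2 - 1 / 4) * δ).re := by
    have e2 : (s / 2 - 1 / 2) * Complex.log (s / 2) - s / 2
        = (p * Complex.log p) * ((1 / 2 : ℝ) : ℂ) - Complex.log p * ((1 / 4 : ℝ) : ℂ)
          - p * ((Real.log 2 / 2 : ℝ) : ℂ)
          + ((Real.log 2 / 4 : ℝ) : ℂ) - p * ((1 / 2 : ℝ) : ℂ) +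
          (-(1 / (8 * p)) + (p / 2 - 1 / 4) * δ) := by
      rw [hl2, hs]
      push_cast
      field_simp
      ring
    rw [stirlingMain, e2]
    generalize (-(1 / (8 * p)) + (p / 2 - 1 / 4) * δ) = w
    rw [add_re, sub_re, add_re, sub_re, sub_re, re_mul_ofReal, re_mul_ofReal, re_mul_ofReal,
      re_mul_ofReal, ofReal_re, Complex.log_re]
    ring
  have hg := hc (s / 2) (by simp [hs]; linarith)
  have hs2 : ‖p‖ / 2 ≤ ‖s / 2‖ := by
    have h := norm_add_le_of_re_nonneg hre (show (0 : ℝ) ≤ 1 / 2 by norm_num)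
    rw [norm_div, hs, add_comm]
    push_cast at h
    norm_num at h ⊢
    linarith
  have hg2 : 5 / 2 / ‖s / 2‖ ≤ 5 / ‖p‖ := by
    rw [div_le_div_iff₀ (by linarith) hpn]
    linarith
  have herr : |(-(1 / (8 * p)) + (p / 2 - 1 / 4) * δ).re| ≤ 1 / ‖p‖ := by
    refine (abs_re_le_norm _).trans ((norm_add_le _ _).trans ?_)
    have h1 : ‖-(1 / (8 * p))‖ = 1 / 8 * (1 / ‖p‖) := by
      rw [norm_neg, norm_div, norm_mul]
      norm_num
      ring
    have h2 : ‖p / 2 - 1 / 4‖ ≤ ‖p‖ := by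
      refine (norm_sub_le _ _).trans ?_
      rw [norm_div]
      norm_num
      linarith
    have h3 : ‖(p / 2 - 1 / 4) * δ‖ ≤ ‖p‖ * (1 / (4 * ‖p‖ ^ 2)) := by
      rw [norm_mul]
      gcongr
    have h4 : ‖p‖ * (1 / (4 * ‖p‖ ^ 2)) = 1 / 4 * (1 / ‖p‖) := by field_simp
    have h5 : 0 < 1 / ‖p‖ := by positivity
    rw [h1]
    linarith
  have hlp : |Real.log ‖p + 1 / 2‖ - Real.log ‖p‖| ≤ 1 / ‖p‖ := by
    have h1 : Real.log ‖p + 1 / 2‖ - Real.log ‖p‖ = (1 / (2 * p) + δ).re := by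
      rw [← Complex.log_re, ← Complex.log_re, ← sub_re, hl1]
      congr 1
      ring
    rw [h1]
    refine (abs_re_le_norm _).trans ((norm_add_le _ _).trans ?_)
    have h2 : ‖1 / (2 * p)‖ = 1 / 2 * (1 / ‖p‖) := by
      rw [norm_div, norm_mul]
      norm_num
      ring
    have h3 : 1 / (4 * ‖p‖ ^ 2) ≤ 1 / 4 * (1 / ‖p‖) := by
      rw [← div_eq_mul_one_div, div_div, div_le_div_iff₀ (by positivity) (by positivity)]
      nlinarith
    have h5 : 0 < 1 / ‖p‖ := by positivity
    rw [h2]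
    linarith
  have hlm : |Real.log ‖p - 1 / 2‖ - Real.log ‖p‖| ≤ 2 / ‖p‖ := by
    have h1 : Real.log ‖p - 1 / 2‖ - Real.log ‖p‖ = Real.log ‖1 - 1 / (2 * p)‖ := by
      rw [← Real.log_div (norm_ne_zero_iff.mpr hpm) hpn.ne', ← norm_div]
      congr 2
      field_simp
    have h2 : ‖1 - 1 / (2 * p) - 1‖ = 1 / 2 * (1 / ‖p‖) := by
      rw [sub_sub_cancel_left, norm_neg, norm_div, norm_mul]
      norm_num
      ring
    have h3 : 1 / ‖p‖ ≤ 1 := by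
      rw [div_le_one hpn]
      linarith
    have h4 : 0 < 1 / ‖p‖ := by positivity
    rw [h1]
    refine (abs_log_norm_le_of_norm_sub_one_le (q := 1 / 2) (by norm_num) (by linarith)).trans ?_
    rw [h2]
    have : 2 / ‖p‖ = 2 * (1 / ‖p‖) := by ring
    rw [this, div_le_iff₀ (by norm_num)]
    linarith
  have h5 : 0 < 1 / ‖p‖ := by positivity
  rw [e1]
  have hfin : 10 / ‖p‖ = 1 / ‖p‖ + 2 / ‖p‖ + 1 / ‖p‖ + 5 / ‖p‖ + 1 / ‖p‖ := by ring
  rw [hfin]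
  rw [hst] at hg
  rw [abs_le] at *
  constructor <;> linarith [hg.1, hg.2, hlm.1, hlm.2, hlp.1, hlp.2, herr.1, herr.2]

/-! ### Mean values of `|log ‖ζ‖|` -/

lemma log_norm_le_circleAverage {f : ℂ → ℂ} {c : ℂ} {r : ℝ} (hr : 0 < r)
    (hf : AnalyticOnNhd ℂ f (Metric.closedBall c r)) (hc : f c ≠ 0) :
    Real.log ‖f c‖ ≤ circleAverage (fun z ↦ Real.log ‖f z‖) c r := by
  have hr' : |r| = r := abs_of_pos hr
  rw [AnalyticOnNhd.circleAverage_log_norm hr.ne' (by rwa [hr']) hc, hr']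
  refine le_add_of_nonneg_left (finsum_nonneg fun u ↦ ?_)
  by_cases hu : u ∈ Metric.closedBall c r
  · refine mul_nonneg ?_ ?_
    · exact_mod_cast MeromorphicOn.AnalyticOnNhd.divisor_nonneg hf u
    · rcases eq_or_ne u c with rfl | huc
      · simp
      · refine Real.log_nonneg ?_
        have h1 : ‖c - u‖ ≤ r := by simpa [dist_eq_norm, norm_sub_rev] using hu
        have h2 : 0 < ‖c - u‖ := norm_pos_iff.mpr (sub_ne_zero.mpr huc.symm)
        rw [← div_eq_mul_inv, le_div_iff₀ h2]
        linarith
  · rw [Function.locallyFinsuppWithin.apply_eq_zero_of_notMem _ hu]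
    simp

lemma lintegral_enorm_log_norm_circle_le {f : ℂ → ℂ} {c : ℂ} {r B : ℝ} (hr : 0 < r)
    (hf : AnalyticOnNhd ℂ f (Metric.closedBall c r)) (hc : f c ≠ 0) (hB : 0 ≤ B)
    (hle : ∀ z ∈ Metric.closedBall c r, Real.log ‖f z‖ ≤ B) :
    ∫⁻ θ in Ioo (-π) π, ‖Real.log ‖f (circleMap c r θ)‖‖ₑ
      ≤ ENNReal.ofReal (2 * π * (2 * B - Real.log ‖f c‖)) := by
  have hci : CircleIntegrable (fun z ↦ Real.log ‖f z‖) c r := by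
    refine MeromorphicOn.circleIntegrable_log_norm (AnalyticOnNhd.meromorphicOn ?_)
    rw [abs_of_pos hr]
    exact hf.mono Metric.sphere_subset_closedBall
  have hper : Function.Periodic (fun θ ↦ Real.log ‖f (circleMap c r θ)‖) (2 * π) :=
    fun θ ↦ by simp [periodic_circleMap c r θ]
  have hint : IntervalIntegrable (fun θ ↦ Real.log ‖f (circleMap c r θ)‖) volume (-π) π :=
    hper.intervalIntegrable (t := 0) Real.two_pi_pos.ne' (by simpa [CircleIntegrable] using hci) _ _
  have hav : ∫ θ in (-π)..π, Real.log ‖f (circleMap c r θ)‖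
      = 2 * π * circleAverage (fun z ↦ Real.log ‖f z‖) c r := by
    have := hper.intervalIntegral_add_eq (-π) 0
    rw [show -π + 2 * π = π by ring, zero_add] at this
    rw [this, circleAverage_def, smul_eq_mul, mul_inv_cancel_left₀ Real.two_pi_pos.ne']
  have hio : IntegrableOn (fun θ ↦ Real.log ‖f (circleMap c r θ)‖) (Ioc (-π) π) :=
    (intervalIntegrable_iff_integrableOn_Ioc_of_le (by linarith [Real.pi_pos])).mp hint
  have hio' := hio.mono_set Ioo_subset_Ioc_self
  rw [← ofReal_integral_norm_eq_lintegral_enorm hio']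
  refine ENNReal.ofReal_le_ofReal ?_
  have hπ : -π ≤ π := by linarith [Real.pi_pos]
  calc ∫ θ in Ioo (-π) π, ‖Real.log ‖f (circleMap c r θ)‖‖
      ≤ ∫ θ in Ioo (-π) π, (2 * B - Real.log ‖f (circleMap c r θ)‖) := by
        refine setIntegral_mono_on hio'.norm ?_ measurableSet_Ioo fun θ _ ↦ ?_
        · exact (integrableOn_const (by simp)).sub hio'
        · have h1 := hle _ (circleMap_mem_closedBall c hr.le θ)
          rw [Real.norm_eq_abs, abs_le]
          constructor <;> linarith
    _ = ∫ θ in (-π)..π, (2 * B - Real.log ‖f (circleMap c r θ)‖) := by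
        rw [intervalIntegral.integral_of_le hπ, integral_Ioc_eq_integral_Ioo]
    _ = 2 * π * (2 * B - circleAverage (fun z ↦ Real.log ‖f z‖) c r) := by
        rw [intervalIntegral.integral_sub (by simp) hint, hav, intervalIntegral.integral_const,
          smul_eq_mul]
        ring
    _ ≤ _ := by
        have := log_norm_le_circleAverage hr hf hc
        gcongr

lemma lintegral_closedBall_enorm_log_norm_le {f : ℂ → ℂ} {c : ℂ} {r B : ℝ} (hr : 0 < r)
    (hmeas : Measurable f)
    (hf : AnalyticOnNhd ℂ f (Metric.closedBall c r)) (hc : f c ≠ 0) (hB : 0 ≤ B)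
    (hle : ∀ z ∈ Metric.closedBall c r, Real.log ‖f z‖ ≤ B) :
    ∫⁻ z in Metric.closedBall c r, ‖Real.log ‖f z‖‖ₑ
      ≤ ENNReal.ofReal (r ^ 2 * (2 * π * (2 * B - Real.log ‖f c‖))) := by
  have h1 : ∫⁻ z in Metric.closedBall c r, ‖Real.log ‖f z‖‖ₑ
      = ∫⁻ w, (Metric.closedBall c r).indicator (fun z ↦ ‖Real.log ‖f z‖‖ₑ) (c + w) := by
    rw [lintegral_add_left_eq_self, lintegral_indicator measurableSet_closedBall]
  rw [h1, ← Complex.lintegral_comp_polarCoord_symm]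
  have hcm : ∀ p : ℝ × ℝ, c + Complex.polarCoord.symm p = circleMap c p.1 p.2 := by
    intro p
    rw [Complex.polarCoord_symm_apply, circleMap, Complex.exp_mul_I]
    push_cast
    rfl
  have hm : Measurable fun p : ℝ × ℝ ↦ ‖Real.log ‖f (circleMap c p.1 p.2)‖‖ₑ := by
    have : Measurable fun p : ℝ × ℝ ↦ circleMap c p.1 p.2 := by
      unfold circleMap
      fun_prop
    fun_prop
  calc _ ≤ ∫⁻ p in Ioc 0 r ×ˢ Ioo (-π) π,
        ENNReal.ofReal p.1 * ‖Real.log ‖f (circleMap c p.1 p.2)‖‖ₑ := by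
        rw [← lintegral_indicator (by measurability), ← lintegral_indicator (by measurability)]
        refine lintegral_mono fun p ↦ ?_
        by_cases hp : p ∈ polarCoord.target
        · rw [indicator_of_mem hp, hcm]
          rw [polarCoord_target] at hp
          by_cases hp1 : p.1 ≤ r
          · have hp2 : p ∈ Ioc 0 r ×ˢ Ioo (-π) π := ⟨⟨hp.1, hp1⟩, hp.2⟩
            rw [indicator_of_mem hp2, smul_eq_mul]
            gcongr
            exact indicator_le_self _ _ _
          · rw [indicator_of_notMem (a := circleMap c p.1 p.2)]
            · simp
            · have h0 : 0 < p.1 := hp.1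
              simp [circleMap, abs_of_pos h0]
              linarith
        · rw [indicator_of_notMem hp]
          simp
    _ = ∫⁻ x in Ioc 0 r, ENNReal.ofReal x *
          ∫⁻ θ in Ioo (-π) π, ‖Real.log ‖f (circleMap c x θ)‖‖ₑ := by
        rw [Measure.volume_eq_prod, ← Measure.prod_restrict, lintegral_prod]
        · refine lintegral_congr fun x ↦ ?_
          exact lintegral_const_mul (ENNReal.ofReal x)
            (hm.comp (by fun_prop : Measurable fun θ : ℝ ↦ (x, θ)))
        · exact (Measurable.mul (by fun_prop) hm).aemeasurable
    _ ≤ ∫⁻ x in Ioc 0 r, ENNReal.ofReal (r * (2 * π * (2 * B - Real.log ‖f c‖))) := by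
        refine setLIntegral_mono' measurableSet_Ioc fun x hx ↦ ?_
        have hsub : Metric.closedBall c x ⊆ Metric.closedBall c r :=
          Metric.closedBall_subset_closedBall hx.2
        have h2 := lintegral_enorm_log_norm_circle_le hx.1 (hf.mono hsub) hc hB
          (fun z hz ↦ hle z (hsub hz))
        rw [ENNReal.ofReal_mul hr.le]
        gcongr
        exact hx.2
    _ = _ := by
        rw [setLIntegral_const, Real.volume_Ioc, sub_zero, ← ENNReal.ofReal_mul']
        · congr 1
          ring
        · exact hr.le

lemma measurable_riemannZeta : Measurable riemannZeta :=
  measurable_of_continuousOn_compl_singleton 1 fun _ hz ↦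
    (differentiableAt_riemannZeta hz).continuousAt.continuousWithinAt

lemma exists_lintegral_closedBall_enorm_log_norm_riemannZeta_le :
    ∃ C : ℝ, 0 < C ∧ ∀ k : ℤ, 3 ≤ |(k : ℝ)| →
    ∫⁻ z in Metric.closedBall (2 + k * I : ℂ) (8 / 5), ‖Real.log ‖riemannZeta z‖‖ₑ
      ≤ ENNReal.ofReal (C * (1 + Real.log |(k : ℝ)|)) := by
  obtain ⟨C, hC, hb⟩ := exists_norm_riemannZeta_le
  set D : ℝ := max (Real.log (3 * C)) 0 with hD
  have hD0 : 0 ≤ D := le_max_right _ _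
  refine ⟨(8 / 5) ^ 2 * (2 * π) * (2 * D + 6), by positivity, fun k hk ↦ ?_⟩
  have hk0 : 0 ≤ Real.log |(k : ℝ)| := Real.log_nonneg (by linarith)
  have him : ∀ z ∈ Metric.closedBall (2 + k * I : ℂ) (8 / 5), 3 / 10 ≤ z.re ∧ 1 ≤ |z.im| ∧
      ‖z‖ ≤ 2 + |(k : ℝ)| + 8 / 5 := by
    intro z hz
    rw [mem_closedBall_iff_norm] at hz
    have h1 := (abs_re_le_norm _).trans hz
    have h2 := (abs_im_le_norm _).trans hz
    simp at h1 h2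
    refine ⟨by linarith [(abs_le.mp h1).1], ?_, ?_⟩
    · have := abs_sub_abs_le_abs_sub (k : ℝ) z.im
      rw [abs_sub_comm] at this
      linarith
    · have h3 := norm_le_norm_add_norm_sub' z (2 + k * I : ℂ)
      have h4 : ‖(2 + k * I : ℂ)‖ ≤ 2 + |(k : ℝ)| := by
        refine (norm_add_le _ _).trans ?_
        simp
      linarith
  have hc : riemannZeta (2 + k * I) ≠ 0 := riemannZeta_ne_zero_of_one_le_re (by simp)
  have hlc : |Real.log ‖riemannZeta (2 + k * I)‖| ≤ 4 := by
    have := abs_log_norm_riemannZeta_le (s := 2 + k * I) (by simp)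
    simpa using this
  have key := lintegral_closedBall_enorm_log_norm_le (f := riemannZeta) (c := 2 + k * I)
    (r := 8 / 5) (B := D + Real.log |(k : ℝ)|) (by norm_num) measurable_riemannZeta
    (fun z hz ↦ analyticAt_riemannZeta (by
      rintro rfl
      have := (him 1 hz).2.1
      norm_num at this)) hc (by positivity) (fun z hz ↦ by
      obtain ⟨h1, h2, h3⟩ := him z hz
      rcases eq_or_ne (riemannZeta z) 0 with h0 | h0
      · rw [h0]
        simp
        positivity
      have h4 : ‖riemannZeta z‖ ≤ (3 * C) * |(k : ℝ)| := by
        refine (hb z h1 h2).trans ?_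
        nlinarith
      calc _ ≤ Real.log ((3 * C) * |(k : ℝ)|) := Real.log_le_log (norm_pos_iff.mpr h0) h4
        _ = Real.log (3 * C) + Real.log |(k : ℝ)| :=
          Real.log_mul (by positivity) (by linarith)
        _ ≤ _ := by gcongr; exact le_max_left _ _)
  refine key.trans (ENNReal.ofReal_le_ofReal ?_)
  have h : 2 * (D + Real.log |(k : ℝ)|) - Real.log ‖riemannZeta (2 + k * I)‖
      ≤ (2 * D + 6) * (1 + Real.log |(k : ℝ)|) := by
    nlinarith [(abs_le.mp hlc).1, mul_nonneg hD0 hk0]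
  calc _ ≤ (8 / 5 : ℝ) ^ 2 * (2 * π * ((2 * D + 6) * (1 + Real.log |(k : ℝ)|))) := by
        gcongr
    _ = _ := by ring

lemma lintegral_farRight_log_norm_riemannZeta_lt_top {η : ℝ} (hη : 0 < η) :
    ∫⁻ p in {p : ℂ | 3 < ‖p‖ ∧ 3 / 2 ≤ p.re},
      ‖Real.log ‖riemannZeta (1 / 2 + p)‖‖ₑ * ENNReal.ofReal (‖p‖ ^ (-(1 + η))) < ⊤ := by
  have hint : Integrable (fun q : ℝ × ℝ ↦ ((Ici (3 / 2 : ℝ)).indicator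
      (fun x ↦ Real.exp (-Real.log 2 * x)) q.1) * ((1 + ‖q.2‖) ^ (-(1 + η)))) := by
    refine Integrable.mul_prod (f := (Ici (3 / 2 : ℝ)).indicator
      (fun x ↦ Real.exp (-Real.log 2 * x))) (g := fun y : ℝ ↦ (1 + ‖y‖) ^ (-(1 + η))) ?_ ?_
    · rw [integrable_indicator_iff measurableSet_Ici, integrableOn_Ici_iff_integrableOn_Ioi]
      exact integrableOn_exp_mul_Ioi (neg_lt_zero.mpr (Real.log_pos one_lt_two)) _
    · exact integrable_one_add_norm (by simpa using hη)
  have hint2 := (Complex.volume_preserving_equiv_real_prod.integrable_comp_emb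
    measurableEquivRealProd.measurableEmbedding).mpr (hint.const_mul
      (4 * (2 : ℝ) ^ (3 / 2 : ℝ) * 2 ^ (1 + η)))
  have hms : MeasurableSet {p : ℂ | 3 < ‖p‖ ∧ 3 / 2 ≤ p.re} := by measurability
  refine lt_of_le_of_lt ?_ hint2.2
  rw [← lintegral_indicator hms]
  refine lintegral_mono fun p ↦ ?_
  by_cases hp : p ∈ {p : ℂ | 3 < ‖p‖ ∧ 3 / 2 ≤ p.re}
  swap
  · rw [indicator_of_notMem hp]
    simp
  rw [indicator_of_mem hp]
  have hre : 3 / 2 ≤ p.re := hp.2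
  have hn : 3 < ‖p‖ := hp.1
  have h1 := abs_log_norm_riemannZeta_le (s := 1 / 2 + p) (by simp; linarith)
  have h2 : ‖p‖ ^ (-(1 + η)) ≤ 2 ^ (1 + η) * (1 + ‖p.im‖) ^ (-(1 + η)) := by
    have h3 : (1 + ‖p.im‖) / 2 ≤ ‖p‖ := by
      have := abs_im_le_norm p
      rw [Real.norm_eq_abs]
      linarith
    calc _ ≤ ((1 + ‖p.im‖) / 2) ^ (-(1 + η)) :=
          Real.rpow_le_rpow_of_nonpos (by positivity) h3 (by linarith)
      _ = _ := by
          rw [Real.div_rpow (by positivity) (by norm_num), Real.rpow_neg (by norm_num : (0 : ℝ) ≤ 2),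
            div_inv_eq_mul, mul_comm]
  simp only [Function.comp, measurableEquivRealProd_apply, indicator_of_mem (mem_Ici.mpr hre)]
  rw [Real.enorm_eq_ofReal_abs, ← ENNReal.ofReal_mul (abs_nonneg _),
    Real.enorm_of_nonneg (by positivity)]
  refine ENNReal.ofReal_le_ofReal ?_
  have h4 : (2 : ℝ) ^ (2 - (1 / 2 + p).re) = 2 ^ (3 / 2 : ℝ) * Real.exp (-Real.log 2 * p.re) := by
    have : 2 - (1 / 2 + p).re = 3 / 2 + (-p.re) := by simp; ring
    rw [this, Real.rpow_add (by norm_num), Real.rpow_def_of_pos (by norm_num : (0 : ℝ) < 2) (-p.re)]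
    ring_nf
  rw [h4] at h1
  calc _ ≤ _ := mul_le_mul h1 h2 (by positivity) (by positivity)
    _ = _ := by ring

lemma lintegral_strip_log_norm_riemannZeta_lt_top {η : ℝ} (hη : 0 < η) :
    ∫⁻ p in {p : ℂ | 3 < ‖p‖ ∧ 0 < p.re ∧ p.re < 3 / 2},
      ‖Real.log ‖riemannZeta (1 / 2 + p)‖‖ₑ * ENNReal.ofReal (‖p‖ ^ (-(1 + η))) < ⊤ := by
  obtain ⟨C, hC, hb⟩ := exists_lintegral_closedBall_enorm_log_norm_riemannZeta_le
  set box : ℤ → Set ℂ := fun k ↦ {p : ℂ | 3 ≤ |(k : ℝ)| ∧ 0 < p.re ∧ p.re < 3 / 2 ∧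
    |p.im - k| ≤ 1 / 2} with hbox
  have hsub : {p : ℂ | 3 < ‖p‖ ∧ 0 < p.re ∧ p.re < 3 / 2} ⊆ ⋃ k, box k := by
    rintro p ⟨h1, h2, h3⟩
    refine mem_iUnion.mpr ⟨round p.im, ?_, h2, h3, abs_sub_round p.im⟩
    have h4 := abs_sub_round p.im
    have h5 : 5 / 2 < |p.im| := by
      by_contra! h
      have h6 : ‖p‖ ^ 2 = p.re * p.re + p.im * p.im := by
        rw [← Complex.normSq_eq_norm_sq, Complex.normSq_apply]
      have h7 : p.im * p.im ≤ (5 / 2) ^ 2 := by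
        rw [← abs_mul_abs_self]
        nlinarith [abs_nonneg p.im]
      nlinarith
    have h6 := abs_sub_abs_le_abs_sub p.im (round p.im : ℝ)
    have h7 : (2 : ℝ) < |(round p.im : ℝ)| := by linarith
    have h8 : (2 : ℤ) < |round p.im| := by exact_mod_cast h7
    exact_mod_cast (show (3 : ℤ) ≤ |round p.im| by omega)
  set F : ℂ → ENNReal := fun p ↦
    ‖Real.log ‖riemannZeta (1 / 2 + p)‖‖ₑ * ENNReal.ofReal (‖p‖ ^ (-(1 + η))) with hF
  have hterm : ∀ k, ∫⁻ p in box k, F p ≤ ENNReal.ofReal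
      (2 ^ (1 + η) * C * (1 + 2 / η) * |(k : ℝ)| ^ (-(1 + η / 2))) := by
    intro k
    by_cases hk : 3 ≤ |(k : ℝ)|
    swap
    · have : box k = ∅ := by
        ext p
        simp only [hbox, mem_ofPred_eq, mem_empty_iff_false, iff_false]
        tauto
      simp [this]
    have hk0 : 0 < |(k : ℝ)| := by linarith
    have hmb : MeasurableSet (box k) := by
      simp only [hbox, hk, true_and]
      measurability
    calc ∫⁻ p in box k, F p
        ≤ ∫⁻ p in box k, ‖Real.log ‖riemannZeta (1 / 2 + p)‖‖ₑ
            * ENNReal.ofReal (2 ^ (1 + η) * |(k : ℝ)| ^ (-(1 + η))) := by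
          refine setLIntegral_mono' hmb fun p hp ↦ ?_
          obtain ⟨_, h1, h2, h3⟩ := hp
          simp only [hF]
          gcongr
          have h5 : |(k : ℝ)| / 2 ≤ ‖p‖ := by
            have h6 := abs_sub_abs_le_abs_sub (k : ℝ) p.im
            rw [abs_sub_comm] at h6
            linarith [abs_im_le_norm p]
          calc _ ≤ (|(k : ℝ)| / 2) ^ (-(1 + η)) :=
                Real.rpow_le_rpow_of_nonpos (by positivity) h5 (by linarith)
            _ = _ := by
              rw [Real.div_rpow (by positivity) (by norm_num),
                Real.rpow_neg (by norm_num : (0 : ℝ) ≤ 2), div_inv_eq_mul, mul_comm]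
      _ = (∫⁻ p in box k, ‖Real.log ‖riemannZeta (1 / 2 + p)‖‖ₑ)
            * ENNReal.ofReal (2 ^ (1 + η) * |(k : ℝ)| ^ (-(1 + η))) := by
          rw [lintegral_mul_const]
          have := measurable_riemannZeta
          fun_prop
      _ ≤ (∫⁻ z in Metric.closedBall (2 + k * I : ℂ) (8 / 5), ‖Real.log ‖riemannZeta z‖‖ₑ)
            * ENNReal.ofReal (2 ^ (1 + η) * |(k : ℝ)| ^ (-(1 + η))) := by
          refine mul_le_mul_left ?_ _
          rw [← lintegral_indicator hmb, ← lintegral_indicator measurableSet_closedBall,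
            ← lintegral_add_left_eq_self ((Metric.closedBall (2 + k * I : ℂ) (8 / 5)).indicator _)
              (1 / 2 : ℂ)]
          refine lintegral_mono fun p ↦ ?_
          by_cases hp : p ∈ box k
          swap
          · rw [indicator_of_notMem hp]
            simp
          have hp2 : 1 / 2 + p ∈ Metric.closedBall (2 + k * I : ℂ) (8 / 5) := by
            obtain ⟨_, h1, h2, h3⟩ := hp
            rw [mem_closedBall_iff_norm, ← sq_le_sq₀ (norm_nonneg _) (by norm_num),
              ← Complex.normSq_eq_norm_sq, Complex.normSq_apply]
            simp
            rw [abs_le] at h3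
            nlinarith
          rw [indicator_of_mem hp, indicator_of_mem hp2]
      _ ≤ ENNReal.ofReal (C * (1 + Real.log |(k : ℝ)|))
            * ENNReal.ofReal (2 ^ (1 + η) * |(k : ℝ)| ^ (-(1 + η))) := by
          gcongr
          exact hb k hk
      _ ≤ _ := by
          rw [← ENNReal.ofReal_mul' (by positivity)]
          refine ENNReal.ofReal_le_ofReal ?_
          have h1 : Real.log |(k : ℝ)| ≤ |(k : ℝ)| ^ (η / 2) / (η / 2) :=
            Real.log_le_rpow_div hk0.le (by positivity)
          have h2 : 1 ≤ |(k : ℝ)| ^ (η / 2) := Real.one_le_rpow (by linarith) (by positivity)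
          have h3 : 1 + Real.log |(k : ℝ)| ≤ (1 + 2 / η) * |(k : ℝ)| ^ (η / 2) := by
            have : |(k : ℝ)| ^ (η / 2) / (η / 2) = 2 / η * |(k : ℝ)| ^ (η / 2) := by field_simp
            linarith
          calc _ ≤ C * ((1 + 2 / η) * |(k : ℝ)| ^ (η / 2)) * (2 ^ (1 + η) * |(k : ℝ)| ^ (-(1 + η))) := by
                gcongr
            _ = 2 ^ (1 + η) * C * (1 + 2 / η) * (|(k : ℝ)| ^ (η / 2) * |(k : ℝ)| ^ (-(1 + η))) := by
                ring
            _ = _ := by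
                rw [← Real.rpow_add hk0]
                congr 2
                ring
  have hsum : Summable fun k : ℤ ↦ 2 ^ (1 + η) * C * (1 + 2 / η) * |(k : ℝ)| ^ (-(1 + η / 2)) :=
    (Real.summable_abs_int_rpow (by linarith)).mul_left _
  calc _ ≤ ∫⁻ p in ⋃ k, box k, F p := lintegral_mono_set hsub
    _ ≤ ∑' k, ∫⁻ p in box k, F p := lintegral_iUnion_le _ _
    _ ≤ ∑' k : ℤ, ENNReal.ofReal (2 ^ (1 + η) * C * (1 + 2 / η) * |(k : ℝ)| ^ (-(1 + η / 2))) :=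
        ENNReal.tsum_le_tsum hterm
    _ < ⊤ := by
        rw [← ENNReal.ofReal_tsum_of_nonneg (fun k ↦ by positivity) hsum]
        exact ENNReal.ofReal_lt_top

lemma lintegral_halfCircle_log_norm_riemannZeta_lt_top {κ : ℝ} (hκ : -1 < κ) :
    ∫⁻ R in Ioi (3 : ℝ), (∫⁻ θ in Ioo (-(π / 2)) (π / 2),
      ‖Real.log ‖riemannZeta (circleMap (1 / 2) R θ)‖‖ₑ) * ENNReal.ofReal (R ^ (-κ - 1)) < ⊤ := by
  set F : ℂ → ENNReal := fun p ↦
    ‖Real.log ‖riemannZeta (1 / 2 + p)‖‖ₑ * ENNReal.ofReal (‖p‖ ^ (-(1 + (κ + 1)))) with hF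
  have hm := measurable_riemannZeta
  set S : Set ℂ := {p : ℂ | 3 < ‖p‖ ∧ 0 < p.re} with hS
  have hmS : MeasurableSet S := by measurability
  have hfin : ∫⁻ p in S, F p < ⊤ := by
    have hsub : S ⊆ {p : ℂ | 3 < ‖p‖ ∧ 3 / 2 ≤ p.re}
        ∪ {p : ℂ | 3 < ‖p‖ ∧ 0 < p.re ∧ p.re < 3 / 2} := by
      rintro p ⟨h1, h2⟩
      rcases le_or_gt (3 / 2) p.re with h | h
      · exact Or.inl ⟨h1, h⟩
      · exact Or.inr ⟨h1, h2, h⟩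
    refine (lintegral_mono_set hsub).trans_lt ((lintegral_union_le _ _ _).trans_lt ?_)
    exact ENNReal.add_lt_top.mpr ⟨lintegral_farRight_log_norm_riemannZeta_lt_top (by linarith),
      lintegral_strip_log_norm_riemannZeta_lt_top (by linarith)⟩
  refine lt_of_le_of_lt ?_ hfin
  rw [← lintegral_indicator hmS, ← Complex.lintegral_comp_polarCoord_symm]
  have hcm : ∀ p : ℝ × ℝ, 1 / 2 + Complex.polarCoord.symm p = circleMap (1 / 2) p.1 p.2 := by
    intro p
    rw [Complex.polarCoord_symm_apply, circleMap, Complex.exp_mul_I]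
    push_cast
    rfl
  have hmc : Measurable fun p : ℝ × ℝ ↦ circleMap (1 / 2) p.1 p.2 := by
    unfold circleMap
    fun_prop
  have hprod : ∫⁻ R in Ioi (3 : ℝ), (∫⁻ θ in Ioo (-(π / 2)) (π / 2),
      ‖Real.log ‖riemannZeta (circleMap (1 / 2) R θ)‖‖ₑ) * ENNReal.ofReal (R ^ (-κ - 1))
      = ∫⁻ p in Ioi (3 : ℝ) ×ˢ Ioo (-(π / 2)) (π / 2),
        ‖Real.log ‖riemannZeta (circleMap (1 / 2) p.1 p.2)‖‖ₑ
          * ENNReal.ofReal (p.1 ^ (-κ - 1)) := by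
    rw [Measure.volume_eq_prod, ← Measure.prod_restrict, lintegral_prod _ (by fun_prop)]
    refine lintegral_congr fun R ↦ ?_
    refine (lintegral_mul_const (ENNReal.ofReal (R ^ (-κ - 1))) ?_).symm
    have := hmc.comp (by fun_prop : Measurable fun θ : ℝ ↦ (R, θ))
    simp only [Function.comp_def] at this
    fun_prop
  rw [hprod, ← lintegral_indicator (by measurability),
    ← lintegral_indicator (by measurability)]
  refine lintegral_mono fun p ↦ ?_
  by_cases hp : p ∈ Ioi (3 : ℝ) ×ˢ Ioo (-(π / 2)) (π / 2)
  swap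
  · rw [indicator_of_notMem hp]
    simp
  obtain ⟨h1, h2⟩ := hp
  have h1' : 3 < p.1 := h1
  have hp0 : 0 < p.1 := by linarith
  have hpt : p ∈ polarCoord.target := by
    rw [polarCoord_target]
    exact ⟨hp0, by linarith [h2.1, Real.pi_pos], by linarith [h2.2, Real.pi_pos]⟩
  have hnp : ‖Complex.polarCoord.symm p‖ = p.1 := by
    rw [norm_polarCoord_symm, abs_of_pos hp0]
  have hpS : Complex.polarCoord.symm p ∈ S := by
    refine ⟨by rwa [hnp], ?_⟩
    rw [Complex.polarCoord_symm_apply]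
    simp
    exact mul_pos hp0 (Real.cos_pos_of_mem_Ioo h2)
  rw [indicator_of_mem (mem_prod.mpr ⟨h1, h2⟩), indicator_of_mem hpt, indicator_of_mem hpS]
  simp only [hF, hnp, hcm, smul_eq_mul]
  rw [mul_left_comm, ← ENNReal.ofReal_mul hp0.le]
  refine le_of_eq ?_
  congr 2
  rw [show -κ - 1 = 1 + -(1 + (κ + 1)) by ring, Real.rpow_add hp0, Real.rpow_one]

/-! ### Counting the zeros by Jensen's formula -/

/-- The nontrivial zeros in the upper half plane. -/
abbrev UpperZero : Type := {ρ : ℂ // IsNontrivialZero ρ ∧ 0 < ρ.im}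

/-- The distance of a point to `1 / 2`, truncated from below at `1`. -/
def truncRadius (u : ℂ) : ℝ := max ‖u - 1 / 2‖ 1

lemma one_le_truncRadius (u : ℂ) : 1 ≤ truncRadius u := le_max_right _ _

lemma truncRadius_one_sub (u : ℂ) : truncRadius (1 - u) = truncRadius u := by
  rw [truncRadius, truncRadius, ← norm_neg]
  congr 2
  ring

/-- The smoothed counting function of the zeros in the upper half plane. -/
def upperLogCount (R : ℝ) : ℝ :=
  ∑' ρ : UpperZero, (zetaMult ρ.1 : ℝ) * Real.posLog (R / truncRadius ρ.1)

/-- The nontrivial zeros in the closed disc of radius `R` about `1 / 2`. -/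
def zerosInDisc (R : ℝ) : Finset ℂ :=
  (finite_isNontrivialZero_inter_closedBall (1 / 2) R).toFinset

lemma mem_zerosInDisc {R : ℝ} {u : ℂ} :
    u ∈ zerosInDisc R ↔ IsNontrivialZero u ∧ ‖u - 1 / 2‖ ≤ R := by
  simp [zerosInDisc]

lemma posLog_div_truncRadius_of_lt {R : ℝ} (hR : 0 < R) {u : ℂ} (h : R < ‖u - 1 / 2‖) :
    Real.posLog (R / truncRadius u) = 0 := by
  have h1 : R ≤ truncRadius u := h.le.trans (le_max_left _ _)
  have h0 : 0 < truncRadius u := one_pos.trans_le (one_le_truncRadius u)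
  rw [Real.posLog_eq_zero_iff, abs_of_pos (by positivity)]
  exact (div_le_one h0).mpr h1

lemma upperLogCount_eq_sum {R : ℝ} (hR : 0 < R) :
    upperLogCount R = ∑ u ∈ zerosInDisc R with 0 < u.im,
      (zetaMult u : ℝ) * Real.posLog (R / truncRadius u) := by
  refine (tsum_subtype {ρ : ℂ | IsNontrivialZero ρ ∧ 0 < ρ.im}
    (fun u ↦ (zetaMult u : ℝ) * Real.posLog (R / truncRadius u))).trans ?_
  rw [tsum_eq_sum (s := (zerosInDisc R).filter fun u ↦ 0 < u.im)]
  · refine Finset.sum_congr rfl fun u hu ↦ ?_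
    rw [Finset.mem_filter, mem_zerosInDisc] at hu
    exact indicator_of_mem (show u ∈ {ρ : ℂ | IsNontrivialZero ρ ∧ 0 < ρ.im} from
      ⟨hu.1.1, hu.2⟩) _
  · intro u hu
    by_cases h : u ∈ {ρ : ℂ | IsNontrivialZero ρ ∧ 0 < ρ.im}
    · rw [indicator_of_mem h, posLog_div_truncRadius_of_lt hR, mul_zero]
      by_contra! h2
      exact hu (Finset.mem_filter.mpr ⟨mem_zerosInDisc.mpr ⟨h.1, h2⟩, h.2⟩)
    · exact indicator_of_notMem h _

lemma summable_upperLogCount {R : ℝ} (hR : 0 < R) :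
    Summable fun ρ : UpperZero ↦ (zetaMult ρ.1 : ℝ) * Real.posLog (R / truncRadius ρ.1) := by
  refine summable_of_hasFiniteSupport (Set.Finite.subset
    ((zerosInDisc R).finite_toSet.preimage Subtype.val_injective.injOn) fun ρ hρ ↦ ?_)
  by_contra h
  refine hρ ?_
  dsimp only
  rw [posLog_div_truncRadius_of_lt hR, mul_zero]
  by_contra! h2
  exact h (mem_zerosInDisc.mpr ⟨ρ.2.1, h2⟩)

lemma divisor_xi_apply {R : ℝ} {u : ℂ} (hu : u ∈ Metric.closedBall (1 / 2 : ℂ) R) :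
    MeromorphicOn.divisor xi (Metric.closedBall (1 / 2 : ℂ) R) u
      = if u ∈ zerosInDisc R then (zetaMult u : ℤ) else 0 := by
  rw [MeromorphicOn.AnalyticOnNhd.divisor_apply (fun s _ ↦ analyticAt_xi s) hu]
  split_ifs with h
  · rw [analyticOrderAt_xi (mem_zerosInDisc.mp h).1]
    rfl
  · have : xi u ≠ 0 := fun h0 ↦ h (mem_zerosInDisc.mpr
      ⟨xi_eq_zero_iff.mp h0, by simpa [dist_eq_norm] using hu⟩)
    rw [(analyticAt_xi u).analyticOrderAt_eq_zero.mpr this]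
    rfl

lemma log_mul_inv_norm_eq {R : ℝ} (hR : 1 ≤ R) {u : ℂ} (hu : ‖u - 1 / 2‖ ≤ R) :
    Real.log (R * ‖1 / 2 - u‖⁻¹) = Real.posLog (R / truncRadius u)
      + (Real.log (truncRadius u) - Real.log ‖u - 1 / 2‖)
      - if u = 1 / 2 then Real.log R else 0 := by
  have h0 : 0 < truncRadius u := one_pos.trans_le (one_le_truncRadius u)
  have h1 : Real.posLog (R / truncRadius u) = Real.log R - Real.log (truncRadius u) := by
    rw [Real.posLog_eq_log, Real.log_div (by linarith) h0.ne']
    rw [abs_of_pos (by positivity), one_le_div h0]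
    exact max_le hu hR
  rw [h1, norm_sub_rev]
  split_ifs with h
  · simp [h]
  · have : ‖u - 1 / 2‖ ≠ 0 := norm_ne_zero_iff.mpr (sub_ne_zero.mpr h)
    rw [Real.log_mul (by linarith) (inv_ne_zero this), Real.log_inv]
    ring

lemma sum_zerosInDisc_lower {R : ℝ} :
    ∑ u ∈ zerosInDisc R with u.im < 0, (zetaMult u : ℝ) * Real.posLog (R / truncRadius u)
      = ∑ u ∈ zerosInDisc R with 0 < u.im,
        (zetaMult u : ℝ) * Real.posLog (R / truncRadius u) := by
  have hmem : ∀ u, u ∈ zerosInDisc R → 1 - u ∈ zerosInDisc R := by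
    intro u hu
    rw [mem_zerosInDisc] at hu ⊢
    refine ⟨isNontrivialZero_one_sub_iff.mpr hu.1, ?_⟩
    rw [← norm_neg]
    convert hu.2 using 1
    congr 1
    ring
  refine Finset.sum_nbij' (fun u ↦ 1 - u) (fun u ↦ 1 - u) ?_ ?_ ?_ ?_ ?_
  · intro u hu
    rw [Finset.mem_filter] at hu ⊢
    exact ⟨hmem u hu.1, by simpa using hu.2⟩
  · intro u hu
    rw [Finset.mem_filter] at hu ⊢
    exact ⟨hmem u hu.1, by simpa using hu.2⟩
  · simp
  · simp
  · intro u hu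
    rw [Finset.mem_filter, mem_zerosInDisc] at hu
    rw [truncRadius_one_sub, zetaMult_one_sub hu.1.1]

lemma norm_sub_half_lt_one {u : ℂ} (hu : IsNontrivialZero u) (h : u.im = 0) :
    ‖u - 1 / 2‖ < 1 := by
  have h1 : u - 1 / 2 = ((u.re - 1 / 2 : ℝ) : ℂ) := by
    apply Complex.ext <;> simp [h]
  rw [h1, Complex.norm_real, Real.norm_eq_abs, abs_lt]
  constructor <;> linarith [hu.2.1, hu.2.2]

lemma exists_circleAverage_log_norm_xi_eq : ∃ c d : ℝ, ∀ R : ℝ, 1 ≤ R →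
    circleAverage (fun z ↦ Real.log ‖xi z‖) (1 / 2) R
      = 2 * upperLogCount R + c * Real.log R + d := by
  refine ⟨∑ u ∈ zerosInDisc 1 with u.im = 0, (zetaMult u : ℝ),
    ∑ u ∈ zerosInDisc 1, (zetaMult u : ℝ) * (Real.log (truncRadius u) - Real.log ‖u - 1 / 2‖)
      + Real.log ‖meromorphicTrailingCoeffAt xi (1 / 2)‖, fun R hR ↦ ?_⟩
  have hR0 : 0 < R := by linarith
  have hmer : MeromorphicOn xi (Metric.closedBall (1 / 2) |R|) :=
    fun s _ ↦ (analyticAt_xi s).meromorphicAt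
  rw [MeromorphicOn.circleAverage_log_norm hR0.ne' hmer, abs_of_pos hR0]
  have hsub : zerosInDisc 1 ⊆ zerosInDisc R := fun u hu ↦ by
    rw [mem_zerosInDisc] at hu ⊢
    exact ⟨hu.1, hu.2.trans hR⟩
  have hfs : ∑ᶠ u, (MeromorphicOn.divisor xi (Metric.closedBall (1 / 2) R) u : ℝ)
      * Real.log (R * ‖1 / 2 - u‖⁻¹)
      = ∑ u ∈ zerosInDisc R, (zetaMult u : ℝ) * Real.log (R * ‖1 / 2 - u‖⁻¹) := by
    rw [finsum_eq_sum_of_support_subset (s := zerosInDisc R)]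
    · refine Finset.sum_congr rfl fun u hu ↦ ?_
      have hu' : u ∈ Metric.closedBall (1 / 2 : ℂ) R := by
        simpa [dist_eq_norm] using (mem_zerosInDisc.mp hu).2
      rw [divisor_xi_apply hu', if_pos hu]
      rfl
    · intro u hu
      by_contra h
      refine hu ?_
      dsimp only
      by_cases hu' : u ∈ Metric.closedBall (1 / 2 : ℂ) R
      · rw [divisor_xi_apply hu', if_neg (by simpa using h)]
        simp
      · rw [Function.locallyFinsuppWithin.apply_eq_zero_of_notMem _ hu']
        simp
  have hcen : (MeromorphicOn.divisor xi (Metric.closedBall (1 / 2) R) (1 / 2) : ℝ) * Real.log R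
      = ∑ u ∈ zerosInDisc R, (zetaMult u : ℝ) * if u = 1 / 2 then Real.log R else 0 := by
    rw [divisor_xi_apply (Metric.mem_closedBall_self hR0.le)]
    simp only [mul_ite, mul_zero, Finset.sum_ite_eq']
    split_ifs <;> simp
  have hφ : ∑ u ∈ zerosInDisc R, (zetaMult u : ℝ)
        * (Real.log (truncRadius u) - Real.log ‖u - 1 / 2‖)
      = ∑ u ∈ zerosInDisc 1, (zetaMult u : ℝ)
        * (Real.log (truncRadius u) - Real.log ‖u - 1 / 2‖) := by
    refine (Finset.sum_subset hsub fun u hu hu1 ↦ ?_).symm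
    have : 1 < ‖u - 1 / 2‖ := by
      by_contra! h
      exact hu1 (mem_zerosInDisc.mpr ⟨(mem_zerosInDisc.mp hu).1, h⟩)
    rw [truncRadius, max_eq_left this.le, sub_self, mul_zero]
  have hreal : ∑ u ∈ zerosInDisc R with u.im = 0,
        (zetaMult u : ℝ) * Real.posLog (R / truncRadius u)
      = (∑ u ∈ zerosInDisc 1 with u.im = 0, (zetaMult u : ℝ)) * Real.log R := by
    rw [Finset.sum_mul]
    have : (zerosInDisc R).filter (fun u ↦ u.im = 0)
        = (zerosInDisc 1).filter (fun u ↦ u.im = 0) := by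
      refine (Finset.filter_subset_filter _ hsub).antisymm' fun u hu ↦ ?_
      rw [Finset.mem_filter, mem_zerosInDisc] at hu ⊢
      exact ⟨⟨hu.1.1, (norm_sub_half_lt_one hu.1.1 hu.2).le⟩, hu.2⟩
    rw [this]
    refine Finset.sum_congr rfl fun u hu ↦ ?_
    rw [Finset.mem_filter, mem_zerosInDisc] at hu
    rw [truncRadius, max_eq_right hu.1.2, div_one, Real.posLog_eq_log (by rwa [abs_of_pos hR0])]
  have hsplit : ∑ u ∈ zerosInDisc R, (zetaMult u : ℝ) * Real.posLog (R / truncRadius u)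
      = 2 * upperLogCount R
        + (∑ u ∈ zerosInDisc 1 with u.im = 0, (zetaMult u : ℝ)) * Real.log R := by
    rw [upperLogCount_eq_sum hR0, ← hreal, two_mul]
    nth_rewrite 1 [← sum_zerosInDisc_lower]
    rw [← Finset.sum_filter_add_sum_filter_not (zerosInDisc R) (fun u ↦ u.im < 0),
      ← Finset.sum_filter_add_sum_filter_not ((zerosInDisc R).filter fun u ↦ ¬ u.im < 0)
        (fun u ↦ 0 < u.im), Finset.filter_filter, Finset.filter_filter, add_assoc]
    congr 2
    · congr 1
      refine Finset.filter_congr fun u _ ↦ ?_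
      constructor
      · exact fun h ↦ h.2
      · exact fun h ↦ ⟨by linarith, h⟩
    · congr 1
      refine Finset.filter_congr fun u _ ↦ ?_
      constructor
      · exact fun h ↦ le_antisymm (not_lt.mp h.2) (not_lt.mp h.1)
      · intro h
        simp [h]
  rw [hfs, hcen, ← hφ]
  have : ∀ u ∈ zerosInDisc R, (zetaMult u : ℝ) * Real.log (R * ‖1 / 2 - u‖⁻¹)
      = (zetaMult u : ℝ) * Real.posLog (R / truncRadius u)
        + (zetaMult u : ℝ) * (Real.log (truncRadius u) - Real.log ‖u - 1 / 2‖)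
        - (zetaMult u : ℝ) * if u = 1 / 2 then Real.log R else 0 := by
    intro u hu
    rw [log_mul_inv_norm_eq hR (mem_zerosInDisc.mp hu).2]
    ring
  rw [Finset.sum_congr rfl this, Finset.sum_sub_distrib, Finset.sum_add_distrib, hsplit]
  ring

lemma intervalIntegrable_log_norm_xi (R a b : ℝ) :
    IntervalIntegrable (fun θ ↦ Real.log ‖xi (circleMap (1 / 2) R θ)‖) volume a b := by
  have h1 : CircleIntegrable (fun z ↦ Real.log ‖xi z‖) (1 / 2) R :=
    MeromorphicOn.circleIntegrable_log_norm (fun s _ ↦ (analyticAt_xi s).meromorphicAt)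
  have h2 : Function.Periodic (fun θ ↦ Real.log ‖xi (circleMap (1 / 2) R θ)‖) (2 * π) :=
    (periodic_circleMap (1 / 2) R).comp fun z ↦ Real.log ‖xi z‖
  exact h2.intervalIntegrable₀ (by positivity) h1 a b

lemma circleAverage_log_norm_xi (R : ℝ) :
    circleAverage (fun z ↦ Real.log ‖xi z‖) (1 / 2) R
      = π⁻¹ * ∫ θ in Ioo (-(π / 2)) (π / 2), Real.log ‖xi (circleMap (1 / 2) R θ)‖ := by
  set g : ℝ → ℝ := fun θ ↦ Real.log ‖xi (circleMap (1 / 2) R θ)‖ with hg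
  have hper : Function.Periodic g π := by
    intro θ
    have : circleMap (1 / 2) R (θ + π) = 1 - circleMap (1 / 2) R θ := by
      simp only [circleMap, ofReal_add, add_mul, Complex.exp_add, Complex.exp_pi_mul_I]
      ring
    simp only [hg, this, xi_one_sub]
  have h1 : ∫ θ in (0 : ℝ)..(2 * π), g θ = 2 * ∫ θ in (-(π / 2))..(π / 2), g θ := by
    rw [← intervalIntegral.integral_add_adjacent_intervals
      (intervalIntegrable_log_norm_xi R 0 π) (intervalIntegrable_log_norm_xi R π (2 * π))]
    have h2 := hper.intervalIntegral_add_eq 0 (-(π / 2))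
    have h3 := hper.intervalIntegral_add_eq π (-(π / 2))
    rw [zero_add, show -(π / 2) + π = π / 2 by ring] at h2
    rw [← two_mul, show -(π / 2) + π = π / 2 by ring] at h3
    change (∫ θ in (0 : ℝ)..π, g θ) + (∫ θ in π..(2 * π), g θ) = _
    rw [h2, h3]
    ring
  rw [circleAverage_def, smul_eq_mul]
  change (2 * π)⁻¹ * ∫ θ in (0 : ℝ)..(2 * π), g θ = _
  rw [h1, intervalIntegral.integral_of_le (by linarith [Real.pi_pos]),
    integral_Ioc_eq_integral_Ioo]
  field_simp

lemma ae_riemannZeta_halfCircle_ne_zero (R : ℝ) (hR : 3 < R) :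
    ∀ᵐ θ ∂(volume.restrict (Ioo (-(π / 2)) (π / 2))), riemannZeta (circleMap (1 / 2) R θ) ≠ 0 := by
  have hfin : {θ ∈ Ioo (-(π / 2)) (π / 2) | riemannZeta (circleMap (1 / 2) R θ) = 0}.Finite := by
    have hinj : InjOn (circleMap (1 / 2) R) {θ ∈ Ioo (-(π / 2)) (π / 2) |
        riemannZeta (circleMap (1 / 2) R θ) = 0} := by
      refine (injOn_circleMap_of_abs_sub_le' (a := -(π / 2)) (b := π / 2) (by linarith)
        (by linarith [Real.pi_pos])).mono fun θ hθ ↦ Ioo_subset_Ico_self hθ.1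
    refine Set.Finite.of_finite_image (Set.Finite.subset (zerosInDisc R).finite_toSet ?_) hinj
    rintro _ ⟨θ, ⟨hθ, h0⟩, rfl⟩
    have hre : 0 < (circleMap (1 / 2) R θ).re := by
      have : (circleMap (1 / 2) R θ).re = 1 / 2 + R * Real.cos θ := by
        simp [circleMap, Complex.exp_ofReal_mul_I_re]
      have := Real.cos_pos_of_mem_Ioo hθ
      have : 0 < R * Real.cos θ := by positivity
      linarith
    refine mem_zerosInDisc.mpr ⟨⟨h0, hre, ?_⟩, ?_⟩
    · by_contra! h
      exact riemannZeta_ne_zero_of_one_le_re h h0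
    · simp [circleMap, abs_of_pos (by linarith : 0 < R)]
  rw [ae_restrict_iff' measurableSet_Ioo]
  filter_upwards [compl_mem_ae_iff.mpr (hfin.measure_zero volume)] with θ hθ hθ2 h0
  exact hθ ⟨hθ2, h0⟩

lemma re_mul_log_exp {R θ : ℝ} (hR : 0 < R) (hθ : θ ∈ Ioo (-(π / 2)) (π / 2)) :
    ((R * Complex.exp (θ * I)) * Complex.log (R * Complex.exp (θ * I))).re
      = R * (Real.cos θ * Real.log R - θ * Real.sin θ) := by
  have h1 : Complex.log (R * Complex.exp (θ * I)) = Real.log R + θ * I := by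
    rw [Complex.log_ofReal_mul hR (Complex.exp_ne_zero _), Complex.log_exp]
    · simp
      linarith [hθ.1, Real.pi_pos]
    · simp
      linarith [hθ.2, Real.pi_pos]
  rw [h1]
  simp [Complex.exp_ofReal_mul_I_re, Complex.exp_ofReal_mul_I_im]
  ring

lemma exists_enorm_upperLogCount_sub_le : ∃ b c d : ℝ, ∀ R : ℝ, 3 < R →
    ‖upperLogCount R - (1 / (2 * π) * (R * Real.log R) + b * R + c * Real.log R + d)‖ₑ
      ≤ (∫⁻ θ in Ioo (-(π / 2)) (π / 2), ‖Real.log ‖riemannZeta (circleMap (1 / 2) R θ)‖‖ₑ)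
        + ENNReal.ofReal (40 / R) := by
  obtain ⟨c₁, d₁, h1⟩ := exists_circleAverage_log_norm_xi_eq
  obtain ⟨β, c₂, h2⟩ := exists_abs_log_norm_xi_sub_le
  set J : ℝ := ∫ θ in Ioo (-(π / 2)) (π / 2), θ * Real.sin θ with hJ
  refine ⟨(2 * π)⁻¹ * (2 * β - J / 2), 7 / 8 - c₁ / 2, c₂ / 2 - d₁ / 2, fun R hR ↦ ?_⟩
  have hR0 : 0 < R := by linarith
  have hpi := Real.pi_pos
  set μ := volume.restrict (Ioo (-(π / 2)) (π / 2)) with hμ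
  set m : ℝ → ℝ := fun θ ↦ R * (Real.cos θ * Real.log R - θ * Real.sin θ) / 2
    + β * (R * Real.cos θ) + 7 / 4 * Real.log R + c₂ with hm
  have hvol : μ.real univ = π := by
    rw [hμ, measureReal_restrict_apply_univ, Real.volume_real_Ioo_of_le (by linarith)]
    ring
  have hcos : ∫ θ, Real.cos θ ∂μ = 2 := by
    rw [hμ, ← integral_Ioc_eq_integral_Ioo, ← intervalIntegral.integral_of_le (by linarith),
      integral_cos, Real.sin_neg, Real.sin_pi_div_two]
    norm_num
  have hci : ∀ f : ℝ → ℝ, Continuous f → Integrable f μ := fun f hf ↦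
    (hf.integrableOn_Icc (a := -(π / 2)) (b := π / 2)).mono_set Ioo_subset_Icc_self
  have hmint : ∫ θ, m θ ∂μ
      = R * Real.log R + (2 * β - J / 2) * R + π * (7 / 4 * Real.log R + c₂) := by
    have : m = fun θ ↦ ((R * Real.log R / 2 + β * R) * Real.cos θ + (-(R / 2)) * (θ * Real.sin θ))
        + (7 / 4 * Real.log R + c₂) := by
      funext θ
      simp only [hm]
      ring
    rw [this, integral_add (hci _ (by fun_prop)) (hci _ (by fun_prop)),
      integral_add (hci _ (by fun_prop)) (hci _ (by fun_prop)), integral_const_mul,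
      integral_const_mul, integral_const, hvol, hcos, ← hJ, smul_eq_mul]
    ring
  have hxi : Integrable (fun θ ↦ Real.log ‖xi (circleMap (1 / 2) R θ)‖) μ := by
    have := (intervalIntegrable_log_norm_xi R (-(π / 2)) (π / 2)).1
    exact this.mono_set Ioo_subset_Ioc_self
  have heq : upperLogCount R - (1 / (2 * π) * (R * Real.log R)
      + (2 * π)⁻¹ * (2 * β - J / 2) * R + (7 / 8 - c₁ / 2) * Real.log R + (c₂ / 2 - d₁ / 2))
      = (2 * π)⁻¹ * ∫ θ, (Real.log ‖xi (circleMap (1 / 2) R θ)‖ - m θ) ∂μ := by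
    rw [integral_sub hxi (hci _ (by fun_prop)), hmint]
    have h3 := h1 R (by linarith)
    rw [circleAverage_log_norm_xi] at h3
    have h4 : ∫ θ, Real.log ‖xi (circleMap (1 / 2) R θ)‖ ∂μ
        = π * (2 * upperLogCount R + c₁ * Real.log R + d₁) := by
      rw [← h3, mul_inv_cancel_left₀ hpi.ne']
    rw [h4]
    field_simp
    ring
  rw [heq, enorm_mul]
  have hbound : ‖∫ θ, (Real.log ‖xi (circleMap (1 / 2) R θ)‖ - m θ) ∂μ‖ₑ
      ≤ (∫⁻ θ, ‖Real.log ‖riemannZeta (circleMap (1 / 2) R θ)‖‖ₑ ∂μ)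
        + ENNReal.ofReal (40 / R) := by
    refine (enorm_integral_le_lintegral_enorm _).trans ?_
    calc _ ≤ ∫⁻ θ, (‖Real.log ‖riemannZeta (circleMap (1 / 2) R θ)‖‖ₑ
            + ENNReal.ofReal (10 / R)) ∂μ := by
          refine lintegral_mono_ae ?_
          filter_upwards [ae_riemannZeta_halfCircle_ne_zero R hR,
            ae_restrict_mem measurableSet_Ioo] with θ h0 hθ
          have hp : circleMap (1 / 2) R θ = 1 / 2 + R * Complex.exp (θ * I) := rfl
          have hn : ‖(R : ℂ) * Complex.exp (θ * I)‖ = R := by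
            rw [norm_mul, Complex.norm_exp_ofReal_mul_I, Complex.norm_real, mul_one,
              Real.norm_of_nonneg hR0.le]
          have hre : ((R : ℂ) * Complex.exp (θ * I)).re = R * Real.cos θ := by
            simp [Complex.exp_ofReal_mul_I_re]
          have h5 := h2 (R * Complex.exp (θ * I)) (by rw [hn]; exact hR.le)
            (by rw [hre]; exact (mul_pos hR0 (Real.cos_pos_of_mem_Ioo hθ)).le) (hp ▸ h0)
          rw [re_mul_log_exp hR0 hθ, hn, hre, ← hp] at h5
          rw [Real.enorm_eq_ofReal_abs, Real.enorm_eq_ofReal_abs,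
            ← ENNReal.ofReal_add (abs_nonneg _) (by positivity)]
          refine ENNReal.ofReal_le_ofReal ?_
          have h6 : Real.log ‖xi (circleMap (1 / 2) R θ)‖ - m θ
              = Real.log ‖riemannZeta (circleMap (1 / 2) R θ)‖
                + (Real.log ‖xi (circleMap (1 / 2) R θ)‖
                - Real.log ‖riemannZeta (circleMap (1 / 2) R θ)‖ - m θ) := by ring
          rw [h6]
          exact (abs_add_le _ _).trans (by gcongr)
      _ = (∫⁻ θ, ‖Real.log ‖riemannZeta (circleMap (1 / 2) R θ)‖‖ₑ ∂μ)
            + ENNReal.ofReal (10 / R) * ENNReal.ofReal π := by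
          rw [lintegral_add_right _ measurable_const, lintegral_const, hμ,
            Measure.restrict_apply_univ, Real.volume_Ioo]
          congr 3
          ring
      _ ≤ _ := by
          gcongr
          rw [← ENNReal.ofReal_mul (by positivity)]
          refine ENNReal.ofReal_le_ofReal ?_
          rw [div_mul_eq_mul_div]
          gcongr
          linarith [Real.pi_le_four]
  refine (mul_le_of_le_one_left zero_le ?_).trans hbound
  rw [Real.enorm_of_nonneg (by positivity)]
  refine ENNReal.ofReal_le_one.mpr (inv_le_one_of_one_le₀ ?_)
  linarith [Real.pi_gt_three]

lemma monotoneOn_upperLogCount : MonotoneOn upperLogCount (Ioi 0) := by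
  intro R hR R' hR' h
  have hR0 : 0 < R := hR
  refine (summable_upperLogCount hR).tsum_le_tsum (fun ρ ↦ ?_) (summable_upperLogCount hR')
  have h0 : 0 < truncRadius ρ.1 := one_pos.trans_le (one_le_truncRadius _)
  gcongr

/-- The asymptotics of `upperLogCount`, with an error term that is small on average. -/
lemma exists_upperLogCount_eq : ∃ b c d : ℝ, ∃ E : ℝ → ℝ,
    (∀ R, upperLogCount R
      = 1 / (2 * π) * (R * Real.log R) + b * R + c * Real.log R + d + E R) ∧
    ∀ κ : ℝ, -1 < κ → IntegrableOn (fun R ↦ E R * R ^ (-κ - 1)) (Ioi 1) := by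
  obtain ⟨b, c, d, h⟩ := exists_enorm_upperLogCount_sub_le
  set q : ℝ → ℝ := fun R ↦ 1 / (2 * π) * (R * Real.log R) + b * R + c * Real.log R + d with hq
  refine ⟨b, c, d, fun R ↦ upperLogCount R - q R, fun R ↦ by simp only [hq]; ring, fun κ hκ ↦ ?_⟩
  have hqc : ContinuousOn q (Ioi 0) := by
    have : ContinuousOn Real.log (Ioi 0) :=
      Real.continuousOn_log.mono fun x hx ↦ (mem_Ioi.mp hx).ne'
    fun_prop
  have hpc : ContinuousOn (fun R : ℝ ↦ R ^ (-κ - 1)) (Ioi 0) := fun R hR ↦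
    (Real.continuousAt_rpow_const _ _ (Or.inl (mem_Ioi.mp hR).ne')).continuousWithinAt
  have hmeas : AEStronglyMeasurable (fun R ↦ (upperLogCount R - q R) * R ^ (-κ - 1))
      (volume.restrict (Ioi 0)) := by
    refine AEMeasurable.aestronglyMeasurable ?_
    exact ((aemeasurable_restrict_of_monotoneOn measurableSet_Ioi monotoneOn_upperLogCount).sub
      (hqc.aemeasurable measurableSet_Ioi)).mul (hpc.aemeasurable measurableSet_Ioi)
  rw [← Ioc_union_Ioi_eq_Ioi (by norm_num : (1 : ℝ) ≤ 3), integrableOn_union]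
  constructor
  · have hsub : Icc (1 : ℝ) 3 ⊆ Ioi 0 := fun x hx ↦ by
      have := hx.1
      simp only [mem_Ioi]
      linarith
    refine IntegrableOn.mono_set ?_ Ioc_subset_Icc_self
    refine IntegrableOn.mul_continuousOn ?_ (hpc.mono hsub) isCompact_Icc
    exact ((monotoneOn_upperLogCount.mono hsub).integrableOn_isCompact isCompact_Icc).sub
      ((hqc.mono hsub).integrableOn_compact isCompact_Icc)
  · refine ⟨hmeas.mono_measure (Measure.restrict_mono (Ioi_subset_Ioi (by norm_num)) le_rfl), ?_⟩
    have h40 : ∫⁻ R in Ioi (3 : ℝ), ENNReal.ofReal (40 / R) * ENNReal.ofReal (R ^ (-κ - 1)) < ⊤ := by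
      have hi : IntegrableOn (fun R : ℝ ↦ 40 * R ^ (-κ - 2)) (Ioi 3) :=
        (integrableOn_Ioi_rpow_of_lt (by linarith) (by norm_num)).const_mul _
      refine lt_of_le_of_lt ?_ hi.2
      refine setLIntegral_mono' measurableSet_Ioi fun R hR ↦ ?_
      have hR0 : 0 < R := by have := mem_Ioi.mp hR; linarith
      rw [← ENNReal.ofReal_mul (by positivity), Real.enorm_of_nonneg (by positivity)]
      refine ENNReal.ofReal_le_ofReal (le_of_eq ?_)
      dsimp only
      rw [show -κ - 2 = -κ - 1 - 1 by ring, Real.rpow_sub_one hR0.ne' (-κ - 1), div_mul_eq_mul_div,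
        mul_div_assoc]
    refine lt_of_le_of_lt ?_ (ENNReal.add_lt_top.mpr
      ⟨lintegral_halfCircle_log_norm_riemannZeta_lt_top hκ, h40⟩)
    rw [← lintegral_add_right]
    · refine setLIntegral_mono' measurableSet_Ioi fun R hR ↦ ?_
      have hR0 : 0 < R := by have := mem_Ioi.mp hR; linarith
      rw [enorm_mul, ← add_mul, Real.enorm_of_nonneg (r := R ^ (-κ - 1)) (by positivity)]
      gcongr
      exact h R hR
    · fun_prop

/-! ### Dirichlet series over the zeros -/

lemma integrableOn_posLog_mul_rpow {σ r : ℝ} (hσ : 0 < σ) (hr : 0 < r) :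
    IntegrableOn (fun R : ℝ ↦ Real.posLog (R / r) * R ^ (-σ - 1)) (Ioi 1) := by
  have hi : IntegrableOn (fun R : ℝ ↦ (r ^ (-(σ / 2)) / (σ / 2)) * R ^ (-(σ / 2) - 1)) (Ioi 1) :=
    (integrableOn_Ioi_rpow_of_lt (by linarith) one_pos).const_mul _
  refine hi.mono' ?_ ?_
  · have : Measurable Real.posLog := by
      unfold Real.posLog
      fun_prop
    exact (by fun_prop : Measurable fun R : ℝ ↦
      Real.posLog (R / r) * R ^ (-σ - 1)).aestronglyMeasurable
  · filter_upwards [ae_restrict_mem measurableSet_Ioi] with R hR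
    have hR0 : 0 < R := one_pos.trans (mem_Ioi.mp hR)
    rw [Real.norm_of_nonneg (mul_nonneg Real.posLog_nonneg (by positivity))]
    have h1 : Real.posLog (R / r) ≤ (R / r) ^ (σ / 2) / (σ / 2) :=
      max_le (by positivity) (Real.log_le_rpow_div (by positivity) (by positivity))
    calc _ ≤ (R / r) ^ (σ / 2) / (σ / 2) * R ^ (-σ - 1) := by gcongr
      _ = _ := by
        rw [Real.div_rpow hR0.le hr.le, Real.rpow_neg hr.le,
          show -(σ / 2) - 1 = σ / 2 + (-σ - 1) by ring, Real.rpow_add hR0]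
        field_simp

lemma norm_ofReal_mul_cpow {x R : ℝ} (hR : 0 < R) (s : ℂ) :
    ‖(x : ℂ) * (R : ℂ) ^ (-s - 1)‖ = ‖x * R ^ (-s.re - 1)‖ := by
  rw [norm_mul, norm_mul, Complex.norm_real, Complex.norm_cpow_eq_rpow_re_of_pos hR]
  simp [abs_of_pos (Real.rpow_pos_of_pos hR _)]

lemma continuousOn_ofReal_cpow (s : ℂ) : ContinuousOn (fun R : ℝ ↦ (R : ℂ) ^ (-s - 1)) (Ioi 0) :=
  fun _ hR ↦ (hasDerivAt_ofReal_cpow_of_pos (mem_Ioi.mp hR) _).continuousAt.continuousWithinAt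

lemma integrableOn_ofReal_mul_cpow {f : ℝ → ℝ} {s : ℂ}
    (hf : IntegrableOn (fun R ↦ f R * R ^ (-s.re - 1)) (Ioi 1)) :
    IntegrableOn (fun R : ℝ ↦ (f R : ℂ) * (R : ℂ) ^ (-s - 1)) (Ioi 1) := by
  have hsub : Ioi (1 : ℝ) ⊆ Ioi 0 := Ioi_subset_Ioi zero_le_one
  have hfm : AEMeasurable f (volume.restrict (Ioi 1)) := by
    have h1 : AEMeasurable (fun R ↦ (f R * R ^ (-s.re - 1)) * (R ^ (-s.re - 1))⁻¹)
        (volume.restrict (Ioi 1)) :=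
      hf.1.aemeasurable.mul (by fun_prop : Measurable fun R : ℝ ↦ (R ^ (-s.re - 1))⁻¹).aemeasurable
    refine h1.congr ?_
    filter_upwards [ae_restrict_mem measurableSet_Ioi] with R hR
    exact mul_inv_cancel_right₀ (Real.rpow_pos_of_pos (hsub hR) _).ne' _
  refine hf.congr' ?_ ?_
  · exact (Complex.measurable_ofReal.comp_aemeasurable hfm).aestronglyMeasurable.mul
      (((continuousOn_ofReal_cpow s).mono hsub).aestronglyMeasurable measurableSet_Ioi)
  · filter_upwards [ae_restrict_mem measurableSet_Ioi] with R hR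
    exact (norm_ofReal_mul_cpow (hsub hR) s).symm

lemma integral_posLog_mul_cpow {s : ℂ} (hs : 0 < s.re) {r : ℝ} (hr : 1 ≤ r) :
    ∫ R in Ioi (1 : ℝ), (Real.posLog (R / r) : ℂ) * (R : ℂ) ^ (-s - 1) = (r : ℂ) ^ (-s) / s ^ 2 := by
  have hr0 : 0 < r := by linarith
  have hs0 : s ≠ 0 := by
    rintro rfl
    simp at hs
  have hint := integrableOn_ofReal_mul_cpow (integrableOn_posLog_mul_rpow hs hr0)
  have h1 : ∫ R in Ioi (1 : ℝ), (Real.posLog (R / r) : ℂ) * (R : ℂ) ^ (-s - 1)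
      = ∫ R in Ioi r, (Real.posLog (R / r) : ℂ) * (R : ℂ) ^ (-s - 1) := by
    refine (setIntegral_eq_of_subset_of_forall_sdiff_eq_zero measurableSet_Ioi
      (Ioi_subset_Ioi hr) fun R hR ↦ ?_)
    have hR1 : 1 < R := hR.1
    have hR2 : R ≤ r := not_lt.mp hR.2
    have h0 : Real.posLog (R / r) = 0 := by
      rw [Real.posLog_eq_zero_iff, abs_of_pos (by positivity)]
      exact (div_le_one hr0).mpr hR2
    simp [h0]
  have h2 : ∀ R ∈ Ioi r, (Real.posLog (R / r) : ℂ) = Real.log R - Real.log r := by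
    intro R hR
    have hR' : r < R := hR
    rw [Real.posLog_eq_log, Real.log_div (by linarith) hr0.ne']
    · push_cast
      rfl
    · rw [abs_of_pos (div_pos (by linarith) hr0)]
      exact (one_le_div hr0).mpr hR'.le
  have h3 : EqOn (fun R : ℝ ↦ (Real.posLog (R / r) : ℂ) * (R : ℂ) ^ (-s - 1))
      (fun R : ℝ ↦ ((Real.log R : ℂ) - Real.log r) * (R : ℂ) ^ (-s - 1)) (Ioi r) := fun R hR ↦ by
    simp only [h2 R hR]
  have hint2 := (hint.mono_set (Ioi_subset_Ioi hr)).congr_fun h3 measurableSet_Ioi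
  rw [h1, setIntegral_congr_fun measurableSet_Ioi h3]
  have hderiv : ∀ R ∈ Ici r, HasDerivAt
      (fun R : ℝ ↦ -(((Real.log R : ℂ) - Real.log r) / s + 1 / s ^ 2) * (R : ℂ) ^ (-s))
      (((Real.log R : ℂ) - Real.log r) * (R : ℂ) ^ (-s - 1)) R := by
    intro R hR
    have hR0 : 0 < R := hr0.trans_le hR
    have hd1 := (Real.hasDerivAt_log hR0.ne').ofReal_comp
    have hd2 := hasDerivAt_ofReal_cpow_of_pos hR0 (-s)
    have hd := (((hd1.sub_const (Real.log r : ℂ)).div_const s).add_const (1 / s ^ 2)).neg.mul hd2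
    convert! hd using 1
    have hRc : (R : ℂ) ≠ 0 := by exact_mod_cast hR0.ne'
    rw [Complex.cpow_sub _ _ hRc, Complex.cpow_one]
    simp only [Pi.neg_apply]
    push_cast
    field_simp
    ring
  have hlim : Tendsto (fun R : ℝ ↦
      -(((Real.log R : ℂ) - Real.log r) / s + 1 / s ^ 2) * (R : ℂ) ^ (-s)) atTop (𝓝 0) := by
    have t1 : Tendsto (fun R : ℝ ↦ (R : ℂ) ^ (-s)) atTop (𝓝 0) := by
      rw [tendsto_zero_iff_norm_tendsto_zero]
      refine (tendsto_rpow_neg_atTop hs).congr' ?_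
      filter_upwards [eventually_gt_atTop 0] with R hR
      rw [Complex.norm_cpow_eq_rpow_re_of_pos hR]
      simp
    have t2 : Tendsto (fun R : ℝ ↦ (Real.log R : ℂ) * (R : ℂ) ^ (-s)) atTop (𝓝 0) := by
      rw [tendsto_zero_iff_norm_tendsto_zero]
      refine ((isLittleO_log_rpow_atTop hs).tendsto_div_nhds_zero).congr' ?_
      filter_upwards [eventually_gt_atTop 1] with R hR
      rw [norm_mul, Complex.norm_cpow_eq_rpow_re_of_pos (by linarith), Complex.norm_real,
        Real.norm_of_nonneg (Real.log_nonneg hR.le), Complex.neg_re, Real.rpow_neg (by linarith)]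
      rfl
    have t3 := (t2.mul_const (-s⁻¹)).add (t1.mul_const ((Real.log r : ℂ) / s - 1 / s ^ 2))
    simp only [zero_mul, add_zero] at t3
    refine t3.congr fun R ↦ ?_
    ring
  rw [integral_Ioi_of_hasDerivAt_of_tendsto' hderiv hint2 hlim]
  ring

lemma truncRadius_pos (u : ℂ) : 0 < truncRadius u := one_pos.trans_le (one_le_truncRadius u)

/-- The power moments of `upperLogCount` are finite in the half plane `1 < σ`. -/
lemma integrableOn_upperLogCount {σ : ℝ} (hσ : 1 < σ) :
    IntegrableOn (fun R : ℝ ↦ upperLogCount R * R ^ (-σ - 1)) (Ioi 1) := by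
  obtain ⟨b, c, d, E, hE, hEi⟩ := exists_upperLogCount_eq
  have i1 := (integrableOn_posLog_mul_rpow (σ := σ - 1) (by linarith) one_pos).const_mul
    (1 / (2 * π))
  have i2 := (integrableOn_posLog_mul_rpow (σ := σ) (by linarith) one_pos).const_mul c
  have i3 := (integrableOn_Ioi_rpow_of_lt (a := -σ) (by linarith) one_pos).const_mul b
  have i4 := (integrableOn_Ioi_rpow_of_lt (a := -σ - 1) (by linarith) one_pos).const_mul d
  refine ((((i1.add i3).add i2).add i4).add (hEi σ (by linarith))).congr ?_
  filter_upwards [ae_restrict_mem measurableSet_Ioi] with R hR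
  have hR1 : 1 < R := hR
  have hR0 : R ≠ 0 := by linarith
  simp only [Pi.add_apply, div_one]
  rw [hE R, Real.posLog_eq_log (by rw [abs_of_pos (by linarith)]; exact hR1.le),
    show -(σ - 1) - 1 = -σ - 1 + 1 by ring, Real.rpow_add_one hR0,
    show -σ = -σ - 1 + 1 by ring, Real.rpow_add_one hR0, show -σ - 1 + 1 - 1 = -σ - 1 by ring]
  ring

lemma integral_posLog_mul_rpow {σ : ℝ} (hσ : 0 < σ) {r : ℝ} (hr : 1 ≤ r) :
    ∫ R in Ioi (1 : ℝ), Real.posLog (R / r) * R ^ (-σ - 1) = r ^ (-σ) / σ ^ 2 := by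
  have h := integral_posLog_mul_cpow (s := σ) (by simpa using hσ) hr
  have h1 : ∫ R in Ioi (1 : ℝ), (Real.posLog (R / r) : ℂ) * (R : ℂ) ^ (-(σ : ℂ) - 1)
      = ∫ R in Ioi (1 : ℝ), ((Real.posLog (R / r) * R ^ (-σ - 1) : ℝ) : ℂ) := by
    refine setIntegral_congr_fun measurableSet_Ioi fun R hR ↦ ?_
    have hR0 : 0 ≤ R := zero_le_one.trans (mem_Ioi.mp hR).le
    push_cast [Complex.ofReal_cpow hR0]
    rfl
  rw [h1, integral_complex_ofReal] at h
  apply Complex.ofReal_injective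
  rw [h]
  push_cast [Complex.ofReal_cpow (zero_le_one.trans hr)]
  rfl

lemma summable_zetaMult_mul_truncRadius_rpow {σ : ℝ} (hσ : 1 < σ) :
    Summable fun ρ : UpperZero ↦ (zetaMult ρ.1 : ℝ) * truncRadius ρ.1 ^ (-σ) := by
  have hσ0 : 0 < σ := by linarith
  refine summable_of_sum_le (c := σ ^ 2 * ∫ R in Ioi (1 : ℝ), upperLogCount R * R ^ (-σ - 1))
    (fun ρ ↦ mul_nonneg (Nat.cast_nonneg _) (Real.rpow_nonneg (truncRadius_pos _).le _))
    fun u ↦ ?_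
  have h1 : ∑ ρ ∈ u, (zetaMult ρ.1 : ℝ) * truncRadius ρ.1 ^ (-σ)
      = σ ^ 2 * ∫ R in Ioi (1 : ℝ), (∑ ρ ∈ u, (zetaMult ρ.1 : ℝ)
        * (Real.posLog (R / truncRadius ρ.1) * R ^ (-σ - 1))) := by
    rw [integral_finsetSum _ fun ρ _ ↦
      (integrableOn_posLog_mul_rpow hσ0 (truncRadius_pos ρ.1)).const_mul _, Finset.mul_sum]
    refine Finset.sum_congr rfl fun ρ _ ↦ ?_
    rw [integral_const_mul, integral_posLog_mul_rpow hσ0 (one_le_truncRadius _)]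
    field_simp
  rw [h1]
  refine mul_le_mul_of_nonneg_left ?_ (by positivity)
  refine setIntegral_mono_on (integrable_finsetSum _ fun ρ _ ↦
      (integrableOn_posLog_mul_rpow hσ0 (truncRadius_pos ρ.1)).const_mul _)
    (integrableOn_upperLogCount hσ) measurableSet_Ioi fun R hR ↦ ?_
  have hR0 : 0 < R := one_pos.trans (mem_Ioi.mp hR)
  simp_rw [← mul_assoc]
  rw [← Finset.sum_mul]
  gcongr
  exact (summable_upperLogCount hR0).sum_le_tsum u
    fun ρ _ ↦ mul_nonneg (Nat.cast_nonneg _) Real.posLog_nonneg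

instance : Countable UpperZero := by
  have : {ρ : ℂ | IsNontrivialZero ρ ∧ 0 < ρ.im} ⊆ ⋃ n : ℕ, (zerosInDisc n : Set ℂ) := by
    rintro ρ ⟨h, -⟩
    obtain ⟨n, hn⟩ := exists_nat_ge ‖ρ - 1 / 2‖
    exact mem_iUnion.mpr ⟨n, mem_zerosInDisc.mpr ⟨h, hn⟩⟩
  exact ((countable_iUnion fun n : ℕ ↦ (zerosInDisc n).countable_toSet).mono this).to_subtype

lemma tsum_zetaMult_mul_truncRadius_cpow {s : ℂ} (hs : 1 < s.re) :
    ∑' ρ : UpperZero, (zetaMult ρ.1 : ℂ) * (truncRadius ρ.1 : ℂ) ^ (-s)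
      = s ^ 2 * ∫ R in Ioi (1 : ℝ), (upperLogCount R : ℂ) * (R : ℂ) ^ (-s - 1) := by
  have hs0 : s ≠ 0 := by
    rintro rfl
    norm_num at hs
  have hsr : 0 < s.re := by linarith
  have hint : ∀ ρ : UpperZero, Integrable (fun R : ℝ ↦ (zetaMult ρ.1 : ℂ)
      * ((Real.posLog (R / truncRadius ρ.1) : ℂ) * (R : ℂ) ^ (-s - 1)))
      (volume.restrict (Ioi 1)) := fun ρ ↦
    (integrableOn_ofReal_mul_cpow
      (integrableOn_posLog_mul_rpow hsr (truncRadius_pos ρ.1))).const_mul _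
  have key := integral_tsum_of_summable_integral_norm hint (by
    refine ((summable_zetaMult_mul_truncRadius_rpow hs).div_const (s.re ^ 2)).congr fun ρ ↦ ?_
    have h1 : ∫ R in Ioi (1 : ℝ), ‖(zetaMult ρ.1 : ℂ)
        * ((Real.posLog (R / truncRadius ρ.1) : ℂ) * (R : ℂ) ^ (-s - 1))‖
        = ∫ R in Ioi (1 : ℝ), (zetaMult ρ.1 : ℝ)
          * (Real.posLog (R / truncRadius ρ.1) * R ^ (-s.re - 1)) := by
      refine setIntegral_congr_fun measurableSet_Ioi fun R hR ↦ ?_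
      have hR0 : 0 < R := one_pos.trans (mem_Ioi.mp hR)
      rw [norm_mul, norm_ofReal_mul_cpow hR0,
        Real.norm_of_nonneg (mul_nonneg Real.posLog_nonneg (by positivity))]
      simp
    rw [h1, integral_const_mul, integral_posLog_mul_rpow hsr (one_le_truncRadius _), mul_div_assoc])
  have h2 : ∀ R ∈ Ioi (1 : ℝ), (upperLogCount R : ℂ) * (R : ℂ) ^ (-s - 1)
      = ∑' ρ : UpperZero, (zetaMult ρ.1 : ℂ)
        * ((Real.posLog (R / truncRadius ρ.1) : ℂ) * (R : ℂ) ^ (-s - 1)) := by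
    intro R _
    rw [upperLogCount, Complex.ofReal_tsum, ← tsum_mul_right]
    refine tsum_congr fun ρ ↦ ?_
    push_cast
    ring
  rw [setIntegral_congr_fun measurableSet_Ioi h2, ← key, ← tsum_mul_left]
  refine tsum_congr fun ρ ↦ ?_
  rw [integral_const_mul, integral_posLog_mul_cpow hsr (one_le_truncRadius _)]
  field_simp

lemma im_le_truncRadius (u : ℂ) : u.im ≤ truncRadius u := by
  refine le_trans ?_ (le_max_left _ _)
  have := abs_im_le_norm (u - 1 / 2)
  simp at this
  exact (le_abs_self _).trans (by simpa using this)

lemma truncRadius_sub_im_le (ρ : UpperZero) : truncRadius ρ.1 - ρ.1.im ≤ ρ.1.im⁻¹ := by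
  obtain ⟨u, hu, him⟩ := ρ
  simp only
  have h0 : ‖u - 1 / 2‖ ^ 2 = (u.re - 1 / 2) ^ 2 + u.im ^ 2 := by
    rw [← Complex.normSq_eq_norm_sq, Complex.normSq_apply]
    simp
    ring
  have h1 : (u.re - 1 / 2) ^ 2 ≤ 1 / 4 := by nlinarith [hu.2.1, hu.2.2]
  have h2 : u.im * u.im⁻¹ = 1 := mul_inv_cancel₀ him.ne'
  have h3 : 0 < u.im⁻¹ := by positivity
  rw [sub_le_iff_le_add]
  refine max_le ?_ ?_
  · refine abs_le_of_sq_le_sq' ?_ (by positivity) |>.2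
    nlinarith [mul_pos h3 h3]
  · nlinarith [sq_nonneg (u.im - u.im⁻¹)]

lemma exists_le_im_upperZero : ∃ δ : ℝ, 0 < δ ∧ ∀ ρ : UpperZero, δ ≤ ρ.1.im := by
  set S := (zerosInDisc 2).filter fun u ↦ 0 < u.im with hS
  have hmem : ∀ ρ : UpperZero, ρ.1.im ≤ 1 → ρ.1 ∈ S := by
    intro ρ hρ
    refine Finset.mem_filter.mpr ⟨mem_zerosInDisc.mpr ⟨ρ.2.1, ?_⟩, ρ.2.2⟩
    refine (Complex.norm_le_abs_re_add_abs_im _).trans ?_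
    have h1 : |ρ.1.re - 1 / 2| ≤ 1 := by
      rw [abs_le]
      constructor <;> linarith [ρ.2.1.2.1, ρ.2.1.2.2]
    have h2 : |ρ.1.im| ≤ 1 := by rwa [abs_of_pos ρ.2.2]
    simp at h1 ⊢
    linarith
  rcases S.eq_empty_or_nonempty with h | h
  · refine ⟨1, one_pos, fun ρ ↦ ?_⟩
    by_contra! hρ
    simpa [h] using hmem ρ hρ.le
  · obtain ⟨u, hu, hmin⟩ := S.exists_min_image (fun u ↦ u.im) h
    refine ⟨min u.im 1, lt_min (Finset.mem_filter.mp hu).2 one_pos, fun ρ ↦ ?_⟩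
    rcases le_or_gt ρ.1.im 1 with h1 | h1
    · exact (min_le_left _ _).trans (hmin _ (hmem ρ h1))
    · exact (min_le_right _ _).trans h1.le

lemma summable_zetaMult_mul_im_rpow {σ : ℝ} (hσ : 1 < σ) :
    Summable fun ρ : UpperZero ↦ (zetaMult ρ.1 : ℝ) * ρ.1.im ^ (-σ) := by
  obtain ⟨δ, hδ, hle⟩ := exists_le_im_upperZero
  refine Summable.of_nonneg_of_le
    (fun ρ ↦ mul_nonneg (Nat.cast_nonneg _) (Real.rpow_nonneg ρ.2.2.le _)) (fun ρ ↦ ?_)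
    ((summable_zetaMult_mul_truncRadius_rpow hσ).mul_left ((1 + (δ ^ 2)⁻¹) ^ σ))
  have hγ : 0 < ρ.1.im := ρ.2.2
  have h1 : truncRadius ρ.1 ≤ (1 + (δ ^ 2)⁻¹) * ρ.1.im := by
    have h2 := truncRadius_sub_im_le ρ
    have h3 : ρ.1.im⁻¹ ≤ (δ ^ 2)⁻¹ * ρ.1.im := by
      rw [inv_mul_eq_div, inv_eq_one_div, div_le_div_iff₀ hγ (by positivity)]
      nlinarith [hle ρ]
    linarith
  have hT := truncRadius_pos ρ.1
  rw [mul_left_comm]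
  gcongr
  calc ρ.1.im ^ (-σ) ≤ (truncRadius ρ.1 / (1 + (δ ^ 2)⁻¹)) ^ (-σ) :=
        Real.rpow_le_rpow_of_nonpos (by positivity) (by rwa [div_le_iff₀' (by positivity)])
          (by linarith)
    _ = _ := by
      rw [Real.div_rpow hT.le (by positivity), Real.rpow_neg (by positivity : 0 ≤ 1 + (δ ^ 2)⁻¹),
        div_inv_eq_mul, mul_comm]

lemma rpow_le_rpow_add_rpow {x : ℝ} (hx : 0 < x) {a b t : ℝ} (h1 : a ≤ t) (h2 : t ≤ b) :
    x ^ t ≤ x ^ a + x ^ b := by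
  rcases le_total 1 x with h | h
  · exact (Real.rpow_le_rpow_of_exponent_le h h2).trans (by simp; positivity)
  · exact (Real.rpow_le_rpow_of_exponent_ge hx h h1).trans (by simp; positivity)

/-- The discrepancy between the Dirichlet series over ordinates and over truncated radii. -/
def ordinateDefect (s : ℂ) : ℂ :=
  ∑' ρ : UpperZero, (zetaMult ρ.1 : ℂ) * ((ρ.1.im : ℂ) ^ (-s) - (truncRadius ρ.1 : ℂ) ^ (-s))

lemma exists_summable_ordinateDefect {κ B : ℝ} (hκ : -1 < κ) :
    ∃ w : UpperZero → ℝ, Summable w ∧ (∀ ρ, 0 ≤ w ρ) ∧ ∀ s : ℂ, κ ≤ s.re → s.re ≤ B → ∀ ρ,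
      ‖(zetaMult ρ.1 : ℂ) * ((ρ.1.im : ℂ) ^ (-s) - (truncRadius ρ.1 : ℂ) ^ (-s))‖
        ≤ ‖s‖ * w ρ := by
  refine ⟨fun ρ ↦ (zetaMult ρ.1 : ℝ) * ρ.1.im ^ (-(max B κ + 2))
    + (zetaMult ρ.1 : ℝ) * ρ.1.im ^ (-(κ + 2)),
    (summable_zetaMult_mul_im_rpow (by linarith [le_max_right B κ])).add
      (summable_zetaMult_mul_im_rpow (by linarith)), fun ρ ↦ ?_, fun s h1 h2 ρ ↦ ?_⟩
  · have := ρ.2.2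
    positivity
  · have hγ : 0 < ρ.1.im := ρ.2.2
    dsimp only
    rw [norm_mul, norm_sub_rev, Complex.norm_natCast, ← mul_add, mul_left_comm]
    gcongr
    refine (norm_cpow_neg_sub_cpow_neg_le hγ (im_le_truncRadius _) (by linarith)).trans ?_
    rw [mul_assoc]
    gcongr
    calc _ ≤ ρ.1.im ^ (-s.re - 1) * ρ.1.im⁻¹ := by
          gcongr
          exact truncRadius_sub_im_le ρ
      _ = ρ.1.im ^ (-s.re - 2) := by
          rw [show -s.re - 2 = -s.re - 1 - 1 by ring, Real.rpow_sub_one hγ.ne' (-s.re - 1),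
            div_eq_mul_inv]
      _ ≤ _ := rpow_le_rpow_add_rpow hγ (by linarith [le_max_left B κ]) (by linarith)

lemma differentiableAt_ordinateDefect {s : ℂ} (hs : -1 < s.re) :
    DifferentiableAt ℂ ordinateDefect s := by
  obtain ⟨κ, hκ1, hκ2⟩ := exists_between hs
  obtain ⟨w, hw, hw0, hb⟩ := exists_summable_ordinateDefect (B := s.re + 1) hκ1
  set V : Set ℂ := {z | κ < z.re} ∩ {z | z.re < s.re + 1} ∩ Metric.ball 0 (‖s‖ + 1) with hV
  have hVo : IsOpen V := ((isOpen_lt continuous_const Complex.continuous_re).inter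
    (isOpen_lt Complex.continuous_re continuous_const)).inter Metric.isOpen_ball
  have hsV : s ∈ V := ⟨⟨hκ2, by simp⟩, by simp⟩
  refine (differentiableOn_tsum_of_summable_norm (hw.mul_left (‖s‖ + 1)) (fun ρ ↦ ?_) hVo
    fun ρ z hz ↦ ?_).differentiableAt (hVo.mem_nhds hsV)
  · have h1 : (ρ.1.im : ℂ) ≠ 0 := by exact_mod_cast ρ.2.2.ne'
    have h2 : (truncRadius ρ.1 : ℂ) ≠ 0 := by exact_mod_cast (truncRadius_pos _).ne'
    refine DifferentiableOn.const_mul (DifferentiableOn.sub ?_ ?_) _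
    · exact (differentiableOn_id.neg).const_cpow (Or.inl h1)
    · exact (differentiableOn_id.neg).const_cpow (Or.inl h2)
  · refine (hb z hz.1.1.le (le_of_lt hz.1.2) ρ).trans ?_
    have hzn : ‖z‖ < ‖s‖ + 1 := by simpa using hz.2
    exact mul_le_mul_of_nonneg_right hzn.le (hw0 ρ)

lemma exists_norm_ordinateDefect_le {κ : ℝ} (hκ : -1 < κ) (B : ℝ) :
    ∃ C : ℝ, 0 ≤ C ∧ ∀ s : ℂ, κ ≤ s.re → s.re ≤ B → ‖ordinateDefect s‖ ≤ C * ‖s‖ := by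
  obtain ⟨w, hw, hw0, hb⟩ := exists_summable_ordinateDefect (B := B) hκ
  refine ⟨∑' ρ, w ρ, tsum_nonneg hw0, fun s h1 h2 ↦ ?_⟩
  rw [mul_comm, ← tsum_mul_left]
  exact tsum_of_norm_bounded (hw.mul_left _).hasSum (hb s h1 h2)

lemma ordinateDefect_zero : ordinateDefect 0 = 0 := by
  simp [ordinateDefect]

/-- The truncated Mellin transform `∫₁^∞ E(R) R^(-s-1) dR`. -/
def tailTransform (E : ℝ → ℝ) (s : ℂ) : ℂ :=
  ∫ R in Ioi (1 : ℝ), (E R : ℂ) * (R : ℂ) ^ (-s - 1)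

lemma norm_tailTransform_le {E : ℝ → ℝ} {κ : ℝ}
    (hE : IntegrableOn (fun R ↦ E R * R ^ (-κ - 1)) (Ioi 1)) {s : ℂ} (hs : κ ≤ s.re) :
    ‖tailTransform E s‖ ≤ ∫ R in Ioi (1 : ℝ), ‖E R * R ^ (-κ - 1)‖ := by
  refine norm_integral_le_of_norm_le hE.norm ?_
  filter_upwards [ae_restrict_mem measurableSet_Ioi] with R hR
  have hR1 : 1 < R := hR
  have hR0 : 0 < R := by linarith
  rw [norm_ofReal_mul_cpow hR0, norm_mul, norm_mul]
  gcongr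
  rw [Real.norm_of_nonneg (by positivity), Real.norm_of_nonneg (by positivity)]
  exact Real.rpow_le_rpow_of_exponent_le hR1.le (by linarith)

lemma differentiableAt_tailTransform {E : ℝ → ℝ}
    (hE : ∀ κ : ℝ, -1 < κ → IntegrableOn (fun R ↦ E R * R ^ (-κ - 1)) (Ioi 1))
    {s : ℂ} (hs : -1 < s.re) : DifferentiableAt ℂ (tailTransform E) s := by
  obtain ⟨κ, hκ1, hκ2⟩ := exists_between hs
  obtain ⟨κ', hκ'1, hκ'2⟩ := exists_between hκ1
  have hη : 0 < κ - κ' := by linarith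
  have hball : ∀ z ∈ Metric.ball s (s.re - κ), κ < z.re := by
    intro z hz
    rw [mem_ball_iff_norm] at hz
    have := (abs_re_le_norm (z - s)).trans_lt hz
    rw [Complex.sub_re, abs_lt] at this
    linarith
  have hint : ∀ z : ℂ, -1 < z.re → IntegrableOn (fun R : ℝ ↦ (E R : ℂ) * (R : ℂ) ^ (-z - 1)) (Ioi 1) :=
    fun z hz ↦ integrableOn_ofReal_mul_cpow (hE _ hz)
  have hlogm : AEStronglyMeasurable (fun R : ℝ ↦ (-(Real.log R : ℂ)))
      (volume.restrict (Ioi (1 : ℝ))) :=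
    (by fun_prop : Measurable fun R : ℝ ↦ (-(Real.log R : ℂ))).aestronglyMeasurable
  refine (hasDerivAt_integral_of_dominated_loc_of_deriv_le
    (F := fun (z : ℂ) (R : ℝ) ↦ (E R : ℂ) * (R : ℂ) ^ (-z - 1))
    (F' := fun (z : ℂ) (R : ℝ) ↦ (-(Real.log R : ℂ)) * ((E R : ℂ) * (R : ℂ) ^ (-z - 1)))
    (bound := fun R ↦ (κ - κ')⁻¹ * ‖E R * R ^ (-κ' - 1)‖)
    (Metric.ball_mem_nhds s (sub_pos.mpr hκ2)) ?_ (hint s hs) ?_ ?_ ?_ ?_).2.differentiableAt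
  · filter_upwards [Metric.ball_mem_nhds s (sub_pos.mpr hκ2)] with z hz
    exact (hint z (hκ1.trans (hball z hz))).1
  · exact hlogm.mul (hint s hs).1
  · filter_upwards [ae_restrict_mem measurableSet_Ioi] with R hR z hz
    have hR1 : 1 < R := hR
    have hR0 : 0 < R := by linarith
    rw [norm_mul, norm_ofReal_mul_cpow hR0, norm_mul, norm_mul, norm_neg, Complex.norm_real,
      Real.norm_of_nonneg (Real.log_nonneg hR1.le), Real.norm_of_nonneg (r := R ^ _) (by positivity),
      Real.norm_of_nonneg (r := R ^ _) (by positivity)]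
    have h1 := Real.log_le_rpow_div hR0.le hη
    have h2 : R ^ (-z.re - 1) ≤ R ^ (-κ - 1) :=
      Real.rpow_le_rpow_of_exponent_le hR1.le (by linarith [hball z hz])
    calc _ ≤ R ^ (κ - κ') / (κ - κ') * (‖E R‖ * R ^ (-κ - 1)) := by gcongr
      _ = (κ - κ')⁻¹ * (‖E R‖ * (R ^ (κ - κ') * R ^ (-κ - 1))) := by ring
      _ = _ := by
        rw [← Real.rpow_add hR0]
        ring_nf
  · exact (hE κ' hκ'1).norm.const_mul _
  · filter_upwards [ae_restrict_mem measurableSet_Ioi] with R hR z _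
    have hR0 : 0 < R := one_pos.trans (mem_Ioi.mp hR)
    have hRc : (R : ℂ) ≠ 0 := by exact_mod_cast hR0.ne'
    have hd := (((hasDerivAt_id z).neg.sub_const (1 : ℂ)).const_cpow (c := (R : ℂ))
      (Or.inl hRc)).const_mul (E R : ℂ)
    convert! hd using 1
    rw [Complex.ofReal_log hR0.le]
    simp only [id, Pi.neg_apply]
    ring

lemma summable_zetaMult_mul_cpow {s : ℂ} {r : UpperZero → ℝ} (hr : ∀ ρ, 0 < r ρ)
    (h : Summable fun ρ : UpperZero ↦ (zetaMult ρ.1 : ℝ) * r ρ ^ (-s.re)) :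
    Summable fun ρ : UpperZero ↦ (zetaMult ρ.1 : ℂ) * (r ρ : ℂ) ^ (-s) := by
  refine Summable.of_norm (h.congr fun ρ ↦ ?_)
  rw [norm_mul, Complex.norm_natCast, Complex.norm_cpow_eq_rpow_re_of_pos (hr ρ), Complex.neg_re]

/-- The Dirichlet series over the ordinates continues to `-1 < Re s` with a double pole at `1`,
with polynomial growth in vertical strips. -/
lemma exists_continuation_ordinate_series : ∃ g : ℂ → ℂ,
    (∀ s : ℂ, -1 < s.re → DifferentiableAt ℂ g s) ∧
    g 1 = ((1 / (2 * π) : ℝ) : ℂ) ∧ (∃ c : ℝ, g 0 = c) ∧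
    (∀ s : ℂ, 1 < s.re →
      (s - 1) ^ 2 * ∑' ρ : UpperZero, (zetaMult ρ.1 : ℂ) * (ρ.1.im : ℂ) ^ (-s) = g s) ∧
    ∀ κ B : ℝ, -1 < κ → ∃ C : ℝ, 0 ≤ C ∧ ∀ s : ℂ, κ ≤ s.re → s.re ≤ B →
      ‖g s‖ ≤ C * (1 + ‖s‖) ^ 4 := by
  obtain ⟨b, c, d, E, hE, hEi⟩ := exists_upperLogCount_eq
  refine ⟨fun s ↦ ((1 / (2 * π) : ℝ) : ℂ) * s ^ 2 + b * (s ^ 2 * (s - 1))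
    + (s - 1) ^ 2 * (c + d * s + s ^ 2 * tailTransform E s + ordinateDefect s),
    fun s hs ↦ ?_, by simp, ⟨c, by simp [ordinateDefect_zero]⟩, fun s hs ↦ ?_, fun κ B hκ ↦ ?_⟩
  · have h1 := differentiableAt_tailTransform hEi hs
    have h2 := differentiableAt_ordinateDefect hs
    fun_prop
  · have hs0 : s ≠ 0 := by
      rintro rfl
      norm_num at hs
    have hs1 : s - 1 ≠ 0 := by
      rw [sub_ne_zero]
      rintro rfl
      norm_num at hs
    have hsr : 0 < s.re := by linarith
    have hsum1 := summable_zetaMult_mul_cpow (s := s) (r := fun ρ ↦ ρ.1.im) (fun ρ ↦ ρ.2.2)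
      (summable_zetaMult_mul_im_rpow hs)
    have hsum2 := summable_zetaMult_mul_cpow (s := s) (r := fun ρ ↦ truncRadius ρ.1)
      (fun ρ ↦ truncRadius_pos _) (summable_zetaMult_mul_truncRadius_rpow hs)
    have hdef : ordinateDefect s = (∑' ρ : UpperZero, (zetaMult ρ.1 : ℂ) * (ρ.1.im : ℂ) ^ (-s))
        - ∑' ρ : UpperZero, (zetaMult ρ.1 : ℂ) * (truncRadius ρ.1 : ℂ) ^ (-s) := by
      rw [← hsum1.tsum_sub hsum2, ordinateDefect]
      exact tsum_congr fun ρ ↦ mul_sub _ _ _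
    rw [tsum_zetaMult_mul_truncRadius_cpow hs] at hdef
    have j1 := integrableOn_ofReal_mul_cpow (s := s - 1) (f := fun R ↦ Real.posLog (R / 1))
      (integrableOn_posLog_mul_rpow (by simpa using hs) one_pos)
    have j2 := integrableOn_ofReal_mul_cpow (s := s) (f := fun R ↦ Real.posLog (R / 1))
      (integrableOn_posLog_mul_rpow hsr one_pos)
    have j3 := integrableOn_Ioi_cpow_of_lt (a := -s) (c := 1) (by simpa using hs) one_pos
    have j4 := integrableOn_Ioi_cpow_of_lt (a := -s - 1) (c := 1) (by simp; linarith) one_pos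
    have j5 := integrableOn_ofReal_mul_cpow (hEi s.re (by linarith))
    have v1 := integral_posLog_mul_cpow (s := s - 1) (by simpa using hs) le_rfl
    have v2 := integral_posLog_mul_cpow (s := s) hsr le_rfl
    have v3 := integral_Ioi_cpow_of_lt (a := -s) (c := 1) (by simpa using hs) one_pos
    have v4 := integral_Ioi_cpow_of_lt (a := -s - 1) (c := 1) (by simp; linarith) one_pos
    have hval : ∫ R in Ioi (1 : ℝ), (upperLogCount R : ℂ) * (R : ℂ) ^ (-s - 1)
        = ((1 / (2 * π) : ℝ) : ℂ) * (1 / (s - 1) ^ 2) + b * (1 / (s - 1)) + c * (1 / s ^ 2)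
          + d * (1 / s) + tailTransform E s := by
      have hc : ∀ R ∈ Ioi (1 : ℝ), (upperLogCount R : ℂ) * (R : ℂ) ^ (-s - 1)
          = ((1 / (2 * π) : ℝ) : ℂ) * ((Real.posLog (R / 1) : ℂ) * (R : ℂ) ^ (-(s - 1) - 1))
            + b * (R : ℂ) ^ (-s)
            + c * ((Real.posLog (R / 1) : ℂ) * (R : ℂ) ^ (-s - 1))
            + d * (R : ℂ) ^ (-s - 1) + (E R : ℂ) * (R : ℂ) ^ (-s - 1) := by
        intro R hR
        have hR1 : 1 < R := hR
        have hRc : (R : ℂ) ≠ 0 := by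
          exact_mod_cast (by linarith : R ≠ 0)
        rw [hE R, div_one,
          Real.posLog_eq_log (by rw [abs_of_pos (by linarith)]; exact hR1.le),
          show -(s - 1) - 1 = -s by ring, show -s = -s - 1 + 1 by ring,
          Complex.cpow_add _ _ hRc, Complex.cpow_one, show -s - 1 + 1 - 1 = -s - 1 by ring]
        push_cast
        ring
      rw [setIntegral_congr_fun measurableSet_Ioi hc,
        integral_add ((((j1.const_mul _).fun_add (j3.const_mul _)).fun_add (j2.const_mul _)).fun_add
          (j4.const_mul _)) j5,
        integral_add (((j1.const_mul _).fun_add (j3.const_mul _)).fun_add (j2.const_mul _))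
          (j4.const_mul _),
        integral_add ((j1.const_mul _).fun_add (j3.const_mul _)) (j2.const_mul _),
        integral_add (j1.const_mul _) (j3.const_mul _), integral_const_mul, integral_const_mul,
        integral_const_mul, integral_const_mul, v1, v2, v3, v4]
      have e1 : -s + 1 ≠ 0 := by
        intro h
        apply hs1
        linear_combination -h
      have e2 : -s - 1 + 1 = -s := by ring
      simp only [ofReal_one, Complex.one_cpow, e2, tailTransform]
      rw [show -s + 1 = -(s - 1) by ring, neg_div_neg_eq, neg_div_neg_eq]
    rw [hval] at hdef
    have hS := sub_eq_iff_eq_add.mp hdef.symm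
    rw [hS]
    field_simp
    ring
  · obtain ⟨C₁, hC₁, h1⟩ := exists_norm_ordinateDefect_le hκ B
    set C₂ := ∫ R in Ioi (1 : ℝ), ‖E R * R ^ (-κ - 1)‖ with hC₂
    have hC₂0 : 0 ≤ C₂ := integral_nonneg fun _ ↦ norm_nonneg _
    refine ⟨1 / (2 * π) + |b| + (|c| + |d| + C₂ + C₁), by positivity, fun s hs1 hs2 ↦ ?_⟩
    have h2 := norm_tailTransform_le (hEi κ hκ) hs1
    have h3 := h1 s hs1 hs2
    set x := ‖s‖ with hx
    have hx0 : 0 ≤ x := norm_nonneg _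
    have h4 : ‖s - 1‖ ≤ 1 + x := (norm_sub_le _ _).trans (by simp [add_comm, hx])
    have hy : 1 ≤ 1 + x := by linarith
    have hxy : x ≤ 1 + x := by linarith
    have p1 : 1 ≤ (1 + x) ^ 2 := one_le_pow₀ hy
    have p2 : 1 + x ≤ (1 + x) ^ 2 := by nlinarith
    have p3 : (1 + x) ^ 2 ≤ (1 + x) ^ 4 := pow_le_pow_right₀ hy (by norm_num)
    have p4 : (1 + x) ^ 3 ≤ (1 + x) ^ 4 := pow_le_pow_right₀ hy (by norm_num)
    have n1 : ‖((1 / (2 * π) : ℝ) : ℂ) * s ^ 2‖ ≤ 1 / (2 * π) * (1 + x) ^ 4 := by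
      rw [norm_mul, norm_pow, Complex.norm_real, Real.norm_of_nonneg (by positivity)]
      gcongr
      exact (pow_le_pow_left₀ hx0 hxy 2).trans p3
    have n2 : ‖(b : ℂ) * (s ^ 2 * (s - 1))‖ ≤ |b| * (1 + x) ^ 4 := by
      rw [norm_mul, norm_mul, norm_pow, Complex.norm_real, Real.norm_eq_abs]
      gcongr
      calc x ^ 2 * ‖s - 1‖ ≤ (1 + x) ^ 2 * (1 + x) := by gcongr
        _ = (1 + x) ^ 3 := by ring
        _ ≤ _ := p4
    have n3 : ‖(c : ℂ) + d * s + s ^ 2 * tailTransform E s + ordinateDefect s‖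
        ≤ (|c| + |d| + C₂ + C₁) * (1 + x) ^ 2 := by
      calc _ ≤ ‖(c : ℂ)‖ + ‖(d : ℂ) * s‖ + ‖s ^ 2 * tailTransform E s‖ + ‖ordinateDefect s‖ :=
            norm_add₄_le
        _ ≤ |c| * (1 + x) ^ 2 + |d| * (1 + x) ^ 2 + (1 + x) ^ 2 * C₂ + C₁ * (1 + x) ^ 2 := by
            rw [norm_mul, norm_mul, norm_pow, Complex.norm_real, Complex.norm_real,
              Real.norm_eq_abs, Real.norm_eq_abs]
            gcongr
            · exact le_mul_of_one_le_right (abs_nonneg _) p1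
            · linarith
            · exact h3.trans (by gcongr; linarith)
        _ = _ := by ring
    have n4 : ‖(s - 1) ^ 2 * ((c : ℂ) + d * s + s ^ 2 * tailTransform E s + ordinateDefect s)‖
        ≤ (|c| + |d| + C₂ + C₁) * (1 + x) ^ 4 := by
      rw [norm_mul, norm_pow]
      calc _ ≤ (1 + x) ^ 2 * ((|c| + |d| + C₂ + C₁) * (1 + x) ^ 2) := by gcongr
        _ = _ := by ring
    calc _ ≤ _ := norm_add₃_le
      _ ≤ _ := add_le_add (add_le_add n1 n2) n4
      _ = _ := by ring

/-! ### Mellin transforms, the Gamma function and contour shifts -/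

/-- The function `t ^ a * (-log t) ^ j` on `(0, 1]`, extended by zero. -/
def powLogCutoff (a : ℝ) (j : ℕ) : ℝ → ℂ :=
  (Ioc (0 : ℝ) 1).indicator fun t ↦ (t : ℂ) ^ (a : ℂ) * (-(Real.log t : ℂ)) ^ j

lemma powLogCutoff_succ (a : ℝ) (j : ℕ) (t : ℝ) :
    powLogCutoff a (j + 1) t = -(Real.log t • powLogCutoff a j t) := by
  by_cases ht : t ∈ Ioc (0 : ℝ) 1
  · simp only [powLogCutoff, indicator_of_mem ht, Complex.real_smul]
    ring
  · simp [powLogCutoff, indicator_of_notMem ht]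

lemma measurable_powLogCutoff (a : ℝ) (j : ℕ) : Measurable (powLogCutoff a j) := by
  refine Measurable.indicator ?_ measurableSet_Ioc
  fun_prop

lemma norm_powLogCutoff_le (a : ℝ) (j : ℕ) {r : ℝ} (hr : 0 < r) :
    ∃ C, ∀ t : ℝ, 0 < t → ‖powLogCutoff a j t‖ ≤ C * t ^ (a - r) := by
  have hr' : 0 < r / (j + 1) := by positivity
  refine ⟨(1 / (r / (j + 1))) ^ j, fun t ht ↦ ?_⟩
  by_cases h1 : t ∈ Ioc (0 : ℝ) 1
  · have hlog : ‖-(Real.log t : ℂ)‖ ≤ (1 / (r / (j + 1))) * t ^ (-(r / (j + 1))) := by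
      rw [norm_neg, Complex.norm_real, Real.norm_eq_abs]
      have := Real.abs_log_mul_self_rpow_lt t (r / (j + 1)) h1.1 h1.2 hr'
      rw [abs_mul, abs_of_pos (Real.rpow_pos_of_pos ht _)] at this
      rw [Real.rpow_neg ht.le, ← div_eq_mul_inv, le_div_iff₀ (Real.rpow_pos_of_pos ht _)]
      exact this.le
    rw [powLogCutoff, indicator_of_mem h1, norm_mul, norm_pow,
      Complex.norm_cpow_eq_rpow_re_of_pos ht, Complex.ofReal_re]
    calc t ^ a * ‖-(Real.log t : ℂ)‖ ^ j
        ≤ t ^ a * ((1 / (r / (j + 1))) * t ^ (-(r / (j + 1)))) ^ j := by gcongr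
      _ = (1 / (r / (j + 1))) ^ j * (t ^ a * t ^ (-(r / (j + 1)) * j)) := by
          rw [mul_pow, Real.rpow_mul ht.le, Real.rpow_natCast]; ring
      _ ≤ (1 / (r / (j + 1))) ^ j * (t ^ a * t ^ (-r)) := by
          gcongr ?_ * (?_ * ?_)
          apply Real.rpow_le_rpow_of_exponent_ge ht h1.2
          rw [neg_mul, neg_le_neg_iff, div_mul_eq_mul_div, div_le_iff₀ (by positivity)]
          nlinarith
      _ = _ := by rw [← Real.rpow_add ht]; ring_nf
  · rw [powLogCutoff, indicator_of_notMem h1, norm_zero]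
    positivity

lemma locallyIntegrableOn_powLogCutoff (a : ℝ) (j : ℕ) :
    LocallyIntegrableOn (powLogCutoff a j) (Ioi 0) := by
  obtain ⟨C, hC⟩ := norm_powLogCutoff_le a j one_pos
  have h : LocallyIntegrableOn (fun t : ℝ ↦ C * t ^ (a - 1)) (Ioi 0) := by
    refine ContinuousOn.locallyIntegrableOn (fun t ht ↦ ?_) measurableSet_Ioi
    exact (continuousAt_const.mul
      (Real.continuousAt_rpow_const _ _ (Or.inl (ne_of_gt ht)))).continuousWithinAt
  rw [locallyIntegrableOn_iff isOpen_Ioi.isLocallyClosed] at h ⊢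
  intro k hk hkc
  refine (h k hk hkc).mono' (measurable_powLogCutoff a j).aestronglyMeasurable ?_
  filter_upwards [ae_restrict_mem hkc.measurableSet] with t ht using hC t (hk ht)

lemma powLogCutoff_isBigO_atTop (a : ℝ) (j : ℕ) (b : ℝ) :
    powLogCutoff a j =O[atTop] fun t : ℝ ↦ t ^ b := by
  refine Asymptotics.IsBigO.of_bound 0 ?_
  filter_upwards [eventually_gt_atTop 1] with t ht
  rw [powLogCutoff, indicator_of_notMem (fun h ↦ ht.not_ge h.2)]
  simp

lemma powLogCutoff_isBigO_zero (a : ℝ) (j : ℕ) {r : ℝ} (hr : 0 < r) :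
    powLogCutoff a j =O[𝓝[>] 0] fun t : ℝ ↦ t ^ (-(r - a)) := by
  obtain ⟨C, hC⟩ := norm_powLogCutoff_le a j hr
  refine Asymptotics.IsBigO.of_bound C ?_
  filter_upwards [self_mem_nhdsWithin] with t ht
  rw [Real.norm_of_nonneg (Real.rpow_nonneg (le_of_lt ht) _), neg_sub]
  exact hC t ht

lemma hasMellin_powLogCutoff (a : ℝ) (j : ℕ) {s : ℂ} (hs : 0 < s.re + a) :
    HasMellin (powLogCutoff a j) s (j.factorial / (s + a) ^ (j + 1)) := by
  induction j generalizing s with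
  | zero =>
    have := hasMellin_cpow_Ioc (a : ℂ) (s := s) (by simpa using hs)
    simpa [powLogCutoff] using this
  | succ j ih =>
    have hd := mellin_hasDerivAt_of_isBigO_rpow (a := s.re + 1) (s := s)
      (locallyIntegrableOn_powLogCutoff a j) (powLogCutoff_isBigO_atTop a j _) (by linarith)
      (powLogCutoff_isBigO_zero a j (r := (s.re + a) / 2) (by linarith)) (by linarith)
    have hne : s + a ≠ 0 := fun h ↦ by
      have := congrArg Complex.re h
      simp at this
      linarith
    have hfun : powLogCutoff a (j + 1) = fun t ↦ -(Real.log t • powLogCutoff a j t) :=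
      funext (powLogCutoff_succ a j)
    have hev : mellin (powLogCutoff a j) =ᶠ[𝓝 s]
        fun z ↦ (j.factorial : ℂ) * ((z + a) ^ (j + 1))⁻¹ := by
      have hopen : IsOpen {z : ℂ | 0 < z.re + a} :=
        isOpen_lt continuous_const (by fun_prop)
      filter_upwards [hopen.mem_nhds hs] with z hz
      rw [(ih hz).2, div_eq_mul_inv]
    have hd2 : HasDerivAt (fun z : ℂ ↦ (j.factorial : ℂ) * ((z + a) ^ (j + 1))⁻¹)
        (-((j + 1).factorial / (s + a) ^ (j + 2))) s := by
      have h1 : HasDerivAt (fun z : ℂ ↦ z + a) 1 s := (hasDerivAt_id s).add_const _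
      have h2 := ((h1.pow (j + 1)).inv (pow_ne_zero _ hne)).const_mul (j.factorial : ℂ)
      refine h2.congr_deriv ?_
      rw [Nat.factorial_succ]
      push_cast
      simp only [Pi.pow_apply]
      field_simp
      ring
    have heq := (hd.2.congr_of_eventuallyEq hev.symm).unique hd2
    refine ⟨?_, ?_⟩
    · rw [hfun]
      have := hd.1.const_smul (-1 : ℂ)
      simpa using this
    · rw [hfun]
      have : mellin (fun t ↦ -(Real.log t • powLogCutoff a j t)) s
          = -mellin (fun t ↦ Real.log t • powLogCutoff a j t) s := by
        simp [mellin, integral_neg]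
      rw [this, heq, neg_neg]

lemma norm_Gamma_le_Gamma_re {s : ℂ} (hs : 0 < s.re) : ‖Complex.Gamma s‖ ≤ Real.Gamma s.re := by
  rw [Complex.Gamma_eq_integral hs, Real.Gamma_eq_integral hs, Complex.GammaIntegral]
  refine (norm_integral_le_integral_norm _).trans (le_of_eq ?_)
  refine setIntegral_congr_fun measurableSet_Ioi fun x hx ↦ ?_
  rw [norm_mul, Complex.norm_cpow_eq_rpow_re_of_pos hx, Complex.norm_real,
    Real.norm_of_nonneg (Real.exp_pos _).le]
  simp

lemma Gamma_add_natCast_eq_prod {s : ℂ} (hs : ∀ k : ℕ, s + k ≠ 0) (n : ℕ) :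
    Complex.Gamma (s + n) = (∏ i ∈ Finset.range n, (s + i)) * Complex.Gamma s := by
  induction n with
  | zero => simp
  | succ n ih =>
    rw [Finset.prod_range_succ, mul_right_comm, ← ih, Nat.cast_succ, ← add_assoc,
      Complex.Gamma_add_one _ (hs n), mul_comm]

lemma exists_norm_Gamma_le (κ B : ℝ) (L : ℕ) (hκ : -1 < κ) :
    ∃ C, 0 ≤ C ∧ ∀ s : ℂ, κ ≤ s.re → s.re ≤ B → s.im ≠ 0 →
      ‖Complex.Gamma (s + 1)‖ ≤ C / |s.im| ^ L := by
  have hcont : ContinuousOn Real.Gamma (Icc (κ + 1 + L) (B + 1 + L)) := by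
    intro x hx
    refine (Real.differentiableAt_Gamma fun m h ↦ ?_).continuousAt.continuousWithinAt
    have h1 := hx.1
    have : (0 : ℝ) ≤ L := by positivity
    have : (0 : ℝ) ≤ m := by positivity
    linarith
  obtain ⟨C, hC⟩ := isCompact_Icc.exists_bound_of_continuousOn hcont
  refine ⟨max C 0, le_max_right _ _, fun s h1 h2 h3 ↦ ?_⟩
  have him : 0 < |s.im| ^ L := by positivity
  have hL : (0 : ℝ) ≤ L := by positivity
  have hne : ∀ k : ℕ, s + 1 + k ≠ 0 := fun k h ↦ h3 (by simpa using congrArg Complex.im h)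
  have hG := congrArg norm (Gamma_add_natCast_eq_prod hne L)
  rw [norm_mul, norm_prod] at hG
  have hprod : |s.im| ^ L ≤ ∏ i ∈ Finset.range L, ‖s + 1 + i‖ := by
    rw [← Finset.card_range L, ← Finset.prod_const, Finset.card_range]
    refine Finset.prod_le_prod (fun _ _ ↦ abs_nonneg _) fun i _ ↦ ?_
    simpa using Complex.abs_im_le_norm (s + 1 + i)
  rw [le_div_iff₀ him, mul_comm]
  have hre : (s + 1 + L : ℂ).re = s.re + 1 + L := by simp
  calc |s.im| ^ L * ‖Complex.Gamma (s + 1)‖ ≤ _ :=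
        mul_le_mul_of_nonneg_right hprod (norm_nonneg _)
    _ = ‖Complex.Gamma (s + 1 + L)‖ := hG.symm
    _ ≤ Real.Gamma (s.re + 1 + L) := by
        rw [← hre]; exact norm_Gamma_le_Gamma_re (by rw [hre]; linarith)
    _ ≤ _ := ((Real.le_norm_self _).trans (hC _ ⟨by linarith, by linarith⟩)).trans
        (le_max_left _ _)

lemma integrable_vertical_of_le {f : ℂ → ℂ} {σ C : ℝ} (hf : Continuous fun y : ℝ ↦ f (σ + y * I))
    (hC : ∀ y : ℝ, ‖f (σ + y * I)‖ ≤ C / (1 + y ^ 2)) :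
    Integrable fun y : ℝ ↦ f (σ + y * I) := by
  refine (integrable_inv_one_add_sq.const_mul C).mono' hf.aestronglyMeasurable ?_
  exact Eventually.of_forall fun y ↦ (hC y).trans (by rw [div_eq_mul_inv])

lemma tendsto_intervalIntegral_horizontal_zero {f : ℂ → ℂ} {a b C : ℝ} (hab : a ≤ b)
    (hC : ∀ s : ℂ, a ≤ s.re → s.re ≤ b → ‖f s‖ ≤ C / (1 + s.im ^ 2)) (e : ℝ) (he : e ^ 2 = 1) :
    Tendsto (fun T : ℝ ↦ ∫ x in a..b, f (x + (e * T : ℝ) * I)) atTop (𝓝 0) := by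
  have hlim : Tendsto (fun T : ℝ ↦ C / (1 + T ^ 2) * |b - a|) atTop (𝓝 0) := by
    rw [← zero_mul |b - a|]
    refine Tendsto.mul_const _ (Tendsto.div_atTop tendsto_const_nhds ?_)
    exact tendsto_atTop_add_const_left _ _ (tendsto_pow_atTop two_ne_zero)
  refine squeeze_zero_norm (fun T ↦ ?_) hlim
  refine intervalIntegral.norm_integral_le_of_norm_le_const fun x hx ↦ ?_
  rw [uIoc_of_le hab] at hx
  have := hC (x + (e * T : ℝ) * I) (by simpa using hx.1.le) (by simpa using hx.2)
  refine this.trans (le_of_eq ?_)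
  simp [mul_pow, he]

lemma integral_vertical_eq_of_differentiableOn {f : ℂ → ℂ} {a b C : ℝ} (hab : a ≤ b)
    (hf : ∀ s : ℂ, a ≤ s.re → DifferentiableAt ℂ f s)
    (hC : ∀ s : ℂ, a ≤ s.re → s.re ≤ b → ‖f s‖ ≤ C / (1 + s.im ^ 2)) :
    ∫ y : ℝ, f (a + y * I) = ∫ y : ℝ, f (b + y * I) := by
  have hcont : ∀ σ : ℝ, a ≤ σ → Continuous fun y : ℝ ↦ f (σ + y * I) := fun σ h ↦
    continuous_iff_continuousAt.2 fun y ↦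
      ((hf (σ + y * I) (by simpa using h)).continuousAt).comp
        (f := fun y : ℝ ↦ (σ + y * I : ℂ)) (by fun_prop)
  have hint : ∀ σ : ℝ, a ≤ σ → σ ≤ b → Integrable fun y : ℝ ↦ f (σ + y * I) := fun σ h h' ↦
    integrable_vertical_of_le (hcont σ h) fun y ↦ by
      simpa using hC (σ + y * I) (by simpa using h) (by simpa using h')
  have hlim : ∀ σ : ℝ, a ≤ σ → σ ≤ b → Tendsto (fun T : ℝ ↦ ∫ y in (-T)..T, f (σ + y * I)) atTop
      (𝓝 (∫ y : ℝ, f (σ + y * I))) := fun σ h h' ↦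
    intervalIntegral_tendsto_integral (hint σ h h') tendsto_neg_atTop_atBot tendsto_id
  have hrect : ∀ T : ℝ, (∫ x in a..b, f (x + ((-1) * T : ℝ) * I)) -
      (∫ x in a..b, f (x + (1 * T : ℝ) * I)) + I * (∫ y in (-T)..T, f (b + y * I)) -
      I * (∫ y in (-T)..T, f (a + y * I)) = 0 := fun T ↦ by
    have := Complex.integral_boundary_rect_eq_zero_of_differentiableOn f (⟨a, -T⟩) (⟨b, T⟩)
      (fun s hs ↦ (hf s (by
        have := hs.1
        simp only [uIcc_of_le hab] at this
        exact this.1)).differentiableWithinAt)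
    simpa using this
  have h0 := (((tendsto_intervalIntegral_horizontal_zero hab hC (-1) (by norm_num)).sub
    (tendsto_intervalIntegral_horizontal_zero hab hC 1 (by norm_num))).add
    ((hlim b hab le_rfl).const_mul I)).sub ((hlim a le_rfl hab).const_mul I)
  simp only [hrect] at h0
  have h1 := tendsto_nhds_unique h0 tendsto_const_nhds
  simp only [sub_self, zero_add] at h1
  exact (mul_left_cancel₀ I_ne_zero (sub_eq_zero.1 h1)).symm

lemma exists_taylor_expansion {U : Set ℂ} (hU : IsOpen U) {c : ℂ} (hc : c ∈ U) {f : ℂ → ℂ}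
    (hf : DifferentiableOn ℂ f U) (N : ℕ) :
    ∃ (a : ℕ → ℂ) (h : ℂ → ℂ), DifferentiableOn ℂ h U ∧
      ∀ s, f s = ∑ k ∈ Finset.range N, a k * (s - c) ^ k + (s - c) ^ N * h s := by
  induction N with
  | zero => exact ⟨0, f, hf, fun s ↦ by simp⟩
  | succ N ih =>
    obtain ⟨a, h, hh, hs⟩ := ih
    refine ⟨fun k ↦ if k = N then h c else a k, dslope h c,
      (Complex.differentiableOn_dslope (hU.mem_nhds hc)).2 hh, fun s ↦ ?_⟩
    have h1 : ∑ k ∈ Finset.range N, (if k = N then h c else a k) * (s - c) ^ k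
        = ∑ k ∈ Finset.range N, a k * (s - c) ^ k :=
      Finset.sum_congr rfl fun k hk ↦ by rw [if_neg (Finset.mem_range.1 hk).ne]
    have h2 : (s - c) * dslope h c s = h s - h c := by
      simpa using sub_smul_dslope h c s
    rw [Finset.sum_range_succ, h1, hs s]
    simp only [if_true]
    linear_combination -(s - c) ^ N * h2

lemma norm_one_div_pow_sub_one_div_pow_le {s : ℂ} (ht : 1 ≤ |s.im|) (j : ℕ) :
    ‖1 / (s - 1) ^ (j + 1) - 1 / (s + 1) ^ (j + 1)‖ ≤ 2 / s.im ^ 2 := by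
  have h1 : |s.im| ≤ ‖s - 1‖ := by simpa using Complex.abs_im_le_norm (s - 1)
  have h2 : |s.im| ≤ ‖s + 1‖ := by simpa using Complex.abs_im_le_norm (s + 1)
  have hpos : 0 < |s.im| := by linarith
  have n1 : 0 < ‖s - 1‖ := by linarith
  have n2 : 0 < ‖s + 1‖ := by linarith
  rw [← sq_abs s.im]
  rcases j with _ | j
  · have e1 : s - 1 ≠ 0 := norm_pos_iff.1 n1
    have e2 : s + 1 ≠ 0 := norm_pos_iff.1 n2
    have : 1 / (s - 1) ^ (0 + 1) - 1 / (s + 1) ^ (0 + 1) = 2 / ((s - 1) * (s + 1)) := by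
      field_simp
      ring
    rw [this, norm_div, norm_mul, Complex.norm_ofNat]
    gcongr
    nlinarith
  · have key : ∀ z : ℂ, |s.im| ≤ ‖z‖ → ‖1 / z ^ (j + 1 + 1)‖ ≤ 1 / |s.im| ^ 2 := fun z hz ↦ by
      rw [norm_div, norm_one, norm_pow]
      gcongr
      calc |s.im| ^ 2 ≤ |s.im| ^ (j + 1 + 1) := pow_le_pow_right₀ ht (by lia)
        _ ≤ _ := by gcongr
    calc _ ≤ _ := norm_sub_le _ _
      _ ≤ 1 / |s.im| ^ 2 + 1 / |s.im| ^ 2 := add_le_add (key _ h1) (key _ h2)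
      _ = _ := by ring

lemma isOpen_neg_one_lt_re : IsOpen {s : ℂ | -1 < s.re} :=
  isOpen_lt continuous_const Complex.continuous_re

lemma exists_holomorphic_part {F : ℂ → ℂ} (hF : ∀ s : ℂ, -1 < s.re → DifferentiableAt ℂ F s)
    {N : ℕ} (hN : 1 ≤ N) :
    ∃ (d : ℕ → ℂ) (H : ℂ → ℂ), d (N - 1) = F 1 ∧
      (∀ s : ℂ, -1 < s.re → DifferentiableAt ℂ H s) ∧
      ∀ s : ℂ, -1 < s.re → s ≠ 0 → s ≠ 1 → H s = Complex.Gamma s * F s / (s - 1) ^ N -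
        ∑ j ∈ Finset.range N, d j * (1 / (s - 1) ^ (j + 1) - 1 / (s + 1) ^ (j + 1)) -
        (-1) ^ N * F 0 * Complex.Gamma s := by
  set U : Set ℂ := {s | -1 < s.re}
  have hU : IsOpen U := isOpen_neg_one_lt_re
  set B : ℂ → ℂ := fun s ↦ F s - (-1) ^ N * (s - 1) ^ N * F 0
  have hB : DifferentiableOn ℂ B U := fun s hs ↦ by
    have := hF s hs
    refine DifferentiableAt.differentiableWithinAt ?_
    fun_prop
  have h0U : (0 : ℂ) ∈ U := by simp [U]
  have hB0 : B 0 = 0 := by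
    simp only [B, zero_sub, ← mul_pow]
    simp
  have hdB : DifferentiableOn ℂ (dslope B 0) U :=
    (Complex.differentiableOn_dslope (hU.mem_nhds h0U)).2 hB
  have hBs : ∀ s, s * dslope B 0 s = B s := fun s ↦ by
    simpa [hB0] using sub_smul_dslope B 0 s
  have hf : DifferentiableOn ℂ (fun s ↦ Complex.Gamma (s + 1) * dslope B 0 s) U := by
    refine DifferentiableOn.mul (fun s hs ↦ ?_) hdB
    refine DifferentiableAt.differentiableWithinAt ?_
    refine DifferentiableAt.comp (f := fun s : ℂ ↦ s + 1) s
      (Complex.differentiableAt_Gamma _ fun m h ↦ ?_) (by fun_prop)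
    have h1 := congrArg Complex.re h
    have h2 : (0 : ℝ) ≤ m := by positivity
    have h3 : -1 < s.re := hs
    simp at h1
    linarith
  obtain ⟨a, h, hh, hexp⟩ := exists_taylor_expansion hU (c := 1) (by simp [U]) hf N
  refine ⟨fun j ↦ a (N - 1 - j), fun s ↦ h s + ∑ j ∈ Finset.range N,
    a (N - 1 - j) * (1 / (s + 1) ^ (j + 1)), ?_, fun s hs ↦ ?_, fun s hs h0 h1 ↦ ?_⟩
  · have h1 := hexp 1
    have h2 : ∑ k ∈ Finset.range N, a k * ((1 : ℂ) - 1) ^ k = a 0 := by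
      rw [Finset.sum_eq_single_of_mem 0 (Finset.mem_range.2 hN)]
      · simp
      · intro k _ hk
        simp [hk]
    have h3 : dslope B 0 1 = B 1 := by simpa using hBs 1
    rw [h2, h3] at h1
    have hN0 : N ≠ 0 := by lia
    have hG : Complex.Gamma (1 + 1) = 1 := by
      rw [Complex.Gamma_add_one _ one_ne_zero]
      simp
    simp only [hG, B, sub_self, zero_pow hN0] at h1
    simpa using h1.symm
  · have hne : s + 1 ≠ 0 := fun h ↦ by
      have h1 := congrArg Complex.re h
      simp at h1
      linarith
    refine (hh.differentiableAt (hU.mem_nhds hs)).fun_add (DifferentiableAt.fun_sum fun j _ ↦ ?_)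
    have hd : DifferentiableAt ℂ (fun s : ℂ ↦ (s + 1) ^ (j + 1)) s := by fun_prop
    exact ((differentiableAt_const (1 : ℂ)).fun_div hd (pow_ne_zero _ hne)).const_mul _
  · have hexp' := hexp s
    have hs1 : s - 1 ≠ 0 := sub_ne_zero.2 h1
    have hG : Complex.Gamma (s + 1) * dslope B 0 s = Complex.Gamma s * B s := by
      rw [Complex.Gamma_add_one _ h0, ← hBs s]
      ring
    have hrefl : ∑ k ∈ Finset.range N, a k * (s - 1) ^ k
        = (s - 1) ^ N * ∑ j ∈ Finset.range N, a (N - 1 - j) * (1 / (s - 1) ^ (j + 1)) := by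
      rw [← Finset.sum_range_reflect, Finset.mul_sum]
      refine Finset.sum_congr rfl fun j hj ↦ ?_
      have hj' := Finset.mem_range.1 hj
      have : (s - 1) ^ N = (s - 1) ^ (N - 1 - j) * (s - 1) ^ (j + 1) := by
        rw [← pow_add]
        congr 1
        lia
      rw [this]
      field_simp
    rw [hG, hrefl] at hexp'
    simp only [mul_sub, Finset.sum_sub_distrib]
    simp only [B] at hexp'
    have hp : (s - 1) ^ N ≠ 0 := pow_ne_zero _ hs1
    set S₁ := ∑ j ∈ Finset.range N, a (N - 1 - j) * (1 / (s - 1) ^ (j + 1))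
    set S₂ := ∑ j ∈ Finset.range N, a (N - 1 - j) * (1 / (s + 1) ^ (j + 1))
    have : h s = Complex.Gamma s * F s / (s - 1) ^ N - (-1) ^ N * F 0 * Complex.Gamma s - S₁ := by
      field_simp
      linear_combination -hexp'
    rw [this]
    ring

lemma exists_norm_le_div_one_add_sq {F H : ℂ → ℂ} {d : ℕ → ℂ} {N M : ℕ} {κ B C : ℝ}
    (hκ : -1 < κ) (hC : 0 ≤ C)
    (hF : ∀ s : ℂ, κ ≤ s.re → s.re ≤ B → ‖F s‖ ≤ C * (1 + ‖s‖) ^ M)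
    (hH : ∀ s : ℂ, -1 < s.re → DifferentiableAt ℂ H s)
    (hHeq : ∀ s : ℂ, -1 < s.re → s ≠ 0 → s ≠ 1 → H s = Complex.Gamma s * F s / (s - 1) ^ N -
        ∑ j ∈ Finset.range N, d j * (1 / (s - 1) ^ (j + 1) - 1 / (s + 1) ^ (j + 1)) -
        (-1) ^ N * F 0 * Complex.Gamma s) :
    ∃ C', ∀ s : ℂ, κ ≤ s.re → s.re ≤ B → ‖H s‖ ≤ C' / (1 + s.im ^ 2) := by
  obtain ⟨K, hK⟩ := ((isCompact_Icc (a := κ) (b := B)).reProdIm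
    (isCompact_Icc (a := (-1 : ℝ)) (b := 1))).exists_bound_of_continuousOn (f := H)
    fun s hs ↦ (hH s (hκ.trans_le hs.1.1)).continuousAt.continuousWithinAt
  obtain ⟨L, hL0, hL⟩ := exists_norm_Gamma_le κ B (M + 2) hκ
  set R := 2 + |κ| + |B|
  have hR : 0 ≤ R := by positivity
  set Q := L * (C * R ^ M) + ∑ j ∈ Finset.range N, ‖d j‖ * 2 + ‖F 0‖ * L
  have hQ : 0 ≤ Q := by positivity
  refine ⟨2 * max K Q, fun s h1 h2 ↦ ?_⟩
  rw [le_div_iff₀ (by positivity)]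
  rcases le_or_gt |s.im| 1 with ht | ht
  · have hk : ‖H s‖ ≤ max K Q := (hK s ⟨⟨h1, h2⟩, abs_le.1 ht⟩).trans (le_max_left _ _)
    have : s.im ^ 2 ≤ 1 := by rw [← sq_abs]; nlinarith [abs_nonneg s.im]
    nlinarith [norm_nonneg (H s)]
  · have him : s.im ≠ 0 := fun h ↦ by simp [h] at ht; linarith
    have hpos : 0 < |s.im| := by linarith
    have hs0 : s ≠ 0 := fun h ↦ him (by simp [h])
    have hs1 : s ≠ 1 := fun h ↦ him (by simp [h])
    have hnorm1 : 1 ≤ ‖s‖ := ht.le.trans (Complex.abs_im_le_norm s)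
    have hns1 : 1 ≤ ‖s - 1‖ := ht.le.trans (by simpa using Complex.abs_im_le_norm (s - 1))
    have hG : ‖Complex.Gamma s‖ ≤ L / |s.im| ^ (M + 2) := by
      have := hL s h1 h2 him
      rw [Complex.Gamma_add_one _ hs0, norm_mul] at this
      exact (le_mul_of_one_le_left (norm_nonneg _) hnorm1).trans this
    have hre : |s.re| ≤ |κ| + |B| := abs_le.2
      ⟨by linarith [neg_abs_le κ, abs_nonneg B], by linarith [le_abs_self B, abs_nonneg κ]⟩
    have hnorm : 1 + ‖s‖ ≤ R * |s.im| := by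
      have := Complex.norm_le_abs_re_add_abs_im s
      have h3 : 0 ≤ |κ| + |B| := by positivity
      simp only [R]
      nlinarith
    have hFs : ‖F s‖ ≤ C * R ^ M * |s.im| ^ M := by
      refine (hF s h1 h2).trans ?_
      rw [mul_assoc, ← mul_pow]
      gcongr
    have t1 : ‖Complex.Gamma s * F s / (s - 1) ^ N‖ ≤ L * (C * R ^ M) / s.im ^ 2 := by
      rw [norm_div, norm_mul, norm_pow]
      calc _ ≤ ‖Complex.Gamma s‖ * ‖F s‖ :=
            div_le_self (by positivity) (one_le_pow₀ hns1)
        _ ≤ L / |s.im| ^ (M + 2) * (C * R ^ M * |s.im| ^ M) := by gcongr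
        _ = _ := by
            rw [← sq_abs s.im, pow_add]
            field_simp
    have t2 : ‖∑ j ∈ Finset.range N, d j * (1 / (s - 1) ^ (j + 1) - 1 / (s + 1) ^ (j + 1))‖
        ≤ (∑ j ∈ Finset.range N, ‖d j‖ * 2) / s.im ^ 2 := by
      refine (norm_sum_le _ _).trans ?_
      rw [Finset.sum_div]
      refine Finset.sum_le_sum fun j _ ↦ ?_
      rw [norm_mul, mul_div_assoc]
      gcongr
      exact norm_one_div_pow_sub_one_div_pow_le ht.le j
    have t3 : ‖(-1) ^ N * F 0 * Complex.Gamma s‖ ≤ ‖F 0‖ * L / s.im ^ 2 := by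
      rw [norm_mul, norm_mul, norm_pow, norm_neg, norm_one, one_pow, one_mul, mul_div_assoc]
      gcongr
      refine hG.trans ?_
      rw [← sq_abs s.im]
      gcongr
      · exact ht.le
      · lia
    have hHs : ‖H s‖ ≤ Q / s.im ^ 2 := by
      rw [hHeq s (hκ.trans_le h1) hs0 hs1]
      calc _ ≤ _ := (norm_sub_le _ _).trans (add_le_add (norm_sub_le _ _) le_rfl)
        _ ≤ _ := add_le_add (add_le_add t1 t2) t3
        _ = _ := by ring
    have hsq : 1 ≤ s.im ^ 2 := by rw [← sq_abs]; nlinarith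
    rw [le_div_iff₀ (by positivity)] at hHs
    nlinarith [norm_nonneg (H s), le_max_right K Q]

/-! ### Asymptotics of exponential series -/

lemma hasMellin_finset_sum {f : ℕ → ℝ → ℂ} {m : ℕ → ℂ} {s : ℂ} (c : ℕ → ℂ) (N : ℕ)
    (h : ∀ j, HasMellin (f j) s (m j)) :
    HasMellin (fun t ↦ ∑ j ∈ Finset.range N, c j * f j t) s
      (∑ j ∈ Finset.range N, c j * m j) := by
  induction N with
  | zero => simp [HasMellin, MellinConvergent, mellin, IntegrableOn]
  | succ N ih =>
    simp only [Finset.sum_range_succ]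
    have h1 : MellinConvergent (fun t ↦ c N * f N t) s := (h N).1.const_smul (c N)
    have h2 : mellin (fun t ↦ c N * f N t) s = c N * m N := by
      rw [← (h N).2]
      exact mellin_const_smul (f N) s (c N)
    have := hasMellin_add ih.1 h1
    rwa [ih.2, h2] at this

lemma hasMellin_exp_neg {s : ℂ} (hs : 0 < s.re) :
    HasMellin (fun t : ℝ ↦ (Real.exp (-t) : ℂ)) s (Complex.Gamma s) := by
  refine ⟨?_, ?_⟩
  · have := Complex.GammaIntegral_convergent hs
    simpa [MellinConvergent, mul_comm] using this
  · rw [Complex.Gamma_eq_integral hs, Complex.GammaIntegral_eq_mellin]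

lemma exp_neg_le_rpow {y σ : ℝ} (hy : 0 < y) (h0 : 0 ≤ σ) (h3 : σ ≤ 3) :
    Real.exp (-y) ≤ 6 * y ^ (-σ) := by
  have h : y ^ σ ≤ 6 * Real.exp y := by
    rcases le_or_gt y 1 with h1 | h1
    · have := Real.rpow_le_one hy.le h1 h0
      have := Real.one_le_exp hy.le
      linarith
    · have h4 : y ^ σ ≤ y ^ (3 : ℝ) := Real.rpow_le_rpow_of_exponent_le h1.le h3
      have h5 := Real.pow_div_factorial_le_exp y hy.le 3
      have h6 : y ^ (3 : ℝ) = y ^ 3 := by norm_cast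
      norm_num [Nat.factorial] at h5
      rw [h6] at h4
      linarith
  rw [Real.exp_neg, Real.rpow_neg hy.le, ← div_eq_mul_inv, le_div_iff₀ (by positivity),
    ← div_eq_inv_mul, div_le_iff₀ (by positivity)]
  exact h

section ExponentialSeries

variable {ι : Type*} {a p : ι → ℝ}

lemma mul_exp_neg_le (ha : ∀ i, 0 ≤ a i) (hp : ∀ i, 0 < p i) {σ t : ℝ} (ht : 0 < t)
    (h0 : 0 ≤ σ) (h3 : σ ≤ 3) (i : ι) :
    a i * Real.exp (-p i * t) ≤ 6 * t ^ (-σ) * (a i * p i ^ (-σ)) := by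
  have := exp_neg_le_rpow (mul_pos (hp i) ht) h0 h3
  rw [Real.mul_rpow (hp i).le ht.le, ← neg_mul] at this
  calc _ ≤ a i * (6 * (p i ^ (-σ) * t ^ (-σ))) := mul_le_mul_of_nonneg_left this (ha i)
    _ = _ := by ring

lemma summable_mul_exp_neg (ha : ∀ i, 0 ≤ a i) (hp : ∀ i, 0 < p i)
    (hsum : ∀ σ : ℝ, 1 < σ → Summable fun i ↦ a i * p i ^ (-σ)) {t : ℝ} (ht : 0 < t) :
    Summable fun i ↦ a i * Real.exp (-p i * t) :=
  ((hsum 2 (by norm_num)).mul_left (6 * t ^ (-2 : ℝ))).of_nonneg_of_le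
    (fun i ↦ mul_nonneg (ha i) (Real.exp_pos _).le)
    (mul_exp_neg_le ha hp ht (by norm_num) (by norm_num))

lemma continuousAt_tsum_mul_exp_neg (ha : ∀ i, 0 ≤ a i) (hp : ∀ i, 0 < p i)
    (hsum : ∀ σ : ℝ, 1 < σ → Summable fun i ↦ a i * p i ^ (-σ)) {t : ℝ} (ht : 0 < t) :
    ContinuousAt (fun t : ℝ ↦ ∑' i, a i * Real.exp (-p i * t)) t := by
  have h : ContinuousOn (fun t : ℝ ↦ ∑' i, a i * Real.exp (-p i * t)) (Ioi (t / 2)) := by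
    refine continuousOn_tsum (fun i ↦ by fun_prop)
      (summable_mul_exp_neg ha hp hsum (half_pos ht)) fun i x hx ↦ ?_
    rw [Real.norm_of_nonneg (mul_nonneg (ha i) (Real.exp_pos _).le)]
    refine mul_le_mul_of_nonneg_left (Real.exp_le_exp.2 ?_) (ha i)
    have : t / 2 < x := hx
    nlinarith [hp i]
  exact h.continuousAt (Ioi_mem_nhds (by linarith))

lemma norm_tsum_mul_exp_neg_le (ha : ∀ i, 0 ≤ a i) (hp : ∀ i, 0 < p i)
    (hsum : ∀ σ : ℝ, 1 < σ → Summable fun i ↦ a i * p i ^ (-σ)) {σ t : ℝ} (ht : 0 < t)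
    (h1 : 1 < σ) (h3 : σ ≤ 3) :
    ‖((∑' i, a i * Real.exp (-p i * t) : ℝ) : ℂ)‖
      ≤ (6 * ∑' i, a i * p i ^ (-σ)) * ‖t ^ (-σ)‖ := by
  rw [Complex.norm_real, Real.norm_of_nonneg
    (tsum_nonneg fun i ↦ mul_nonneg (ha i) (Real.exp_pos _).le),
    Real.norm_of_nonneg (Real.rpow_nonneg ht.le _)]
  calc _ ≤ ∑' i, 6 * t ^ (-σ) * (a i * p i ^ (-σ)) :=
        (summable_mul_exp_neg ha hp hsum ht).tsum_le_tsum
          (mul_exp_neg_le ha hp ht (by linarith) h3) ((hsum σ h1).mul_left _)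
    _ = _ := by rw [tsum_mul_left]; ring

lemma hasMellin_tsum_mul_exp_neg [Countable ι] (ha : ∀ i, 0 ≤ a i) (hp : ∀ i, 0 < p i)
    (hsum : ∀ σ : ℝ, 1 < σ → Summable fun i ↦ a i * p i ^ (-σ)) {s : ℂ} (hs : s.re = 2) :
    HasMellin (fun t : ℝ ↦ ((∑' i, a i * Real.exp (-p i * t) : ℝ) : ℂ)) s
      (Complex.Gamma s * ∑' i, (a i : ℂ) * (p i : ℂ) ^ (-s)) := by
  refine ⟨?_, ?_⟩
  · refine mellinConvergent_of_isBigO_rpow (a := 3) (b := 3 / 2) ?_ ?_ (by linarith) ?_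
      (by linarith)
    · refine ContinuousOn.locallyIntegrableOn (fun t ht ↦ ?_) measurableSet_Ioi
      exact (Complex.continuous_ofReal.continuousAt.comp
        (continuousAt_tsum_mul_exp_neg ha hp hsum ht)).continuousWithinAt
    · refine Asymptotics.IsBigO.of_bound (6 * ∑' i, a i * p i ^ (-3 : ℝ)) ?_
      filter_upwards [eventually_gt_atTop 0] with t ht
      exact norm_tsum_mul_exp_neg_le ha hp hsum ht (by norm_num) le_rfl
    · refine Asymptotics.IsBigO.of_bound (6 * ∑' i, a i * p i ^ (-(3 / 2) : ℝ)) ?_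
      filter_upwards [self_mem_nhdsWithin] with t ht
      exact norm_tsum_mul_exp_neg_le ha hp hsum ht (by norm_num) (by norm_num)
  · have h := hasSum_mellin (a := fun i ↦ (a i : ℂ)) (p := p) (s := s)
      (F := fun t : ℝ ↦ ((∑' i, a i * Real.exp (-p i * t) : ℝ) : ℂ))
      (fun i ↦ Or.inr (hp i)) (by linarith)
      (fun t ht ↦ by
        simpa using Complex.hasSum_ofReal.2 (summable_mul_exp_neg ha hp hsum ht).hasSum) (by
        refine (hsum 2 (by norm_num)).congr fun i ↦ ?_
        rw [Complex.norm_real, Real.norm_of_nonneg (ha i), hs, Real.rpow_neg (hp i).le,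
          div_eq_mul_inv])
    rw [← h.tsum_eq, ← tsum_mul_left]
    refine tsum_congr fun i ↦ ?_
    rw [Complex.cpow_neg]
    ring

end ExponentialSeries

lemma norm_le_of_hasMellin {D : ℝ → ℂ} {h : ℂ → ℂ} {σ C x : ℝ} (hσ : σ ≤ 2)
    (hx0 : 0 < x) (hx1 : x < 1) (hD : ∀ s : ℂ, s.re = 2 → HasMellin D s (h s))
    (hcont : ContinuousAt D x) (hh : ∀ s : ℂ, σ ≤ s.re → DifferentiableAt ℂ h s)
    (hC : ∀ s : ℂ, σ ≤ s.re → s.re ≤ 2 → ‖h s‖ ≤ C / (1 + s.im ^ 2)) :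
    ‖D x‖ ≤ C * x ^ (-σ) := by
  have hline : ∀ y : ℝ, mellin D ((2 : ℝ) + y * I) = h ((2 : ℝ) + y * I) := fun y ↦
    (hD _ (by simp)).2
  have hcontL : Continuous fun y : ℝ ↦ h ((2 : ℝ) + y * I) := continuous_iff_continuousAt.2
    fun y ↦ ((hh ((2 : ℝ) + y * I) (by simpa using hσ)).continuousAt).comp
        (f := fun y : ℝ ↦ ((2 : ℝ) + y * I : ℂ)) (by fun_prop)
  have hvert : VerticalIntegrable (mellin D) 2 := by
    simp only [VerticalIntegrable, hline]
    refine integrable_vertical_of_le (C := C) hcontL fun y ↦ ?_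
    simpa using hC ((2 : ℝ) + y * I) (by simpa using hσ) (by simp)
  have hinv := mellinInv_mellin_eq 2 D hx0 (hD _ (by simp)).1 hvert hcont
  have hxne : (x : ℂ) ≠ 0 := Complex.ofReal_ne_zero.2 hx0.ne'
  have hC0 : 0 ≤ C := by
    have := (norm_nonneg _).trans (hC (σ : ℂ) (by simp) (by simpa using hσ))
    simpa using this
  have hshift := integral_vertical_eq_of_differentiableOn (f := fun s ↦ (x : ℂ) ^ (-s) * h s)
    (a := σ) (b := 2) (C := x ^ (-2 : ℝ) * C) hσ
    (fun s hs ↦ by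
      refine DifferentiableAt.fun_mul ?_ (hh s hs)
      exact DifferentiableAt.const_cpow (by fun_prop) (Or.inl hxne))
    (fun s h1 h2 ↦ by
      rw [norm_mul, Complex.norm_cpow_eq_rpow_re_of_pos hx0, Complex.neg_re, mul_div_assoc]
      refine mul_le_mul ?_ (hC s h1 h2) (norm_nonneg _) (by positivity)
      exact Real.rpow_le_rpow_of_exponent_ge hx0 hx1.le (by linarith))
  rw [← hinv, mellinInv]
  simp only [hline, smul_eq_mul]
  rw [← hshift, norm_smul]
  have hbound : ‖∫ y : ℝ, (x : ℂ) ^ (-(σ + y * I : ℂ)) * h (σ + y * I)‖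
      ≤ ∫ y : ℝ, x ^ (-σ) * C * (1 + y ^ 2)⁻¹ := by
    refine norm_integral_le_of_norm_le (integrable_inv_one_add_sq.const_mul _)
      (Eventually.of_forall fun y ↦ ?_)
    have h1 := hC (σ + y * I) (by simp) (by simpa using hσ)
    rw [norm_mul, Complex.norm_cpow_eq_rpow_re_of_pos hx0, mul_assoc, ← div_eq_mul_inv]
    simp only [neg_re, add_re, ofReal_re, mul_re, I_re, mul_zero, ofReal_im, I_im, mul_one,
      sub_self, add_zero, add_im, mul_im, zero_add] at h1 ⊢
    gcongr
  rw [integral_const_mul, integral_univ_inv_one_add_sq] at hbound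
  calc _ ≤ ‖1 / (2 * π)‖ * (x ^ (-σ) * C * π) := by gcongr
    _ = C * x ^ (-σ) / 2 := by
        rw [Real.norm_of_nonneg (by positivity)]
        field_simp
    _ ≤ _ := half_le_self (by positivity)

lemma continuousAt_powLogCutoff (b : ℝ) (j : ℕ) {x : ℝ} (hx0 : 0 < x) (hx1 : x < 1) :
    ContinuousAt (powLogCutoff b j) x := by
  have hev : powLogCutoff b j =ᶠ[𝓝 x] fun t ↦ (t : ℂ) ^ (b : ℂ) * (-(Real.log t : ℂ)) ^ j := by
    filter_upwards [Ioo_mem_nhds hx0 hx1] with t ht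
    rw [powLogCutoff, indicator_of_mem (Ioo_subset_Ioc_self ht)]
  refine ContinuousAt.congr ?_ hev.symm
  have h1 : ContinuousAt (fun t : ℝ ↦ (t : ℂ) ^ (b : ℂ)) x :=
    (hasDerivAt_ofReal_cpow_of_pos hx0 b).continuousAt
  have h2 : ContinuousAt (fun t : ℝ ↦ (Real.log t : ℂ)) x :=
    Complex.continuous_ofReal.continuousAt.comp (Real.continuousAt_log hx0.ne')
  fun_prop

lemma powLogCutoff_neg_one_inv (j : ℕ) {X : ℝ} (hX : 1 ≤ X) :
    powLogCutoff (-1) j X⁻¹ = X * (Real.log X : ℂ) ^ j := by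
  have hX0 : 0 < X := by linarith
  have hmem : X⁻¹ ∈ Ioc (0 : ℝ) 1 := ⟨inv_pos.2 hX0, inv_le_one_of_one_le₀ hX⟩
  rw [powLogCutoff, indicator_of_mem hmem, Real.log_inv]
  push_cast
  rw [neg_neg, Complex.cpow_neg_one, inv_inv]

/-- If the Dirichlet series `∑ a i * p i ^ (-s)` continues to `F s / (s - 1) ^ N` with `F`
holomorphic and of polynomial growth in `-1 < re s`, then `∑ a i * exp (-p i / X)` has an
asymptotic expansion with an error `O(X ^ (ε - 1))`. -/
theorem exists_asymptotic_tsum_mul_exp_neg {ι : Type*} [Countable ι] {a p : ι → ℝ}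
    (ha : ∀ i, 0 ≤ a i) (hp : ∀ i, 0 < p i)
    (hsum : ∀ σ : ℝ, 1 < σ → Summable fun i ↦ a i * p i ^ (-σ))
    {F : ℂ → ℂ} (hF : ∀ s : ℂ, -1 < s.re → DifferentiableAt ℂ F s) {N M : ℕ} (hN : 1 ≤ N)
    (hser : ∀ s : ℂ, 1 < s.re → (s - 1) ^ N * ∑' i, (a i : ℂ) * (p i : ℂ) ^ (-s) = F s)
    (hgrowth : ∀ κ B : ℝ, -1 < κ → ∃ C, 0 ≤ C ∧
      ∀ s : ℂ, κ ≤ s.re → s.re ≤ B → ‖F s‖ ≤ C * (1 + ‖s‖) ^ M) :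
    ∃ c : ℕ → ℂ, c (N - 1) = F 1 / (N - 1).factorial ∧ ∀ ε : ℝ, 0 < ε → ∃ K : ℝ, ∀ X : ℝ, 2 ≤ X →
      ‖((∑' i, a i * Real.exp (-p i / X) : ℝ) : ℂ) -
        X * ∑ j ∈ Finset.range N, c j * (Real.log X : ℂ) ^ j - (-1) ^ N * F 0‖
        ≤ K * X ^ (ε - 1) := by
  obtain ⟨d, H, hd, hH, hHeq⟩ := exists_holomorphic_part hF hN
  refine ⟨fun j ↦ d j / j.factorial, by simp only [hd], fun ε hε ↦ ?_⟩
  set r := min ε (1 / 2) with hr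
  have hr0 : 0 < r := lt_min hε (by norm_num)
  have hr1 : r ≤ 1 / 2 := min_le_right _ _
  obtain ⟨C₀, hC₀, hFb⟩ := hgrowth (r - 1) 2 (by linarith)
  obtain ⟨C, hC⟩ := exists_norm_le_div_one_add_sq (by linarith) hC₀ hFb hH hHeq
  set S : ℝ → ℂ := fun t ↦ ((∑' i, a i * Real.exp (-p i * t) : ℝ) : ℂ)
  set u : ℕ → ℝ → ℂ := fun j t ↦ powLogCutoff (-1) j t - powLogCutoff 1 j t
  set D : ℝ → ℂ := fun t ↦ S t - (∑ j ∈ Finset.range N, d j / j.factorial * u j t +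
    (-1) ^ N * F 0 * (Real.exp (-t) : ℂ))
  have hDm : ∀ s : ℂ, s.re = 2 → HasMellin D s (H s) := fun s hs ↦ by
    have hu : ∀ j, HasMellin (u j) s
        (j.factorial * (1 / (s - 1) ^ (j + 1) - 1 / (s + 1) ^ (j + 1))) := fun j ↦ by
      have h1 := hasMellin_powLogCutoff (-1) j (s := s) (by rw [hs]; norm_num)
      have h2 := hasMellin_powLogCutoff 1 j (s := s) (by rw [hs]; norm_num)
      have h3 := hasMellin_sub h1.1 h2.1
      rw [h1.2, h2.2] at h3
      convert! h3 using 1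
      push_cast
      rw [← sub_eq_add_neg]
      ring
    have hE := hasMellin_exp_neg (s := s) (by linarith)
    have hE1 : MellinConvergent (fun t : ℝ ↦ (-1) ^ N * F 0 * (Real.exp (-t) : ℂ)) s :=
      hE.1.const_smul ((-1) ^ N * F 0)
    have hE2 : mellin (fun t : ℝ ↦ (-1) ^ N * F 0 * (Real.exp (-t) : ℂ)) s
        = (-1) ^ N * F 0 * Complex.Gamma s := by
      rw [← hE.2]
      exact mellin_const_smul _ s ((-1) ^ N * F 0)
    have hU := hasMellin_finset_sum (fun j ↦ d j / j.factorial) N hu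
    have hUE := hasMellin_add hU.1 hE1
    have hS := hasMellin_tsum_mul_exp_neg ha hp hsum hs
    have hDs := hasMellin_sub hS.1 hUE.1
    rw [hUE.2, hU.2, hE2, hS.2] at hDs
    refine ⟨hDs.1, hDs.2.trans ?_⟩
    have hs1 : s ≠ 1 := fun h ↦ by norm_num [h] at hs
    have hs0 : s ≠ 0 := fun h ↦ by norm_num [h] at hs
    rw [hHeq s (by linarith) hs0 hs1, ← hser s (by linarith)]
    have hp1 : (s - 1) ^ N ≠ 0 := pow_ne_zero _ (sub_ne_zero.2 hs1)
    have hsumeq : ∑ j ∈ Finset.range N, d j / j.factorial *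
        (j.factorial * (1 / (s - 1) ^ (j + 1) - 1 / (s + 1) ^ (j + 1)))
        = ∑ j ∈ Finset.range N, d j * (1 / (s - 1) ^ (j + 1) - 1 / (s + 1) ^ (j + 1)) := by
      refine Finset.sum_congr rfl fun j _ ↦ ?_
      have : (j.factorial : ℂ) ≠ 0 := Nat.cast_ne_zero.2 j.factorial_ne_zero
      rw [← mul_assoc, div_mul_cancel₀ _ this]
    rw [hsumeq]
    field_simp
    ring
  have hDc : ∀ x : ℝ, 0 < x → x < 1 → ContinuousAt D x := fun x h0 h1 ↦ by
    have hS : ContinuousAt S x := Complex.continuous_ofReal.continuousAt.comp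
      (continuousAt_tsum_mul_exp_neg ha hp hsum h0)
    have hu : ContinuousAt (fun t ↦ ∑ j ∈ Finset.range N, d j / j.factorial * u j t) x :=
      tendsto_finsetSum _ fun j _ ↦ continuousAt_const.mul
        ((continuousAt_powLogCutoff (-1) j h0 h1).sub (continuousAt_powLogCutoff 1 j h0 h1))
    have hE : ContinuousAt (fun t : ℝ ↦ (-1) ^ N * F 0 * (Real.exp (-t) : ℂ)) x := by fun_prop
    exact hS.sub (hu.add hE)
  have hDb : ∀ x : ℝ, 0 < x → x < 1 → ‖D x‖ ≤ C * x ^ (1 - r) := fun x h0 h1 ↦ by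
    have := norm_le_of_hasMellin (σ := r - 1) (by linarith) h0 h1 hDm (hDc x h0 h1)
      (fun s hs ↦ hH s (by linarith)) hC
    rwa [neg_sub] at this
  choose Q hQ using fun j ↦ norm_powLogCutoff_le 1 j hr0
  set K := C + ∑ j ∈ Finset.range N, ‖d j / j.factorial‖ * Q j + ‖F 0‖ with hK
  refine ⟨max K 0, fun X hX ↦ ?_⟩
  have hX0 : 0 < X := by linarith
  have hx0 : 0 < X⁻¹ := inv_pos.2 hX0
  have hx1 : X⁻¹ < 1 := inv_lt_one_of_one_lt₀ (by linarith)
  have hSX : ((∑' i, a i * Real.exp (-p i / X) : ℝ) : ℂ) = S X⁻¹ := by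
    simp only [S, div_eq_mul_inv]
  have hid : S X⁻¹ - X * ∑ j ∈ Finset.range N, d j / j.factorial * (Real.log X : ℂ) ^ j -
      (-1) ^ N * F 0 = D X⁻¹ - ∑ j ∈ Finset.range N, d j / j.factorial * powLogCutoff 1 j X⁻¹ +
      (-1) ^ N * F 0 * ((Real.exp (-X⁻¹) - 1 : ℝ) : ℂ) := by
    simp only [D, u, powLogCutoff_neg_one_inv _ (by linarith : 1 ≤ X), mul_sub,
      Finset.sum_sub_distrib, Finset.mul_sum]
    have : ∑ j ∈ Finset.range N, (X : ℂ) * (d j / j.factorial * (Real.log X : ℂ) ^ j)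
        = ∑ j ∈ Finset.range N, d j / j.factorial * (X * (Real.log X : ℂ) ^ j) :=
      Finset.sum_congr rfl fun j _ ↦ by ring
    rw [this]
    push_cast
    ring
  have t2 : ‖∑ j ∈ Finset.range N, d j / j.factorial * powLogCutoff 1 j X⁻¹‖
      ≤ (∑ j ∈ Finset.range N, ‖d j / j.factorial‖ * Q j) * X⁻¹ ^ (1 - r) := by
    refine (norm_sum_le _ _).trans ?_
    rw [Finset.sum_mul]
    refine Finset.sum_le_sum fun j _ ↦ ?_
    rw [norm_mul, mul_assoc]
    exact mul_le_mul_of_nonneg_left (hQ j _ hx0) (norm_nonneg _)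
  have t3 : ‖(-1) ^ N * F 0 * ((Real.exp (-X⁻¹) - 1 : ℝ) : ℂ)‖ ≤ ‖F 0‖ * X⁻¹ ^ (1 - r) := by
    rw [norm_mul, norm_mul, norm_pow, norm_neg, norm_one, one_pow, one_mul, Complex.norm_real]
    gcongr
    have h1 : Real.exp (-X⁻¹) ≤ 1 := Real.exp_le_one_iff.2 (by linarith)
    have h2 := Real.add_one_le_exp (-X⁻¹)
    have h3 : X⁻¹ ≤ X⁻¹ ^ (1 - r) := by
      conv_lhs => rw [← Real.rpow_one X⁻¹]
      exact Real.rpow_le_rpow_of_exponent_ge hx0 hx1.le (by linarith)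
    rw [Real.norm_eq_abs, abs_le]
    exact ⟨by linarith, by linarith⟩
  have hpow : X⁻¹ ^ (1 - r) ≤ X ^ (ε - 1) := by
    rw [Real.inv_rpow hX0.le, ← Real.rpow_neg hX0.le, neg_sub]
    exact Real.rpow_le_rpow_of_exponent_le (by linarith) (by linarith [min_le_left ε (1 / 2)])
  rw [hSX, hid]
  calc _ ≤ ‖D X⁻¹‖ + ‖∑ j ∈ Finset.range N, d j / j.factorial * powLogCutoff 1 j X⁻¹‖ +
          ‖(-1) ^ N * F 0 * ((Real.exp (-X⁻¹) - 1 : ℝ) : ℂ)‖ :=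
        (norm_add_le _ _).trans (add_le_add (norm_sub_le _ _) le_rfl)
    _ ≤ K * X⁻¹ ^ (1 - r) := by
        have := hDb _ hx0 hx1
        rw [hK, add_mul, add_mul]
        linarith
    _ ≤ max K 0 * X⁻¹ ^ (1 - r) := by gcongr; exact le_max_left _ _
    _ ≤ _ := by gcongr

/-! ### Products of ordinates -/

lemma summable_norm_and_tsum_fin_prod {α 𝕜 : Type*} [RCLike 𝕜] {f : α → 𝕜}
    (hf : Summable fun x ↦ ‖f x‖) (n : ℕ) :
    (Summable fun v : Fin n → α ↦ ‖∏ i, f (v i)‖) ∧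
      ∑' v : Fin n → α, ∏ i, f (v i) = (∑' x, f x) ^ n := by
  induction n with
  | zero =>
    refine ⟨Summable.of_finite, by simp⟩
  | succ n ih =>
    have hcons : ∀ q : α × (Fin n → α), ∏ i, f (Fin.consEquiv (fun _ ↦ α) q i)
        = f q.1 * ∏ i, f (q.2 i) := fun q ↦ by
      simp [Fin.prod_univ_succ, Fin.consEquiv]
    refine ⟨?_, ?_⟩
    · rw [← (Fin.consEquiv (fun _ : Fin (n + 1) ↦ α)).summable_iff]
      have h := hf.mul_norm ih.1
      refine h.congr fun q ↦ ?_
      simp only [Function.comp_apply, hcons]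
    · rw [← (Fin.consEquiv (fun _ : Fin (n + 1) ↦ α)).tsum_eq]
      simp only [hcons]
      rw [← tsum_mul_tsum_of_summable_norm hf ih.1, ih.2, pow_succ']

lemma ofReal_prod_cpow {ι : Type*} (t : Finset ι) {x : ι → ℝ} (hx : ∀ i, 0 ≤ x i) (s : ℂ) :
    ((∏ i ∈ t, x i : ℝ) : ℂ) ^ s = ∏ i ∈ t, (x i : ℂ) ^ s := by
  classical
  induction t using Finset.induction_on with
  | empty => simp
  | insert i t hi ih =>
    rw [Finset.prod_insert hi, Finset.prod_insert hi, Complex.ofReal_mul,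
      Complex.mul_cpow_ofReal_nonneg (hx i) (Finset.prod_nonneg fun j _ ↦ hx j), ih]

lemma eq_at_zero_of_continuation {G g : ℂ → ℂ}
    (hG : ∀ s : ℂ, -1 < s.re → s ≠ 1 → DifferentiableAt ℂ G s)
    (hg : ∀ s : ℂ, -1 < s.re → DifferentiableAt ℂ g s)
    (h : ∀ s : ℂ, 1 < s.re → (s - 1) ^ 2 * G s = g s) : G 0 = g 0 := by
  set V : Set ℂ := {s | -1 < s.re} ∩ {s | s.re - s.im < 1}
  have hV : IsOpen V := isOpen_neg_one_lt_re.inter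
    (isOpen_lt (by fun_prop) continuous_const)
  have hconv : Convex ℝ V := by
    refine (convex_halfSpace_re_gt (-1)).inter ?_
    refine convex_halfSpace_lt (f := fun s : ℂ ↦ s.re - s.im) ⟨fun x y ↦ ?_, fun c x ↦ ?_⟩ 1
    · simp only [add_re, add_im]
      ring
    · simp only [real_smul, re_ofReal_mul, im_ofReal_mul, smul_eq_mul]
      ring
  have hd1 : DifferentiableOn ℂ (fun s ↦ (s - 1) ^ 2 * G s) V := fun s hs ↦ by
    have h1 : s ≠ 1 := fun h ↦ by
      have : s.re - s.im < 1 := hs.2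
      norm_num [h] at this
    have := hG s hs.1 h1
    exact DifferentiableAt.differentiableWithinAt (by fun_prop)
  have hd2 : DifferentiableOn ℂ g V := fun s hs ↦ (hg s hs.1).differentiableWithinAt
  have hmem : (⟨2, 3⟩ : ℂ) ∈ V := by
    constructor <;> norm_num
  have hev : (fun s ↦ (s - 1) ^ 2 * G s) =ᶠ[𝓝 (⟨2, 3⟩ : ℂ)] g := by
    filter_upwards [(isOpen_lt continuous_const Complex.continuous_re).mem_nhds
      (show (1 : ℝ) < (⟨2, 3⟩ : ℂ).re by norm_num)] with s hs using h s hs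
  have := (hd1.analyticOnNhd hV).eqOn_of_preconnected_of_eventuallyEq (hd2.analyticOnNhd hV)
    hconv.isPreconnected hmem hev (show (0 : ℂ) ∈ V by constructor <;> simp)
  simpa using this

theorem statement8
    (G : ℂ → ℂ)
    (hGser : ∀ s : ℂ, 1 < s.re →
      G s = ∑' ρ : {ρ : ℂ // IsNontrivialZero ρ ∧ 0 < ρ.im},
        (zetaMult ρ.1 : ℂ) * (ρ.1.im : ℂ) ^ (-s))
    (hGan : ∀ s : ℂ, -1 < s.re → s ≠ 1 → DifferentiableAt ℂ G s)
    : ∀ n : ℕ, 1 ≤ n → ∃ A : ℕ → ℝ, A (2 * n - 1) ≠ 0 ∧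
      ∀ ε : ℝ, 0 < ε → ∃ K : ℝ, ∀ X : ℝ, 2 ≤ X →
        ‖((∑' γs : Fin n → {ρ : ℂ // IsNontrivialZero ρ ∧ 0 < ρ.im},
              (∏ i, (zetaMult (γs i).1 : ℝ)) *
                Real.exp (-(∏ i, (γs i).1.im) / X) : ℝ) : ℂ)
            - (X : ℂ) * ∑ j ∈ Finset.range (2 * n), (A j : ℂ) * (Real.log X : ℂ) ^ j
            - (G 0) ^ n‖ ≤ K * X ^ (ε - 1) := by
  intro n hn
  obtain ⟨g, hgd, hg1, ⟨c₀, hg0⟩, hgser, hgb⟩ := exists_continuation_ordinate_series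
  have hG0 : G 0 = c₀ := by
    rw [← hg0]
    refine eq_at_zero_of_continuation hGan hgd fun s hs ↦ ?_
    rw [hGser s hs]
    exact hgser s hs
  have him : ∀ ρ : UpperZero, 0 < ρ.1.im := fun ρ ↦ ρ.2.2
  have hnormC : ∀ s : ℂ, 1 < s.re →
      Summable fun ρ : UpperZero ↦ ‖(zetaMult ρ.1 : ℂ) * (ρ.1.im : ℂ) ^ (-s)‖ := fun s hs ↦ by
    refine (summable_zetaMult_mul_im_rpow hs).congr fun ρ ↦ ?_
    rw [norm_mul, Complex.norm_natCast, Complex.norm_cpow_eq_rpow_re_of_pos (him ρ),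
      Complex.neg_re]
  obtain ⟨c, hcN, hc⟩ := exists_asymptotic_tsum_mul_exp_neg (ι := Fin n → UpperZero)
    (a := fun γ ↦ ∏ i, (zetaMult (γ i).1 : ℝ)) (p := fun γ ↦ ∏ i, (γ i).1.im)
    (fun γ ↦ Finset.prod_nonneg fun i _ ↦ Nat.cast_nonneg _)
    (fun γ ↦ Finset.prod_pos fun i _ ↦ him _)
    (fun σ hσ ↦ by
      have h := (summable_norm_and_tsum_fin_prod (summable_zetaMult_mul_im_rpow hσ).norm n).1
      refine h.of_norm.congr fun γ ↦ ?_
      rw [← Real.finsetProd_rpow _ _ fun i _ ↦ (him (γ i)).le, ← Finset.prod_mul_distrib])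
    (F := fun s ↦ g s ^ n) (fun s hs ↦ (hgd s hs).fun_pow n) (N := 2 * n) (M := 4 * n) (by lia)
    (fun s hs ↦ by
      rw [← hgser s hs, mul_pow, ← pow_mul,
        ← (summable_norm_and_tsum_fin_prod (hnormC s hs) n).2]
      congr 1
      refine tsum_congr fun γ ↦ ?_
      rw [ofReal_prod_cpow _ fun i ↦ (him (γ i)).le, Finset.prod_mul_distrib]
      push_cast
      rfl)
    (fun κ B hκ ↦ by
      obtain ⟨C, hC0, hC⟩ := hgb κ B hκ
      refine ⟨C ^ n, by positivity, fun s h1 h2 ↦ ?_⟩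
      rw [norm_pow, pow_mul, ← mul_pow]
      gcongr
      exact hC s h1 h2)
  refine ⟨fun j ↦ (c j).re, ?_, fun ε hε ↦ ?_⟩
  · have : c (2 * n - 1) = (((1 / (2 * π)) ^ n / (2 * n - 1).factorial : ℝ) : ℂ) := by
      rw [hcN, hg1]
      push_cast
      rfl
    simp only [this, Complex.ofReal_re]
    positivity
  · obtain ⟨K, hK⟩ := hc ε hε
    refine ⟨K, fun X hX ↦ le_trans ?_ (hK X hX)⟩
    simp only [hg0, hG0]
    rw [pow_mul (-1 : ℂ), neg_one_sq, one_pow, one_mul]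
    set S : ℝ := ∑' γ : Fin n → UpperZero, (∏ i, (zetaMult (γ i).1 : ℝ)) *
      Real.exp (-(∏ i, (γ i).1.im) / X)
    set z : ℂ := S - X * ∑ j ∈ Finset.range (2 * n), c j * (Real.log X : ℂ) ^ j - c₀ ^ n with hz
    have hre : (S : ℂ) - X * ∑ j ∈ Finset.range (2 * n), ((c j).re : ℂ) * (Real.log X : ℂ) ^ j
        - (c₀ : ℂ) ^ n = (z.re : ℂ) := by
      have h1 : z.re = S - X * ∑ j ∈ Finset.range (2 * n), (c j).re * Real.log X ^ j
          - c₀ ^ n := by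
        rw [hz]
        simp only [← Complex.ofReal_pow, Complex.sub_re, Complex.ofReal_re, Complex.re_ofReal_mul,
          Complex.re_sum, Complex.re_mul_ofReal]
      rw [h1]
      push_cast
      rfl
    rw [hre, Complex.norm_real]
    exact Complex.abs_re_le_norm z
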